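/- Let A be a commutative Noetherian ring of Krull dimension d in which d! is invertible, and let R = A[X_1,…,X_n]. Let P be a finitely generated projective R-module of rank d such that P ⊕ R is extended from A. Then P is extended from A. -/

import Mathlib

/-! Statement 14 (Theorem 4.2 / w42): `A` Noetherian of dimension `d` with `d!` invertible,
`R = A[X_1,…,X_n]`, `P` a f.g. projective `R`-module of rank `d` such that `P ⊕ R` is
extended from `A`.  Then `P` is extended from `A`. -/

universe u

open TensorProduct

/-- A finitely generated projective module `P` over an `A`-algebra `B` is *extended from `A`*
if there is a finitely generated projective `A`-module `Q` with `P ≅ B ⊗[A] Q`. -/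
def IsExtendedFrom (A : Type u) (B : Type u) [CommRing A] [CommRing B] [Algebra A B]
    (P : Type u) [AddCommGroup P] [Module B P] : Prop :=
  ∃ (Q : Type u) (_ : AddCommGroup Q) (_ : Module A Q),
    Module.Finite A Q ∧ Module.Projective A Q ∧ Nonempty (P ≃ₗ[B] B ⊗[A] Q)

/-- A module `P` over a commutative ring `B` has (constant) rank `r` if its localization at
every prime of `B` has rank `r`. -/
def HasRank (B : Type u) [CommRing B] (P : Type u) [AddCommGroup P] [Module B P]
    (r : ℕ) : Prop :=
  ∀ 𝔭 : PrimeSpectrum B,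
    Module.finrank (Localization.AtPrime 𝔭.asIdeal)
      (LocalizedModule 𝔭.asIdeal.primeCompl P) = r

/-- An ideal of `A[X_0,…,X_{n-1}]` is a monomial ideal if it is generated by (nonconstant)
monomials in the variables. -/
def IsMonomialIdeal {A : Type u} [CommRing A] {n : ℕ}
    (I : Ideal (MvPolynomial (Fin n) A)) : Prop :=
  ∃ S : Set (MvPolynomial (Fin n) A),
    (∀ p ∈ S, ∃ s : Fin n →₀ ℕ, s ≠ 0 ∧ p = MvPolynomial.monomial s 1) ∧ I = Ideal.span S

/-- `B` is a discrete Hodge `A`-algebra if `B ≅ A[X_0,…,X_n]/I` for some ideal `I`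
generated by monomials. -/
def IsDiscreteHodgeAlgebra (A : Type u) (B : Type u) [CommRing A] [CommRing B]
    [Algebra A B] : Prop :=
  ∃ (n : ℕ) (I : Ideal (MvPolynomial (Fin (n + 1)) A)), IsMonomialIdeal I ∧
    Nonempty ((MvPolynomial (Fin (n + 1)) A ⧸ I) ≃ₐ[A] B)

section Preliminaries

open Matrix

/-- The monoid (in fact group) of elementary matrices. -/
def ElemMat (ι R : Type*) [Fintype ι] [DecidableEq ι] [CommRing R] : Submonoid (Matrix ι ι R) :=
  Submonoid.closure {g | ∃ i j, i ≠ j ∧ ∃ c, g = transvection i j c}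

/-- Two rows are equivalent if they differ by right multiplication by an elementary matrix. -/
def RowEquiv {ι R : Type*} [Fintype ι] [DecidableEq ι] [CommRing R] (v w : ι → R) : Prop :=
  ∃ g ∈ ElemMat ι R, v ᵥ* g = w

/-- Unimodular rows. -/
def Unimod {ι R : Type*} [Fintype ι] [CommRing R] (v : ι → R) : Prop := ∃ w : ι → R, v ⬝ᵥ w = 1

section Elementary

variable {ι κ R S : Type*} [Fintype ι] [DecidableEq ι] [Fintype κ] [DecidableEq κ]
  [CommRing R] [CommRing S]

namespace ElemMat

theorem transvection_mem {i j : ι} (h : i ≠ j) (c : R) : transvection i j c ∈ ElemMat ι R :=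
  Submonoid.subset_closure ⟨i, j, h, c, rfl⟩

theorem exists_inv {g : Matrix ι ι R} (hg : g ∈ ElemMat ι R) :
    ∃ h ∈ ElemMat ι R, g * h = 1 ∧ h * g = 1 := by
  induction hg using Submonoid.closure_induction with
  | mem x hx =>
    obtain ⟨i, j, hij, c, rfl⟩ := hx
    exact ⟨transvection i j (-c), transvection_mem hij _,
      by rw [transvection_mul_transvection_same _ _ hij]; simp,
      by rw [transvection_mul_transvection_same _ _ hij]; simp⟩
  | one => exact ⟨1, one_mem _, by simp, by simp⟩
  | mul x y _ _ hx hy =>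
    obtain ⟨x', hx', h1, h2⟩ := hx
    obtain ⟨y', hy', h3, h4⟩ := hy
    refine ⟨y' * x', mul_mem hy' hx', ?_, ?_⟩
    · rw [mul_assoc, ← mul_assoc y, h3, one_mul, h1]
    · rw [mul_assoc, ← mul_assoc x', h2, one_mul, h4]

theorem mul_mem_cancel_right {g h : Matrix ι ι R} (hg : g ∈ ElemMat ι R) :
    h * g ∈ ElemMat ι R ↔ h ∈ ElemMat ι R := by
  refine ⟨fun H => ?_, fun H => mul_mem H hg⟩
  obtain ⟨k, hk, h1, h2⟩ := exists_inv hg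
  simpa [mul_assoc, h1] using mul_mem H hk

theorem det_eq_one {g : Matrix ι ι R} (hg : g ∈ ElemMat ι R) : g.det = 1 := by
  induction hg using Submonoid.closure_induction with
  | mem x hx =>
    obtain ⟨i, j, hij, c, rfl⟩ := hx
    exact det_transvection_of_ne _ _ hij _
  | one => simp
  | mul x y _ _ hx hy => rw [det_mul, hx, hy, one_mul]

theorem transpose_mem {g : Matrix ι ι R} (hg : g ∈ ElemMat ι R) : gᵀ ∈ ElemMat ι R := by
  induction hg using Submonoid.closure_induction with
  | mem x hx =>
    obtain ⟨i, j, hij, c, rfl⟩ := hx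
    have : (transvection i j c)ᵀ = transvection j i c := by
      simp [transvection, transpose_add]
    rw [this]; exact transvection_mem hij.symm _
  | one => simp
  | mul x y _ _ hx hy => rw [transpose_mul]; exact mul_mem hy hx

theorem map_transvection (f : R →+* S) (i j : ι) (c : R) :
    (transvection i j c).map f = transvection i j (f c) := by
  ext a b
  simp [transvection, single_apply, one_apply, apply_ite f]

theorem map_mem (f : R →+* S) {g : Matrix ι ι R} (hg : g ∈ ElemMat ι R) :
    g.map f ∈ ElemMat ι S := by
  induction hg using Submonoid.closure_induction with
  | mem x hx =>
    obtain ⟨i, j, hij, c, rfl⟩ := hx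
    rw [map_transvection]; exact transvection_mem hij _
  | one => simp
  | mul x y _ _ hx hy => rw [Matrix.map_mul]; exact mul_mem hx hy

theorem exists_lift {f : R →+* S} (hf : Function.Surjective f) {g : Matrix ι ι S}
    (hg : g ∈ ElemMat ι S) : ∃ g' ∈ ElemMat ι R, g'.map f = g := by
  induction hg using Submonoid.closure_induction with
  | mem x hx =>
    obtain ⟨i, j, hij, c, rfl⟩ := hx
    obtain ⟨c', rfl⟩ := hf c
    exact ⟨_, transvection_mem hij c', map_transvection _ _ _ _⟩
  | one => exact ⟨1, one_mem _, by simp⟩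
  | mul x y _ _ hx hy =>
    obtain ⟨x', hx', rfl⟩ := hx
    obtain ⟨y', hy', rfl⟩ := hy
    exact ⟨x' * y', mul_mem hx' hy', Matrix.map_mul⟩

theorem submatrix_mem (e : κ ≃ ι) {g : Matrix ι ι R} (hg : g ∈ ElemMat ι R) :
    g.submatrix e e ∈ ElemMat κ R := by
  induction hg using Submonoid.closure_induction with
  | mem x hx =>
    obtain ⟨i, j, hij, c, rfl⟩ := hx
    have : (transvection i j c).submatrix e e = transvection (e.symm i) (e.symm j) c := by
      ext a b
      simp [transvection, single_apply, one_apply, Equiv.symm_apply_eq]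
    rw [this]; exact transvection_mem (by simpa using hij) _
  | one => simp
  | mul x y _ _ hx hy => rw [← submatrix_mul_equiv _ _ _ e]; exact mul_mem hx hy

theorem submatrix_mem_iff (e : κ ≃ ι) {g : Matrix ι ι R} :
    g.submatrix e e ∈ ElemMat κ R ↔ g ∈ ElemMat ι R := by
  refine ⟨fun h => ?_, submatrix_mem e⟩
  simpa using submatrix_mem e.symm h

theorem fromBlocks_one_mem {g : Matrix ι ι R} (hg : g ∈ ElemMat ι R) :
    fromBlocks g 0 0 (1 : Matrix κ κ R) ∈ ElemMat (ι ⊕ κ) R := by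
  induction hg using Submonoid.closure_induction with
  | mem x hx =>
    obtain ⟨i, j, hij, c, rfl⟩ := hx
    have : fromBlocks (transvection i j c) 0 0 (1 : Matrix κ κ R) =
        transvection (Sum.inl i) (Sum.inl j) c := by
      ext a b
      rcases a with a | a <;> rcases b with b | b <;>
      simp [transvection, single_apply, one_apply]
    rw [this]; exact transvection_mem (by simpa using hij) _
  | one => simp
  | mul x y _ _ hx hy =>
    have := mul_mem hx hy
    simpa [fromBlocks_multiply] using this

theorem one_fromBlocks_mem {g : Matrix ι ι R} (hg : g ∈ ElemMat ι R) :
    fromBlocks (1 : Matrix κ κ R) 0 0 g ∈ ElemMat (κ ⊕ ι) R := by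
  have := submatrix_mem (Equiv.sumComm κ ι) (fromBlocks_one_mem (κ := κ) hg)
  simpa [Equiv.sumComm] using this

/-- `1 + M` is elementary if the row and column supports of `M` are separated. -/
theorem one_add_mem_of_separated (M : Matrix ι ι R) (p : ι → Prop)
    (hM : ∀ i j, M i j ≠ 0 → p i ∧ ¬ p j) : 1 + M ∈ ElemMat ι R := by
  classical
  have key : ∀ s : Finset (ι × ι),
      1 + (∑ x ∈ s, single x.1 x.2 (M x.1 x.2)) ∈ ElemMat ι R := by
    intro s
    induction s using Finset.induction_on with
    | empty => simp
    | insert x s hx ih =>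
      by_cases h0 : M x.1 x.2 = 0
      · rw [Finset.sum_insert hx, h0]; simpa using ih
      have hx1 := hM _ _ h0
      have hne : x.1 ≠ x.2 := fun h => hx1.2 (h ▸ hx1.1)
      have h1 := mul_mem ih (transvection_mem hne (M x.1 x.2))
      have h2 : (∑ y ∈ s, single y.1 y.2 (M y.1 y.2)) * single x.1 x.2 (M x.1 x.2) = 0 := by
        rw [Finset.sum_mul]
        refine Finset.sum_eq_zero fun y _ => ?_
        by_cases hy : M y.1 y.2 = 0
        · simp [hy]
        have : y.2 ≠ x.1 := fun h => (hM _ _ hy).2 (h ▸ hx1.1)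
        exact single_mul_single_of_ne (h := this) ..
      rw [transvection, add_mul, one_mul, mul_add, mul_one, h2, add_zero] at h1
      rw [Finset.sum_insert hx]
      convert h1 using 1
      abel
  have := key Finset.univ
  convert this using 2
  rw [Fintype.sum_prod_type]
  exact matrix_eq_sum_single M

theorem upper_mem (x : Matrix ι κ R) : fromBlocks 1 x 0 1 ∈ ElemMat (ι ⊕ κ) R := by
  have : fromBlocks 1 x 0 1 = (1 : Matrix (ι ⊕ κ) (ι ⊕ κ) R) + fromBlocks 0 x 0 0 := by
    rw [← fromBlocks_one, fromBlocks_add]; simp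
  rw [this]
  refine one_add_mem_of_separated _ (fun i => i.isLeft) fun i j h => ?_
  rcases i with i | i <;> rcases j with j | j <;> simp_all

theorem lower_mem (x : Matrix κ ι R) : fromBlocks 1 0 x 1 ∈ ElemMat (ι ⊕ κ) R := by
  have := transpose_mem (upper_mem xᵀ)
  simpa [fromBlocks_transpose] using this

theorem vecMulVec_disjoint (y v : ι → R) (h : ∀ i, y i = 0 ∨ v i = 0) :
    1 + vecMulVec y v ∈ ElemMat ι R := by
  refine one_add_mem_of_separated _ (fun i => y i ≠ 0) fun i j hij => ?_
  rw [vecMulVec_apply] at hij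
  refine ⟨left_ne_zero_of_mul hij, ?_⟩
  rcases h j with h | h
  · simpa using h
  · simp [h] at hij

theorem one_add_vecMulVec_mul (y v y' v' : ι → R) (h : v ⬝ᵥ y' = 0) :
    (1 + vecMulVec y v) * (1 + vecMulVec y' v') = 1 + vecMulVec y v + vecMulVec y' v' := by
  rw [add_mul, one_mul, mul_add, mul_one, vecMulVec_mul_vecMulVec, h]
  simp only [zero_smul, vecMulVec_zero]
  abel

theorem vecMulVec_of_coord_zero (y v : ι → R) (h : v ⬝ᵥ y = 0) (k : ι) (hk : v k = 0) :
    1 + vecMulVec y v ∈ ElemMat ι R := by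
  set y' := y - Pi.single k (y k) with hy'
  have hyk : y' k = 0 := by simp [hy']
  have hvy' : v ⬝ᵥ y' = 0 := by simp [hy', dotProduct_sub, h, hk]
  have h1 : 1 + vecMulVec y v = (1 + vecMulVec y' v) * (1 + vecMulVec (Pi.single k (y k)) v) := by
    rw [one_add_vecMulVec_mul _ _ _ _ (by simp [hk]), add_assoc, ← add_vecMulVec]
    simp [hy']
  rw [h1]
  refine mul_mem ?_ (vecMulVec_disjoint _ _ fun i => ?_)
  · have e1 : 1 + vecMulVec y' (Pi.single k 1) ∈ ElemMat ι R :=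
      vecMulVec_disjoint _ _ fun i => by
        by_cases hi : i = k
        · subst hi; left; exact hyk
        · right; simp [hi]
    have e2 : 1 + vecMulVec (Pi.single k 1) v ∈ ElemMat ι R :=
      vecMulVec_disjoint _ _ fun i => by
        by_cases hi : i = k
        · subst hi; right; exact hk
        · left; simp [hi]
    have e3 : 1 + vecMulVec (-y') (Pi.single k 1) ∈ ElemMat ι R :=
      vecMulVec_disjoint _ _ fun i => by
        by_cases hi : i = k
        · subst hi; left; simp [hyk]
        · right; simp [hi]
    have e4 : 1 + vecMulVec (-Pi.single k 1) v ∈ ElemMat ι R :=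
      vecMulVec_disjoint _ _ fun i => by
        by_cases hi : i = k
        · subst hi; right; exact hk
        · left; simp [hi]
    have := mul_mem (mul_mem e1 e2) (mul_mem e3 e4)
    convert this using 1
    simp only [mul_add, add_mul, one_mul, mul_one, vecMulVec_mul_vecMulVec, neg_vecMulVec,
      mul_neg, neg_mul]
    simp [hyk, hk, hvy']
    abel
  · by_cases hi : i = k
    · subst hi; right; exact hk
    · left; simp [hi]

theorem vecMulVec_of_unimod (hι : 3 ≤ Fintype.card ι) (y u : ι → R) (hy : Unimod y)
    (h : u ⬝ᵥ y = 0) : 1 + vecMulVec y u ∈ ElemMat ι R := by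
  obtain ⟨w, hw⟩ := hy
  let r : ι × ι → ι → R := fun x =>
    (u x.2 * w x.1) • (Pi.single x.2 (y x.1) - Pi.single x.1 (y x.2))
  have hr : ∀ x, r x ⬝ᵥ y = 0 := by
    intro x
    simp [r, smul_dotProduct, sub_dotProduct]
    ring
  have hmem : ∀ x, 1 + vecMulVec y (r x) ∈ ElemMat ι R := by
    intro x
    obtain ⟨k, hk⟩ : ∃ k, k ∉ ({x.1, x.2} : Finset ι) := by
      by_contra! hc
      have h1 : Finset.univ ⊆ ({x.1, x.2} : Finset ι) := fun k _ => hc k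
      have h2 := (Finset.card_le_card h1).trans (Finset.card_le_two)
      rw [Finset.card_univ] at h2
      omega
    simp only [Finset.mem_insert, Finset.mem_singleton, not_or] at hk
    exact vecMulVec_of_coord_zero _ _ (hr x) k (by simp [r, hk.1, hk.2])
  have key : ∀ s : Finset (ι × ι), 1 + vecMulVec y (∑ x ∈ s, r x) ∈ ElemMat ι R := by
    intro s
    induction s using Finset.induction_on with
    | empty => simp
    | insert x s hx ih =>
      have := mul_mem (hmem x) ih
      rwa [one_add_vecMulVec_mul _ _ _ _ (hr x), add_assoc, ← vecMulVec_add,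
        ← Finset.sum_insert hx] at this
  have hu : u = ∑ x, r x := by
    ext a
    simp only [Finset.sum_apply, r, Pi.smul_apply, Pi.sub_apply, smul_eq_mul, mul_sub,
      Finset.sum_sub_distrib]
    rw [Fintype.sum_prod_type, Fintype.sum_prod_type]
    simp only [Pi.single_apply, mul_ite, mul_zero, Finset.sum_ite_eq, Finset.mem_univ, if_true]
    have h1 : ∑ i, u a * w i * y i = u a := by
      simp only [dotProduct] at hw
      calc ∑ i, u a * w i * y i = u a * ∑ i, y i * w i := by
            rw [Finset.mul_sum]; exact Finset.sum_congr rfl fun _ _ => by ring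
        _ = u a := by rw [hw, mul_one]
    have h2 : ∑ i, ∑ j, (if a = i then u j * w i * y j else 0) = 0 := by
      rw [Finset.sum_comm]
      simp only [Finset.sum_ite_eq, Finset.mem_univ, if_true]
      simp only [dotProduct] at h
      calc ∑ j, u j * w a * y j = w a * ∑ j, u j * y j := by
            rw [Finset.mul_sum]; exact Finset.sum_congr rfl fun _ _ => by ring
        _ = 0 := by rw [h, mul_zero]
    rw [h1, h2, sub_zero]
  rw [hu]
  exact key _

theorem conj_mem (hι : 3 ≤ Fintype.card ι) {g h e : Matrix ι ι R} (hgh : g * h = 1)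
    (he : e ∈ ElemMat ι R) : g * e * h ∈ ElemMat ι R := by
  have hhg : h * g = 1 := mul_eq_one_comm.mp hgh
  induction he using Submonoid.closure_induction with
  | mem x hx =>
    obtain ⟨i, j, hij, c, rfl⟩ := hx
    have h1 : g * transvection i j c * h =
        1 + vecMulVec (fun a => g a i) (fun b => c * h j b) := by
      rw [transvection, mul_add, mul_one, add_mul, hgh]
      congr 1
      ext a b
      simp [vecMulVec_apply, mul_apply, single_apply, ite_and]
      ring
    rw [h1]
    refine vecMulVec_of_unimod hι _ _ ⟨fun a => h i a, ?_⟩ ?_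
    · have := congrFun (congrFun hhg i) i
      simp only [mul_apply, one_apply_eq] at this
      rw [dotProduct_comm]; exact this
    · have := congrFun (congrFun hhg j) i
      simp only [mul_apply, one_apply_ne hij.symm] at this
      simp only [dotProduct, mul_assoc, ← Finset.mul_sum, this, mul_zero]
  | one => simpa using hgh ▸ one_mem _
  | mul x y _ _ hx hy =>
    have := mul_mem hx hy
    convert this using 1
    calc g * (x * y) * h = g * x * (h * g) * y * h := by rw [hhg]; simp [mul_assoc]
      _ = _ := by simp only [mul_assoc]

end ElemMat
end Elementary

section RowOps

variable {ι κ R S : Type*} [Fintype ι] [DecidableEq ι] [Fintype κ] [DecidableEq κ]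
  [CommRing R] [CommRing S]

theorem RowEquiv.refl (v : ι → R) : RowEquiv v v := ⟨1, one_mem _, by simp⟩

theorem RowEquiv.symm {v w : ι → R} (h : RowEquiv v w) : RowEquiv w v := by
  obtain ⟨g, hg, rfl⟩ := h
  obtain ⟨k, hk, h1, h2⟩ := ElemMat.exists_inv hg
  exact ⟨k, hk, by rw [vecMul_vecMul, h1, vecMul_one]⟩

theorem RowEquiv.trans {u v w : ι → R} (h : RowEquiv u v) (h' : RowEquiv v w) : RowEquiv u w := by
  obtain ⟨g, hg, rfl⟩ := h
  obtain ⟨k, hk, rfl⟩ := h'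
  exact ⟨g * k, mul_mem hg hk, by rw [vecMul_vecMul]⟩

theorem Unimod.vecMul {v : ι → R} (hv : Unimod v) {g h : Matrix ι ι R} (hgh : g * h = 1) :
    Unimod (v ᵥ* g) := by
  obtain ⟨w, hw⟩ := hv
  exact ⟨h *ᵥ w, by rw [← dotProduct_mulVec, mulVec_mulVec, hgh, one_mulVec, hw]⟩

theorem Unimod.of_rowEquiv {v w : ι → R} (hv : Unimod v) (h : RowEquiv v w) : Unimod w := by
  obtain ⟨g, hg, rfl⟩ := h
  obtain ⟨k, hk, h1, h2⟩ := ElemMat.exists_inv hg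
  exact hv.vecMul h1

theorem Unimod.map {v : ι → R} (hv : Unimod v) (f : R →+* S) : Unimod (f ∘ v) := by
  obtain ⟨w, hw⟩ := hv
  exact ⟨f ∘ w, by rw [← RingHom.map_dotProduct, hw, map_one]⟩

theorem RowEquiv.map {v w : ι → R} (h : RowEquiv v w) (f : R →+* S) : RowEquiv (f ∘ v) (f ∘ w) := by
  obtain ⟨g, hg, rfl⟩ := h
  exact ⟨g.map f, ElemMat.map_mem f hg, by ext; simp [RingHom.map_vecMul]⟩

theorem RowEquiv.exists_lift {f : R →+* S} (hf : Function.Surjective f) {v : ι → R} {w : ι → S}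
    (h : RowEquiv (f ∘ v) w) : ∃ w', RowEquiv v w' ∧ f ∘ w' = w := by
  obtain ⟨g, hg, rfl⟩ := h
  obtain ⟨g', hg', rfl⟩ := ElemMat.exists_lift hf hg
  exact ⟨_, ⟨g', hg', rfl⟩, by ext; simp [RingHom.map_vecMul]⟩

theorem RowEquiv.comp_equiv {v w : ι → R} (h : RowEquiv v w) (e : κ ≃ ι) :
    RowEquiv (v ∘ e) (w ∘ e) := by
  obtain ⟨g, hg, rfl⟩ := h
  refine ⟨g.submatrix e e, ElemMat.submatrix_mem e hg, ?_⟩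
  rw [Matrix.submatrix_vecMul_equiv]
  congr 2
  ext; simp

theorem RowEquiv.of_comp_equiv {v w : ι → R} (e : κ ≃ ι) (h : RowEquiv (v ∘ e) (w ∘ e)) :
    RowEquiv v w := by
  simpa [Function.comp_assoc] using h.comp_equiv e.symm

theorem RowEquiv.sumElim {v w : ι → R} (h : RowEquiv v w) (c : κ → R) :
    RowEquiv (Sum.elim v c) (Sum.elim w c) := by
  obtain ⟨g, hg, rfl⟩ := h
  exact ⟨_, ElemMat.fromBlocks_one_mem hg, by simp [vecMul_fromBlocks]⟩

theorem Unimod.comp_equiv {v : ι → R} (h : Unimod v) (e : κ ≃ ι) : Unimod (v ∘ e) := by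
  obtain ⟨w, hw⟩ := h
  exact ⟨w ∘ e, by rw [← hw]; exact Equiv.sum_comp e fun i => v i * w i⟩

theorem unimod_iff_span {v : ι → R} : Unimod v ↔ Ideal.span (Set.range v) = ⊤ := by
  rw [Ideal.eq_top_iff_one, Ideal.mem_span_range_iff_exists_fun]
  simp only [Unimod, dotProduct, mul_comm]

theorem Unimod.exists_notMem {v : ι → R} (h : Unimod v) {I : Ideal R} (hI : I ≠ ⊤) :
    ∃ i, v i ∉ I := by
  by_contra! hc
  obtain ⟨w, hw⟩ := h
  exact hI ((Ideal.eq_top_iff_one _).mpr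
    (hw ▸ Ideal.sum_mem _ fun i _ => Ideal.mul_mem_right _ _ (hc i)))

theorem unimod_of_forall_prime {v : ι → R} (h : ∀ p : Ideal R, p.IsPrime → ∃ i, v i ∉ p) :
    Unimod v := by
  rw [unimod_iff_span]
  by_contra hc
  obtain ⟨m, hm, hle⟩ := Ideal.exists_le_maximal _ hc
  obtain ⟨i, hi⟩ := h m hm.isPrime
  exact hi (hle (Ideal.subset_span ⟨i, rfl⟩))

theorem unimod_of_apply_eq_one {v : ι → R} {i : ι} (h : IsUnit (v i)) : Unimod v := by
  obtain ⟨u, hu⟩ := h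
  exact ⟨Pi.single i (↑u⁻¹), by simp [← hu]⟩

theorem RowEquiv.one_add_vecMulVec {y u : ι → R} (h : 1 + vecMulVec y u ∈ ElemMat ι R)
    (v : ι → R) : RowEquiv v (v + (v ⬝ᵥ y) • u) :=
  ⟨_, h, by rw [vecMul_add, vecMul_one, vecMul_vecMulVec]⟩

theorem RowEquiv.of_dvd {v w : ι → R} (k : ι) (hk : w k = v k) (h : ∀ i, v k ∣ w i - v i) :
    RowEquiv v w := by
  choose c hc using h
  have := RowEquiv.one_add_vecMulVec (ElemMat.vecMulVec_disjoint (Pi.single k 1)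
    (fun i => if i = k then 0 else c i) fun i => by
      by_cases hi : i = k
      · right; simp [hi]
      · left; simp [hi]) v
  convert this using 1
  ext i
  by_cases hi : i = k
  · subst hi; simp [hk]
  · simp [hi, ← hc]

theorem RowEquiv.add_single {v : ι → R} (k : ι) (c : ι → R) (hc : c k = 0) :
    RowEquiv v (v + Pi.single k (v ⬝ᵥ c)) := by
  have := RowEquiv.one_add_vecMulVec (ElemMat.vecMulVec_disjoint c
    (Pi.single k 1) fun i => by
      by_cases hi : i = k
      · left; simp [hi, hc]
      · right; simp [hi]) v
  convert this using 1
  ext i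
  by_cases hi : i = k
  · subst hi; simp
  · simp [hi]

theorem RowEquiv.update_of_mem {v : ι → R} (k : ι) {x : R}
    (hx : x - v k ∈ Ideal.span (v '' {k}ᶜ)) : RowEquiv v (Function.update v k x) := by
  obtain ⟨c, hc⟩ : ∃ c : ι → R, c k = 0 ∧ v ⬝ᵥ c = x - v k := by
    refine Submodule.span_induction (p := fun y _ => ∃ c : ι → R, c k = 0 ∧ v ⬝ᵥ c = y)
      ?_ ?_ ?_ ?_ hx
    · rintro _ ⟨i, hi, rfl⟩
      have hi' : k ≠ i := fun h => hi h.symm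
      exact ⟨Pi.single i 1, by simp [hi'], by simp⟩
    · exact ⟨0, by simp, by simp⟩
    · rintro y z _ _ ⟨c, h1, h2⟩ ⟨d, h3, h4⟩
      exact ⟨c + d, by simp [h1, h3], by rw [dotProduct_add, h2, h4]⟩
    · rintro a y _ ⟨c, h1, h2⟩
      exact ⟨a • c, by simp [h1], by rw [dotProduct_smul, h2]⟩
  have := RowEquiv.add_single (v := v) k c hc.1
  convert this using 1
  ext i
  by_cases hi : i = k
  · subst hi; simp [hc.2]
  · simp [hi]

theorem RowEquiv.update_add (v : ι → R) {i j : ι} (hij : i ≠ j) (a : R) :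
    RowEquiv v (Function.update v j (v j + a * v i)) := by
  refine RowEquiv.update_of_mem j ?_
  simp only [add_sub_cancel_left]
  exact Ideal.mul_mem_left _ _ (Ideal.subset_span ⟨i, hij, rfl⟩)

theorem RowEquiv.single_of_apply_eq_one {v : ι → R} {i : ι} (h : v i = 1) :
    RowEquiv v (Pi.single i 1) :=
  RowEquiv.of_dvd i (by simp [h]) fun j => by simp [h]

theorem RowEquiv.single_of_span {v : ι → R} (i : ι) (h : Ideal.span (v '' {i}ᶜ) = ⊤) :
    RowEquiv v (Pi.single i 1) :=
  (RowEquiv.update_of_mem (x := 1) i (by simp [h])).trans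
    (RowEquiv.single_of_apply_eq_one (by simp))

theorem RowEquiv.single_of_isUnit {v : ι → R} {i j : ι} (h : IsUnit (v i)) (hij : i ≠ j) :
    RowEquiv v (Pi.single j 1) :=
  RowEquiv.single_of_span j (Ideal.eq_top_of_isUnit_mem _ (Ideal.subset_span ⟨i, hij, rfl⟩) h)

theorem RowEquiv.single_single (i j : ι) :
    RowEquiv (Pi.single i 1 : ι → R) (Pi.single j 1) := by
  by_cases hij : i = j
  · subst hij; exact RowEquiv.refl _
  · exact RowEquiv.single_of_isUnit (i := i) (by simp) hij

/-- Scaling two entries by mutually inverse factors modulo a third entry. -/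
theorem RowEquiv.scale_pair (v : ι → R) {i j k : ι} (hij : i ≠ j) (hik : i ≠ k) (hjk : j ≠ k)
    {t t' : R} (ht : v k ∣ t * t' - 1) :
    RowEquiv v (Function.update (Function.update v i (t * v i)) j (t' * v j)) := by
  set z1 := v j + t * v i with hz1
  set y1 := v i - t' * z1 with hy1
  set z2 := z1 + (t - 1) * y1 with hz2
  set y2 := y1 + z2 with hy2
  set z3 := z2 - y2 with hz3
  have h1 := RowEquiv.update_add v hij t
  have h2 := RowEquiv.update_add (Function.update v j z1) hij.symm (-t')
  have h3 := RowEquiv.update_add (Function.update (Function.update v j z1) i y1) hij (t - 1)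
  have h4 := RowEquiv.update_add (Function.update (Function.update (Function.update v j z1) i y1)
    j z2) hij.symm 1
  have h5 := RowEquiv.update_add (Function.update (Function.update (Function.update
    (Function.update v j z1) i y1) j z2) i y2) hij (-1)
  simp only [Function.update_self, Function.update_of_ne hij, Function.update_of_ne hij.symm]
    at h1 h2 h3 h4 h5
  have e2 : v i + -t' * z1 = y1 := by rw [hy1]; ring
  have e4 : y1 + 1 * z2 = y2 := by rw [hy2]; ring
  have e5 : z2 + -1 * y2 = z3 := by rw [hz3]; ring
  rw [e2] at h2
  rw [← hz2] at h3
  rw [e4] at h4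
  rw [e5] at h5
  refine ((((h1.trans h2).trans h3).trans h4).trans h5).trans (RowEquiv.of_dvd k ?_ fun l => ?_)
  · simp [hik.symm, hjk.symm]
  · obtain ⟨s, hs⟩ := ht
    have hk : Function.update (Function.update (Function.update (Function.update
        (Function.update v j z1) i y1) j z2) i y2) j z3 k = v k := by
      simp [hik.symm, hjk.symm]
    rw [hk]
    by_cases hlj : l = j
    · subst hlj
      simp only [Function.update_self]
      refine ⟨s * (- v i), ?_⟩
      rw [← mul_assoc, ← hs, hz3, hy2, hz2, hy1, hz1]
      ring
    by_cases hli : l = i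
    · subst hli
      simp only [Function.update_self, Function.update_of_ne hij]
      refine ⟨s * (z1), ?_⟩
      rw [← mul_assoc, ← hs, hy2, hz2, hy1, hz1]
      ring
    · simp [hli, hlj]

end RowOps

section StableRange

variable {R S : Type*} [CommRing R] [CommRing S]

/-- All prime ideals have height at most `e`. -/
def HeightLE (R : Type*) [CommRing R] (e : ℕ) : Prop :=
  ∀ p : Ideal R, p.IsPrime → p.height ≤ e

/-- Unimodular rows of length more than `n` can be shortened. -/
def StableRange (R : Type*) [CommRing R] (n : ℕ) : Prop :=
  ∀ (ι : Type) [Fintype ι], n ≤ Fintype.card ι → ∀ (v : ι → R) (a : R),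
    Ideal.span (Set.range v) ⊔ Ideal.span {a} = ⊤ → ∃ c : ι → R, Unimod fun i => v i + c i * a

theorem exists_add_mul_notMem_primes (T : Finset (Ideal R)) (hT : ∀ p ∈ T, p.IsPrime) (x a : R) :
    ∃ c, ∀ p ∈ T, x + c * a ∈ p → a ∈ p := by
  classical
  induction T using Finset.strongInduction with
  | H T ih =>
    rcases T.eq_empty_or_nonempty with rfl | hne
    · exact ⟨0, by simp⟩
    obtain ⟨p, hpT, hmin⟩ := T.exists_minimal hne
    obtain ⟨c, hc⟩ := ih (T.erase p) (Finset.erase_ssubset hpT)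
      fun q hq => hT q (Finset.mem_of_mem_erase hq)
    by_cases hx : x + c * a ∈ p ∧ a ∉ p
    · have hp := hT p hpT
      have : ¬ (∏ q ∈ T.erase p, q) ≤ p := by
        rw [hp.prod_le]
        rintro ⟨q, hq, hqp⟩
        exact Finset.ne_of_mem_erase hq (le_antisymm hqp (hmin (Finset.mem_of_mem_erase hq) hqp))
      obtain ⟨e, he, hep⟩ := SetLike.not_le_iff_exists.mp this
      refine ⟨c + e, fun q hq hmem => ?_⟩
      have hrw : x + (c + e) * a = (x + c * a) + e * a := by ring
      rw [hrw] at hmem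
      by_cases hqp : q = p
      · subst hqp
        exact absurd ((hp.mem_or_mem ((Ideal.add_mem_iff_right _ hx.1).mp hmem))) (by
          simp [hep, hx.2])
      · have hqe : q ∈ T.erase p := Finset.mem_erase.mpr ⟨hqp, hq⟩
        refine hc q hqe ((Ideal.add_mem_iff_left _ ?_).mp hmem)
        exact Ideal.mul_mem_right _ _ (Ideal.le_of_dvd (Finset.dvd_prod_of_mem _ hqe) he)
    · refine ⟨c, fun q hq hmem => ?_⟩
      by_cases hqp : q = p
      · subst hqp
        by_contra hh
        exact hx ⟨hmem, hh⟩
      · exact hc q (Finset.mem_erase.mpr ⟨hqp, hq⟩) hmem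

theorem exists_add_mul_height [IsNoetherianRing R] {ι : Type*} (v : ι → R) (a : R)
    (s : Finset ι) :
    ∃ c : ι → R, ∀ p : Ideal R, p.IsPrime → (∀ i ∈ s, v i + c i * a ∈ p) →
      a ∈ p ∨ (s.card : ℕ∞) ≤ p.height := by
  classical
  induction s using Finset.induction_on with
  | empty => exact ⟨0, fun p _ _ => Or.inr (by simp)⟩
  | insert k s hk ih =>
    obtain ⟨c, hc⟩ := ih
    set J := Ideal.span ((fun i => v i + c i * a) '' s) with hJ
    have hfin := J.finite_minimalPrimes_of_isNoetherianRing
    obtain ⟨x, hx⟩ := exists_add_mul_notMem_primes hfin.toFinset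
      (fun p hp => (hfin.mem_toFinset.mp hp).1.1) (v k) a
    refine ⟨Function.update c k x, fun p hp hmem => ?_⟩
    by_cases ha : a ∈ p
    · exact Or.inl ha
    right
    have hJp : J ≤ p := by
      rw [hJ, Ideal.span_le]
      rintro _ ⟨i, hi, rfl⟩
      have := hmem i (Finset.mem_insert_of_mem hi)
      rwa [Function.update_of_ne (by rintro rfl; exact hk hi)] at this
    obtain ⟨q, hq, hqp⟩ := Ideal.exists_minimalPrimes_le hJp
    have hqprime := hq.1.1
    have haq : a ∉ q := fun h => ha (hqp h)
    have hlt : q < p := by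
      refine lt_of_le_of_ne hqp ?_
      rintro rfl
      have := hmem k (Finset.mem_insert_self _ _)
      rw [Function.update_self] at this
      exact haq (hx q (hfin.mem_toFinset.mpr hq) this)
    have h1 := (hc q hqprime fun i hi => hq.1.2 (Ideal.subset_span ⟨i, hi, rfl⟩)).resolve_left haq
    have h2 := Ideal.height_add_one_le_of_lt_of_isPrime hlt
    rw [Finset.card_insert_of_notMem hk]
    push_cast
    exact (add_le_add_left h1 1).trans h2

theorem StableRange.of_heightLE [IsNoetherianRing R] {e : ℕ} (h : HeightLE R e) :
    StableRange R (e + 1) := by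
  classical
  intro ι _ hι v a hva
  obtain ⟨c, hc⟩ := exists_add_mul_height v a Finset.univ
  refine ⟨c, unimod_of_forall_prime fun p hp => ?_⟩
  by_contra! hcon
  rcases hc p hp fun i _ => hcon i with ha | hht
  · apply hp.ne_top
    rw [eq_top_iff, ← hva, sup_le_iff, Ideal.span_le, Ideal.span_singleton_le_iff_mem]
    refine ⟨?_, ha⟩
    rintro _ ⟨i, rfl⟩
    exact (Ideal.add_mem_iff_left _ (Ideal.mul_mem_left _ _ ha)).mp (hcon i)
  · have := hht.trans (h p hp)
    rw [Finset.card_univ] at this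
    have h3 : Fintype.card ι ≤ e := by exact_mod_cast this
    omega

theorem StableRange.mono {m n : ℕ} (h : StableRange R m) (hmn : m ≤ n) : StableRange R n :=
  fun ι _ hι => h ι (hmn.trans hι)

theorem StableRange.of_surjective {n : ℕ} (h : StableRange R n) (f : R →+* S)
    (hf : Function.Surjective f) : StableRange S n := by
  classical
  intro ι _ hι v a hva
  choose w hw using fun i => hf (v i)
  obtain ⟨a, rfl⟩ := hf a
  obtain ⟨x, hx, y, hy, hxy⟩ := Submodule.mem_sup.mp ((Ideal.eq_top_iff_one _).mp hva)
  obtain ⟨b, rfl⟩ := Ideal.mem_span_singleton'.mp hy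
  obtain ⟨g, rfl⟩ := Ideal.mem_span_range_iff_exists_fun.mp hx
  choose g' hg' using fun i => hf (g i)
  obtain ⟨b, rfl⟩ := hf b
  obtain ⟨c, hc⟩ := h ι hι w (1 - ∑ i, g' i * w i) (by
    rw [Ideal.eq_top_iff_one]
    have : (1 : R) = ∑ i, g' i * w i + (1 - ∑ i, g' i * w i) := by ring
    rw [this]
    exact Submodule.add_mem_sup ((Ideal.mem_span_range_iff_exists_fun).mpr ⟨g', rfl⟩)
      (by simp))
  refine ⟨fun i => f (c i) * f b, ?_⟩
  convert hc.map f using 1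
  ext i
  have : f (1 - ∑ i, g' i * w i) = f b * f a := by
    rw [map_sub, map_one, map_sum, ← hxy]
    simp [hw, hg']
  simp only [Function.comp, map_add, map_mul, this, hw]
  ring

theorem Unimod.rowEquiv_single {n : ℕ} (h : StableRange R n) {ι : Type} [Fintype ι] [DecidableEq ι]
    (hι : n < Fintype.card ι) {v : ι → R} (hv : Unimod v) (i : ι) :
    RowEquiv v (Pi.single i 1) := by
  obtain ⟨c, hc⟩ := h {j : ι // j ≠ i} (by
    rw [Fintype.card_subtype_compl, Fintype.card_subtype_eq]; omega) (fun j => v j) (v i) (by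
      rw [eq_top_iff, ← unimod_iff_span.mp hv, Ideal.span_le]
      rintro _ ⟨j, rfl⟩
      by_cases hj : j = i
      · subst hj
        exact Ideal.mem_sup_right (Ideal.mem_span_singleton_self _)
      · exact Ideal.mem_sup_left (Ideal.subset_span ⟨⟨j, hj⟩, rfl⟩))
  set w : ι → R := fun j => if hj : j = i then v i else v j + c ⟨j, hj⟩ * v i with hw
  refine (RowEquiv.of_dvd (w := w) i (by simp [hw]) fun j => ?_).trans
    (RowEquiv.single_of_span i ?_)
  · by_cases hj : j = i
    · simp [hw, hj]
    · simp [hw, hj]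
  · rw [eq_top_iff, ← unimod_iff_span.mp hc, Ideal.span_le]
    rintro _ ⟨⟨j, hj⟩, rfl⟩
    exact Ideal.subset_span ⟨j, hj, by simp [hw, hj]⟩

end StableRange

section MonicLocalization

open Polynomial

variable {A B : Type*} [CommRing A] [CommRing B]

attribute [local instance] Polynomial.algebra Polynomial.isLocalization in
theorem height_le_height_comap_C_add_one [IsNoetherianRing A] (P : Ideal A[X]) [P.IsPrime] :
    P.height ≤ (P.under A).height + 1 := by
  set p := P.under A
  have disj : Disjoint (p.primeCompl.map C : Set A[X]) P := by
    refine Set.disjoint_left.mpr fun a ⟨b, hb⟩ ha ↦ hb.1 ?_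
    rw [← hb.2] at ha
    exact ha
  let Ap := Localization.AtPrime p
  let P' : Ideal Ap[X] := P.map (algebraMap A[X] Ap[X])
  have : P'.IsPrime := IsLocalization.isPrime_of_isPrime_disjoint (p.primeCompl.map C) _ P ‹_› disj
  have h1 : P'.height = P.height := IsLocalization.height_map_of_disjoint (p.primeCompl.map C) P disj
  have h2 := Ideal.height_le_ringKrullDim_of_isPrime (I := P')
  rw [h1, Polynomial.ringKrullDim_of_isNoetherianRing,
    IsLocalization.AtPrime.ringKrullDim_eq_height p Ap] at h2
  exact_mod_cast h2

theorem height_le_of_forall_not_monic [IsNoetherianRing A] {e : ℕ} (h : HeightLE A e)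
    (P : Ideal A[X]) [hPp : P.IsPrime] (hP : ∀ f ∈ P, ¬ f.Monic) : P.height ≤ e := by
  set p := P.under A with hp
  have hle : p.map (algebraMap A A[X]) ≤ P := Ideal.map_comap_le
  by_cases hmax : p.IsMaximal
  · have heq : P = p.map C := by
      refine le_antisymm ?_ hle
      by_contra hcon
      obtain ⟨f, hf, hfp⟩ := SetLike.not_le_iff_exists.mp hcon
      let _ := Ideal.Quotient.field p
      set fb : (A ⧸ p)[X] := f.map (Ideal.Quotient.mk p) with hfb
      have hfb0 : fb ≠ 0 := by
        intro h0
        apply hfp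
        rw [Ideal.mem_map_C_iff]
        intro n
        have := congrArg (fun q => q.coeff n) h0
        simpa [hfb, coeff_map, Ideal.Quotient.eq_zero_iff_mem] using this
      obtain ⟨g, hg⟩ := Polynomial.map_surjective _ (Ideal.Quotient.mk_surjective (I := p))
        (C fb.leadingCoeff⁻¹)
      have hmon : (fb * C fb.leadingCoeff⁻¹).Monic := monic_mul_leadingCoeff_inv hfb0
      have hlift : fb * C fb.leadingCoeff⁻¹ ∈ lifts (Ideal.Quotient.mk p) := by
        rw [mem_lifts]
        exact ⟨f * g, by rw [Polynomial.map_mul, hg]⟩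
      obtain ⟨q, hq, _, hqm⟩ := lifts_and_natDegree_eq_and_monic hlift hmon
      refine hP q ?_ hqm
      have : q - f * g ∈ p.map C := by
        rw [Ideal.mem_map_C_iff]
        intro n
        rw [← Ideal.Quotient.eq_zero_iff_mem, ← coeff_map, Polynomial.map_sub, hq,
          Polynomial.map_mul, hg, sub_self, coeff_zero]
      have h2 := Ideal.add_mem _ (hle this) (P.mul_mem_right g hf)
      simpa using h2
    rw [heq, height_map_C]
    exact h p inferInstance
  · have hpp : p.IsPrime := inferInstance
    obtain ⟨m, hm, hpm⟩ := Ideal.exists_le_maximal p hpp.ne_top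
    have hlt : p < m := lt_of_le_of_ne hpm (by rintro rfl; exact hmax hm)
    exact ((height_le_height_comap_C_add_one P).trans
      (Ideal.height_add_one_le_of_lt_of_isPrime hlt)).trans (h m hm.isPrime)

/-- The multiplicative set of monic polynomials. -/
def monics (A : Type*) [CommRing A] : Submonoid A[X] where
  carrier := {f | f.Monic}
  one_mem' := monic_one
  mul_mem' := fun hf hg => hf.mul hg

/-- The localization of `A[X]` at the monic polynomials. -/
abbrev MonicLoc (A : Type*) [CommRing A] := Localization (monics A)

theorem HeightLE.monicLoc [IsNoetherianRing A] {e : ℕ} (h : HeightLE A e) :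
    HeightLE (MonicLoc A) e := by
  intro P hP
  rw [← IsLocalization.height_under (monics A)]
  have : (P.under A[X]).IsPrime := inferInstance
  refine height_le_of_forall_not_monic h _ fun f hf hm => ?_
  exact hP.ne_top (Ideal.eq_top_of_isUnit_mem _ hf
    (IsLocalization.map_units (MonicLoc A) (⟨f, hm⟩ : monics A)))

instance [IsNoetherianRing A] : IsNoetherianRing (MonicLoc A) :=
  IsLocalization.isNoetherianRing (monics A) _ inferInstance

theorem monics_le_comap (f : A →+* B) : monics A ≤ (monics B).comap (mapRingHom f) :=
  fun _ hp => Monic.map f hp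

/-- Functoriality of `MonicLoc`. -/
noncomputable def MonicLoc.map (f : A →+* B) : MonicLoc A →+* MonicLoc B :=
  IsLocalization.map (MonicLoc B) (mapRingHom f) (monics_le_comap f)

theorem MonicLoc.map_algebraMap (f : A →+* B) (p : A[X]) :
    MonicLoc.map f (algebraMap _ _ p) = algebraMap _ _ (p.map f) := by
  simp [MonicLoc.map]

theorem exists_monic_map_eq {f : A →+* B} (hf : Function.Surjective f) {g : B[X]} (hg : g.Monic) :
    ∃ q : A[X], q.map f = g ∧ q.Monic := by
  obtain ⟨q, h1, _, h2⟩ := lifts_and_natDegree_eq_and_monic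
    ((mem_lifts g).mpr (Polynomial.map_surjective _ hf g)) hg
  exact ⟨q, h1, h2⟩

theorem MonicLoc.map_surjective {f : A →+* B} (hf : Function.Surjective f) :
    Function.Surjective (MonicLoc.map f) := by
  intro x
  obtain ⟨⟨p, g, hg⟩, rfl⟩ := IsLocalization.mk'_surjective (monics B) x
  obtain ⟨q, rfl, hq⟩ := exists_monic_map_eq hf hg
  obtain ⟨p, rfl⟩ := Polynomial.map_surjective _ hf p
  refine ⟨IsLocalization.mk' _ p (⟨q, hq⟩ : monics A), ?_⟩
  simp only [MonicLoc.map, IsLocalization.map_mk']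
  rfl

theorem MonicLoc.exists_of_map_eq_zero {f : A →+* B} (hf : Function.Surjective f) {c : A}
    (hc : RingHom.ker f = Ideal.span {c}) {x : MonicLoc A} (hx : MonicLoc.map f x = 0) :
    ∃ y, x = algebraMap A[X] _ (C c) * y := by
  obtain ⟨⟨p, g, hg⟩, rfl⟩ := IsLocalization.mk'_surjective (monics A) x
  simp only [MonicLoc.map, IsLocalization.map_mk', coe_mapRingHom] at hx
  obtain ⟨⟨q, hq⟩, h0⟩ := (IsLocalization.mk'_eq_zero_iff _ _).mp hx
  obtain ⟨q, rfl, hq'⟩ := exists_monic_map_eq hf hq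
  simp only [← Polynomial.map_mul] at h0
  have hmem : ∀ n, c ∣ (q * p).coeff n := fun n => by
    rw [← Ideal.mem_span_singleton, ← hc, RingHom.mem_ker, ← coeff_map, h0, coeff_zero]
  obtain ⟨r, hr⟩ := (C_dvd_iff_dvd_coeff c (q * p)).mpr hmem
  have hq2 : q ∈ monics A := hq'
  refine ⟨IsLocalization.mk' _ r (⟨q, hq2⟩ * ⟨g, hg⟩ : monics A), ?_⟩
  rw [IsLocalization.mul_mk'_eq_mk'_of_mul, IsLocalization.mk'_eq_iff_eq]
  congr 1
  show q * g * p = g * (C c * r)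
  rw [← hr]; ring

end MonicLocalization

section DegreeReduction

open Polynomial

variable {A B : Type*} [CommRing A] [CommRing B]

theorem exists_monic_mem_of_forall_prime (J : Ideal A[X])
    (h : ∀ P : Ideal A[X], P.IsPrime → J ≤ P → ∃ f ∈ P, f.Monic) : ∃ f ∈ J, f.Monic := by
  by_contra! hcon
  have hne : J.map (algebraMap A[X] (MonicLoc A)) ≠ ⊤ := by
    rw [IsLocalization.map_algebraMap_ne_top_iff_disjoint (monics A)]
    exact Set.disjoint_left.mpr fun f hf hfJ => hcon f hfJ hf
  obtain ⟨M, hM, hle⟩ := Ideal.exists_le_maximal _ hne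
  have hMp := hM.isPrime
  obtain ⟨f, hf, hfm⟩ := h (M.under A[X]) inferInstance (Ideal.map_le_iff_le_comap.mp hle)
  exact hM.ne_top (Ideal.eq_top_of_isUnit_mem _ hf
    (IsLocalization.map_units (MonicLoc A) (⟨f, hfm⟩ : monics A)))

theorem mem_leadingCoeffNth_iff {I : Ideal A[X]} {n : ℕ} {x : A} :
    x ∈ I.leadingCoeffNth n ↔ ∃ p ∈ I, p.degree ≤ n ∧ p.coeff n = x := by
  simp only [Ideal.leadingCoeffNth, Submodule.mem_map, Ideal.degreeLE, Submodule.mem_inf,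
    Polynomial.mem_degreeLE, Polynomial.lcoeff_apply, Ideal.mem_ofPolynomial]
  constructor
  · rintro ⟨p, ⟨h1, h2⟩, h3⟩; exact ⟨p, h2, h1, h3⟩
  · rintro ⟨p, h2, h1, h3⟩; exact ⟨p, ⟨h1, h2⟩, h3⟩

theorem coeff_mem_leadingCoeffNth {I : Ideal A[X]} {n : ℕ} {f : A[X]} (hf : f ∈ I)
    (hfm : f.Monic) (hfn : f.natDegree = n + 1) {h : A[X]} (hh : h ∈ I) (hd : h.degree ≤ n)
    (k : ℕ) : h.coeff k ∈ I.leadingCoeffNth n := by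
  have key : ∀ j ≤ n, ∀ h ∈ I, h.degree ≤ n → h.coeff (n - j) ∈ I.leadingCoeffNth n := by
    intro j
    induction j with
    | zero => exact fun _ h hh hd => mem_leadingCoeffNth_iff.mpr ⟨h, hh, hd, rfl⟩
    | succ j ih =>
      intro hj h hh hd
      have h0 : h.coeff n ∈ I.leadingCoeffNth n := mem_leadingCoeffNth_iff.mpr ⟨h, hh, hd, rfl⟩
      have hd' : (X * h - C (h.coeff n) * f).degree ≤ (n : WithBot ℕ) := by
        rw [degree_le_iff_coeff_zero]
        intro m hm
        have hm' : n < m := by exact_mod_cast hm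
        obtain ⟨m, rfl⟩ : ∃ m', m = m' + 1 := ⟨m - 1, by omega⟩
        rw [coeff_sub, coeff_X_mul, coeff_C_mul]
        rcases (Nat.lt_succ_iff.mp hm').eq_or_lt with rfl | hlt
        · rw [← hfn, hfm.coeff_natDegree]; ring
        · rw [coeff_eq_zero_of_natDegree_lt (p := f) (by omega),
            (degree_le_iff_coeff_zero _ _).mp hd m (by exact_mod_cast hlt)]; ring
      have h1 := ih (by omega) _ (I.sub_mem (I.mul_mem_left X hh) (I.mul_mem_left _ hf)) hd'
      obtain ⟨l, hl⟩ : ∃ l, n - j = l + 1 := ⟨n - j - 1, by omega⟩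
      have hl' : n - (j + 1) = l := by omega
      rw [hl, coeff_sub, coeff_X_mul, coeff_C_mul] at h1
      rw [hl']
      have := Ideal.add_mem _ h1 (Ideal.mul_mem_right (f.coeff (l + 1)) _ h0)
      simpa using this
  by_cases hk : k ≤ n
  · have := key (n - k) (by omega) h hh hd
    rwa [Nat.sub_sub_self hk] at this
  · rw [(degree_le_iff_coeff_zero _ _).mp hd k (by exact_mod_cast not_le.mp hk)]
    exact zero_mem _

theorem monic_add_of_degree {f g : A[X]} {n : ℕ} (hf : f.degree < n) (hg : g.Monic)
    (hn : n ≤ g.natDegree) : (g + f).Monic ∧ (g + f).natDegree = g.natDegree := by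
  nontriviality A
  have : f.degree < g.degree := by
    rw [degree_eq_natDegree hg.ne_zero]; exact hf.trans_le (by exact_mod_cast hn)
  exact ⟨hg.add_of_left this, natDegree_add_eq_left_of_degree_lt this⟩

/-- A unimodular row over `B[X]`, `B` local, with a monic entry is elementarily trivial. -/
theorem rowEquiv_single_of_monic [IsLocalRing B] {ι : Type*} [Fintype ι] [DecidableEq ι]
    (hι : 3 ≤ Fintype.card ι) (n : ℕ) : ∀ (v : ι → B[X]), Unimod v → ∀ i, (v i).Monic →
      (v i).natDegree = n → ∀ i₀, RowEquiv v (Pi.single i₀ 1) := by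
  induction n with
  | zero =>
    intro v hv i hm hn i₀
    have : v i = 1 := eq_one_of_monic_natDegree_zero hm hn
    exact (RowEquiv.single_of_apply_eq_one this).trans (RowEquiv.single_single _ _)
  | succ n ih =>
    intro v hv i hm hn i₀
    set w : ι → B[X] := fun j => if j = i then v i else v j %ₘ v i with hw
    have hwi : w i = v i := by simp [hw]
    have hvw : RowEquiv v w := RowEquiv.of_dvd i hwi fun j => by
      by_cases hj : j = i
      · simp [hw, hj]
      · simp only [hw, hj, if_false]
        exact ⟨-(v j /ₘ v i), by rw [modByMonic_eq_sub_mul_div (v j)]; ring⟩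
    refine hvw.trans ?_
    have hwu := hv.of_rowEquiv hvw
    rw [← hwi] at hm hn
    have hdeg : ∀ j, j ≠ i → (w j).degree ≤ n := fun j hj => by
      have := degree_modByMonic_lt (v j) (hwi ▸ hm)
      simp only [hw, hj, if_false]
      rw [← hwi, degree_eq_natDegree hm.ne_zero, hn] at this
      rw [← hwi]
      exact Order.le_of_lt_succ this
    obtain ⟨j, k, hji, hu⟩ : ∃ j k, j ≠ i ∧ IsUnit ((w j).coeff k) := by
      by_contra! hcon
      set φ := mapRingHom (IsLocalRing.residue B)
      have h0 : ∀ j, j ≠ i → φ (w j) = 0 := fun j hj => by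
        ext k
        simp only [φ, coe_mapRingHom, coeff_map, coeff_zero]
        exact (IsLocalRing.residue_eq_zero_iff _).mpr (hcon j k hj)
      obtain ⟨x, hx⟩ := hwu.map φ
      have hx' : φ (w i) * x i = 1 := by
        rw [← hx, dotProduct, Finset.sum_eq_single i]
        · rfl
        · intro j _ hj; simp [h0 j hj]
        · simp
      have h1 : IsUnit (φ (w i)) := IsUnit.of_mul_eq_one _ hx'
      have h2 : (φ (w i)).natDegree = n + 1 := by
        simp only [φ, coe_mapRingHom]; rw [hm.natDegree_map, hn]
      rw [natDegree_eq_zero_of_isUnit h1] at h2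
      omega
    obtain ⟨t, hti, htj⟩ : ∃ t, t ≠ i ∧ t ≠ j := by
      by_contra! hcon
      have : (Finset.univ : Finset ι) ⊆ {i, j} := fun t _ => by
        by_cases h : t = i
        · simp [h]
        · simp [hcon t h]
      have := (Finset.card_le_card this).trans Finset.card_le_two
      rw [Finset.card_univ] at this; omega
    set I := Ideal.span (w '' {t}ᶜ) with hI
    have hiI : w i ∈ I := Ideal.subset_span ⟨i, hti.symm, rfl⟩
    have hjI : w j ∈ I := Ideal.subset_span ⟨j, htj.symm, rfl⟩
    have h1 : (1 - (w t).coeff n) ∈ I.leadingCoeffNth n := by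
      rw [Ideal.eq_top_of_isUnit_mem _
        (coeff_mem_leadingCoeffNth hiI hm hn hjI (hdeg j hji) k) hu]
      trivial
    obtain ⟨h, hhI, hhd, hhc⟩ := mem_leadingCoeffNth_iff.mp h1
    have h2 := RowEquiv.update_of_mem (v := w) t (x := w t + h) (by simpa using hhI)
    refine h2.trans (ih _ (hwu.of_rowEquiv h2) t ?_ ?_ i₀)
    · simp only [Function.update_self]
      exact monic_of_degree_le n ((degree_add_le _ _).trans (max_le (hdeg t hti) hhd))
        (by rw [coeff_add, hhc]; ring)
    · simp only [Function.update_self]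
      exact natDegree_eq_of_degree_eq_some (by
        refine le_antisymm ((degree_add_le _ _).trans (max_le (hdeg t hti) hhd)) ?_
        exact le_degree_of_ne_zero (by rw [coeff_add, hhc]; simp))

theorem exists_rowEquiv_monic [IsNoetherianRing B] [Nontrivial B] {e : ℕ} (hB : HeightLE B e) {ι : Type*}
    [Fintype ι] [DecidableEq ι] (hι : e + 2 ≤ Fintype.card ι) {v : ι → B[X]} (hv : Unimod v)
    (i : ι) : ∃ w, RowEquiv v w ∧ (w i).Monic := by
  obtain ⟨c, hc⟩ := exists_add_mul_height v (v i) (Finset.univ.erase i)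
  set w : ι → B[X] := fun j => if j = i then v i else v j + c j * v i with hw
  have hwi : w i = v i := by simp [hw]
  have hvw : RowEquiv v w := RowEquiv.of_dvd i hwi fun j => by
    by_cases hj : j = i
    · simp [hw, hj]
    · simp [hw, hj]
  have hwu := hv.of_rowEquiv hvw
  obtain ⟨f, hf, hfm⟩ := exists_monic_mem_of_forall_prime (Ideal.span (w '' {i}ᶜ)) fun P hP hle => by
    by_contra! hcon
    have hPw : ∀ j, j ≠ i → w j ∈ P := fun j hj => hle (Ideal.subset_span ⟨j, hj, rfl⟩)
    have hPv : ∀ j ∈ Finset.univ.erase i, v j + c j * v i ∈ P := fun j hj => by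
      have := hPw j (Finset.ne_of_mem_erase hj)
      simpa only [hw, if_neg (Finset.ne_of_mem_erase hj)] using this
    rcases hc P hP hPv with h | h
    · obtain ⟨j, hj⟩ := hwu.exists_notMem hP.ne_top
      by_cases hji : j = i
      · exact hj (hji ▸ hwi ▸ h)
      · exact hj (hPw j hji)
    · have := h.trans (height_le_of_forall_not_monic hB P hcon)
      rw [Finset.card_erase_of_mem (Finset.mem_univ _), Finset.card_univ] at this
      have h3 : Fintype.card ι - 1 ≤ e := by exact_mod_cast this
      omega
  set N := (w i).natDegree + 1
  refine ⟨_, hvw.trans (RowEquiv.update_of_mem i (x := w i + X ^ N * f) ?_), ?_⟩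
  · simpa using Ideal.mul_mem_left _ _ hf
  · simp only [Function.update_self]
    rw [add_comm]
    refine (monic_add_of_degree (n := N) ?_ ((monic_X_pow N).mul hfm) ?_).1
    · exact degree_le_natDegree.trans_lt (by exact_mod_cast Nat.lt_succ_self _)
    · rw [(monic_X_pow N).natDegree_mul hfm, natDegree_X_pow]; omega

theorem rowEquiv_single_polynomial [IsNoetherianRing B] [IsLocalRing B] {e : ℕ}
    (hB : HeightLE B e) {ι : Type*} [Fintype ι] [DecidableEq ι] (h3 : 3 ≤ Fintype.card ι)
    (hι : e + 2 ≤ Fintype.card ι) {v : ι → B[X]} (hv : Unimod v) (i : ι) :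
    RowEquiv v (Pi.single i 1) := by
  obtain ⟨w, hvw, hm⟩ := exists_rowEquiv_monic hB hι hv i
  exact hvw.trans (rowEquiv_single_of_monic h3 _ w (hv.of_rowEquiv hvw) i hm rfl i)

end DegreeReduction

section PowerShift

variable {ι R : Type*} [Fintype ι] [DecidableEq ι] [CommRing R]

theorem exists_third (hι : 3 ≤ Fintype.card ι) (i j : ι) : ∃ k, k ≠ i ∧ k ≠ j := by
  by_contra! hcon
  have : (Finset.univ : Finset ι) ⊆ {i, j} := fun t _ => by
    by_cases h : t = i
    · simp [h]
    · simp [hcon t h]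
  have := (Finset.card_le_card this).trans Finset.card_le_two
  rw [Finset.card_univ] at this; omega

theorem RowEquiv.update_add_of_mem (v : ι → R) (j : ι) {x : R}
    (hx : x ∈ Ideal.span (v '' {j}ᶜ)) : RowEquiv v (Function.update v j (v j + x)) :=
  RowEquiv.update_of_mem j (by simpa using hx)

/-- If `t` is a unit modulo `v i`, then another entry `v j` can be multiplied by `t ^ 2`. -/
theorem RowEquiv.scale_sq (hι : 3 ≤ Fintype.card ι) {v : ι → R} (hv : Unimod v) {i j : ι}
    (hij : i ≠ j) {t t' : R} (ht : v i ∣ t * t' - 1) :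
    RowEquiv v (Function.update v j (t ^ 2 * v j)) := by
  obtain ⟨k, hki, hkj⟩ := exists_third hι i j
  set I := Ideal.span (v '' {j, k}ᶜ) with hI
  set V : R → R → ι → R := fun x y => Function.update (Function.update v j x) k y with hV
  have hVj : ∀ x y, V x y j = x := fun x y => by simp [hV, hkj.symm]
  have hVk : ∀ x y, V x y k = y := fun x y => by simp [hV]
  have hVo : ∀ x y l, l ≠ j → l ≠ k → V x y l = v l := fun x y l h1 h2 => by simp [hV, h1, h2]
  have hIle : ∀ x y, ∀ l ∈ ({j, k} : Set ι), I ≤ Ideal.span (V x y '' {l}ᶜ) := by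
    intro x y l hl
    refine Ideal.span_le.mpr ?_
    rintro _ ⟨o, ho, rfl⟩
    have ho' : ¬ (o = j ∨ o = k) := ho
    rw [not_or] at ho'
    rw [← hVo x y o ho'.1 ho'.2]
    exact Ideal.subset_span ⟨o, (by rintro rfl; exact ho hl), rfl⟩
  have step : ∀ x y y1 y2 u1 u2, u1 * y1 + u2 * y2 = 0 →
      RowEquiv (V x y) (V (x + (x * y1 + y * y2) * u1) (y + (x * y1 + y * y2) * u2)) := by
    intro x y y1 y2 u1 u2 h
    have hd : ∀ (w : ι → R), w ⬝ᵥ (Pi.single j y1 + Pi.single k y2) = w j * y1 + w k * y2 := by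
      intro w; simp [dotProduct_add]
    have := RowEquiv.one_add_vecMulVec (ElemMat.vecMulVec_of_coord_zero
      (Pi.single j y1 + Pi.single k y2) (Pi.single j u1 + Pi.single k u2) (by
        rw [hd]; simpa [hkj, hkj.symm] using h) i (by simp [hij, hki.symm])) (V x y)
    convert this using 1
    rw [hd, hVj, hVk]
    ext l
    by_cases hlk : l = k
    · subst hlk; simp [hVk, hkj]
    by_cases hlj : l = j
    · subst hlj; simp [hVj, hlk]
    · simp [hVo _ _ l hlj hlk, hlj, hlk]
  have congr : ∀ x y x' y', x' - x ∈ I → y' - y ∈ I → RowEquiv (V x y) (V x' y') := by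
    intro x y x' y' hx hy
    have h1 := RowEquiv.update_of_mem (v := V x y) (x := x') j
      (by rw [hVj]; exact hIle x y j (by simp) hx)
    have e1 : Function.update (V x y) j x' = V x' y := by
      simp only [hV]; rw [Function.update_comm hkj.symm, Function.update_idem,
        Function.update_comm hkj]
    rw [e1] at h1
    have h2 := RowEquiv.update_of_mem (v := V x' y) (x := y') k
      (by rw [hVk]; exact hIle x' y k (by simp) hy)
    have e2 : Function.update (V x' y) k y' = V x' y' := by simp [hV]
    rw [e2] at h2
    exact h1.trans h2
  have hitI : v i ∈ I := Ideal.subset_span ⟨i, by simp [hij, hki.symm], rfl⟩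
  have htI : t * t' - 1 ∈ I := Ideal.mem_of_dvd _ ht hitI
  obtain ⟨w, hw⟩ := hv
  set b := v j; set c := v k; set β := w j; set γ := w k
  have hpI : b * β + c * γ - 1 ∈ I := by
    have : b * β + c * γ - 1 = -∑ l ∈ ({j, k} : Finset ι)ᶜ, v l * w l := by
      rw [← hw, dotProduct, ← Finset.sum_add_sum_compl {j, k}, Finset.sum_pair hkj.symm]; ring
    rw [this]
    refine Ideal.neg_mem_iff _ |>.mpr (Ideal.sum_mem _ fun l hl => Ideal.mul_mem_right _ _
      (Ideal.subset_span ⟨l, ?_, rfl⟩))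
    simpa using hl
  have h0 : v = V b c := by
    ext l
    by_cases hlk : l = k
    · subst hlk; simp [hVk, c]
    by_cases hlj : l = j
    · subst hlj; simp [hVj, b]
    · simp [hVo _ _ l hlj hlk]
  have hA : RowEquiv v (V (t * b) (t * c)) := by
    rw [h0]
    have q : ∀ {z : R}, Ideal.Quotient.mk I z = 0 ↔ z ∈ I := Ideal.Quotient.eq_zero_iff_mem
    have qp := q.mpr hpI
    have qt := q.mpr htI
    simp only [map_sub, map_add, map_mul, map_one] at qp qt
    refine ((step b c β γ (-(t - 1) * γ) ((t - 1) * β) (by ring)).trans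
      (congr _ _ (b - (t - 1) * γ) (c + (t - 1) * β) (q.mp ?_) (q.mp ?_))).trans ?_
    · simp only [map_sub, map_add, map_mul, map_one, map_neg]; linear_combination
        (Ideal.Quotient.mk I t - 1) * Ideal.Quotient.mk I γ * qp
    · simp only [map_sub, map_add, map_mul, map_one]; linear_combination
        -(Ideal.Quotient.mk I t - 1) * Ideal.Quotient.mk I β * qp
    refine ((step _ _ (-c) b b c (by ring)).trans
      (congr _ _ (t * b - (t - 1) * γ) (t * c + (t - 1) * β) (q.mp ?_) (q.mp ?_))).trans ?_
    · simp only [map_sub, map_add, map_mul, map_one, map_neg]; linear_combination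
        -(Ideal.Quotient.mk I t - 1) * Ideal.Quotient.mk I b * qp
    · simp only [map_sub, map_add, map_mul, map_one, map_neg]; linear_combination
        -(Ideal.Quotient.mk I t - 1) * Ideal.Quotient.mk I c * qp
    refine (step _ _ β γ ((t - 1) * t' * γ) (-(t - 1) * t' * β) (by ring)).trans
      (congr _ _ _ _ (q.mp ?_) (q.mp ?_))
    · simp only [map_sub, map_add, map_mul, map_one]; linear_combination
        -(Ideal.Quotient.mk I t - 1) * Ideal.Quotient.mk I γ * (qt + Ideal.Quotient.mk I t *
          Ideal.Quotient.mk I t' * qp)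
    · simp only [map_sub, map_add, map_mul, map_one, map_neg]; linear_combination
        (Ideal.Quotient.mk I t - 1) * Ideal.Quotient.mk I β * (qt + Ideal.Quotient.mk I t *
          Ideal.Quotient.mk I t' * qp)
  refine hA.trans ((RowEquiv.scale_pair (V (t * b) (t * c)) hkj.symm hij.symm hki
    (t := t) (t' := t') (by rwa [hVo _ _ i hij hki.symm])).trans ?_)
  have e : Function.update v j (t ^ 2 * b) = V (t ^ 2 * b) c := by
    simp only [hV]; rw [Function.update_comm hkj.symm]
    rw [Function.update_eq_self k v]
  have e' : Function.update (Function.update (V (t * b) (t * c)) j (t * V (t * b) (t * c) j)) k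
      (t' * V (t * b) (t * c) k) = V (t ^ 2 * b) (t' * (t * c)) := by
    rw [hVj, hVk, ← mul_assoc t t b, ← sq]
    simp only [hV]; rw [Function.update_comm hkj]; simp
  rw [e, e']
  refine congr _ _ _ _ (by simp) ?_
  have : c - t' * (t * c) = -c * (t * t' - 1) := by ring
  rw [this]
  exact Ideal.mul_mem_left _ _ htI

open Polynomial in
/-- Truncated `k`-th roots of `1 + X`. -/
theorem exists_root_one_add_X (k : ℕ) (hk : IsUnit (k : R)) (m : ℕ) :
    ∃ p : R[X], p.coeff 0 = 1 ∧ X ^ m ∣ p ^ k - (1 + X) := by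
  induction m with
  | zero => exact ⟨1, by simp, by simp⟩
  | succ m ih =>
    rcases m with _ | m
    · exact ⟨1, by simp, by simp⟩
    obtain ⟨p, hp0, q, hq⟩ := ih
    obtain ⟨u, hu⟩ := hk
    obtain ⟨s, hs⟩ := Polynomial.powAddExpansion p (-(C (↑u⁻¹ * q.coeff 0) * X ^ (m + 1))) k
    refine ⟨p - C (↑u⁻¹ * q.coeff 0) * X ^ (m + 1), by simp [hp0], ?_⟩
    rw [sub_eq_add_neg p, hs]
    obtain ⟨r, hr⟩ : X ∣ q - C (q.coeff 0) * p ^ (k - 1) := by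
      rw [X_dvd_iff, coeff_sub, coeff_C_mul, coeff_zero_eq_eval_zero (p ^ _), eval_pow,
        ← coeff_zero_eq_eval_zero, hp0]; simp
    have hku : (k : R[X]) * C (↑u⁻¹ : R) = 1 := by
      rw [← C_eq_natCast, ← C_mul, ← hu]; simp
    refine ⟨r + s * C (↑u⁻¹ * q.coeff 0) ^ 2 * X ^ m, ?_⟩
    rw [C_mul]
    linear_combination hq + X ^ (m + 1) * hr - X ^ (m + 1) * p ^ (k - 1) * C (q.coeff 0) * hku

theorem exists_pow_eq_one_add (k : ℕ) (hk : IsUnit (k : R)) {n : R} (hn : IsNilpotent n) :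
    ∃ t, t ^ k = 1 + n := by
  obtain ⟨m, hm⟩ := hn
  obtain ⟨p, _, q, hq⟩ := exists_root_one_add_X k hk m
  refine ⟨p.eval n, ?_⟩
  have := congrArg (Polynomial.eval n) hq
  simp only [Polynomial.eval_sub, Polynomial.eval_pow, Polynomial.eval_add, Polynomial.eval_one,
    Polynomial.eval_X, Polynomial.eval_mul, hm, zero_mul, sub_eq_zero] at this
  exact this

theorem RowEquiv.update_add_nilpotent (hι : 3 ≤ Fintype.card ι) (h2 : IsUnit (2 : R)) {v : ι → R}
    (hv : Unimod v) {i j : ι} (hij : i ≠ j) {n : R} {m : ℕ} (hn : v i ∣ n ^ m) :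
    RowEquiv v (Function.update v j (v j + n)) := by
  obtain ⟨w, hw⟩ := id hv
  set τ := 1 + n * w j with hτ
  have hnil : IsNilpotent (Ideal.Quotient.mk (Ideal.span {v i}) (n * w j)) :=
    ⟨m, by
      rw [← map_pow, Ideal.Quotient.eq_zero_iff_mem, Ideal.mem_span_singleton, mul_pow]
      exact Dvd.dvd.mul_right hn _⟩
  obtain ⟨t, ht⟩ := exists_pow_eq_one_add 2
    (by
      have := h2.map (Ideal.Quotient.mk (Ideal.span {v i}))
      rw [map_ofNat] at this; exact_mod_cast this) hnil
  obtain ⟨t, rfl⟩ := Ideal.Quotient.mk_surjective t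
  have htτ : v i ∣ t ^ 2 - τ := by
    rw [← Ideal.mem_span_singleton, ← Ideal.Quotient.eq_zero_iff_mem, map_sub, map_pow, ht]
    simp [hτ]
  have hu : IsUnit (Ideal.Quotient.mk (Ideal.span {v i}) t) := by
    have : IsUnit (Ideal.Quotient.mk (Ideal.span {v i}) t ^ 2) := by
      rw [ht]; exact hnil.isUnit_one_add
    exact (isUnit_pow_iff two_ne_zero).mp this
  obtain ⟨t', ht'⟩ := hu.exists_right_inv
  obtain ⟨t', rfl⟩ := Ideal.Quotient.mk_surjective t'
  have htt' : v i ∣ t * t' - 1 := by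
    rw [← Ideal.mem_span_singleton, ← Ideal.Quotient.eq_zero_iff_mem, map_sub, map_mul, ht']
    simp
  refine (RowEquiv.scale_sq hι hv hij htt').trans ?_
  have := RowEquiv.update_of_mem (v := Function.update v j (t ^ 2 * v j)) j (x := v j + n) (by
    rw [Function.update_self]
    have e : Function.update v j (t ^ 2 * v j) '' {j}ᶜ = v '' {j}ᶜ :=
      Set.image_congr fun l hl => Function.update_of_ne hl _ _
    rw [e]
    have e2 : v j + n - t ^ 2 * v j = n * (1 - v j * w j) - (t ^ 2 - τ) * v j := by
      rw [hτ]; ring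
    rw [e2]
    refine Ideal.sub_mem _ (Ideal.mul_mem_left _ _ ?_) (Ideal.mul_mem_right _ _
      (Ideal.mem_of_dvd _ htτ (Ideal.subset_span ⟨i, hij, rfl⟩)))
    rw [← hw, dotProduct, ← Finset.add_sum_erase _ _ (Finset.mem_univ j), add_sub_cancel_left]
    exact Ideal.sum_mem _ fun l hl => Ideal.mul_mem_right _ _
      (Ideal.subset_span ⟨l, Finset.ne_of_mem_erase hl, rfl⟩))
  simpa using this

theorem Unimod.update_pow {v : ι → R} (hv : Unimod v) (i : ι) (m : ℕ) :
    Unimod (Function.update v i (v i ^ m)) := by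
  refine unimod_of_forall_prime fun p hp => ?_
  obtain ⟨j, hj⟩ := hv.exists_notMem hp.ne_top
  by_cases hji : j = i
  · subst hji
    exact ⟨j, by rw [Function.update_self]; exact fun h => hj (hp.mem_of_pow_mem _ h)⟩
  · exact ⟨j, by rwa [Function.update_of_ne hji]⟩

/-- A power can be moved from one entry of a unimodular row to another. -/
theorem RowEquiv.shift_pow (hι : 3 ≤ Fintype.card ι) (h2 : IsUnit (2 : R)) {v : ι → R}
    (hv : Unimod v) {i j : ι} (hij : i ≠ j) (m : ℕ) :
    RowEquiv (Function.update v i (v i ^ m)) (Function.update v j (v j ^ m)) := by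
  set V : R → R → ι → R := fun x y => Function.update (Function.update v i x) j y with hV
  have hVi : ∀ x y, V x y i = x := fun x y => by simp [hV, hij]
  have hVj : ∀ x y, V x y j = y := fun x y => by simp [hV]
  have hui : ∀ x y z, Function.update (V x y) i z = V z y := fun x y z => by
    simp only [hV]; rw [Function.update_comm hij, Function.update_idem,
      Function.update_comm hij.symm]
  have huj : ∀ x y z, Function.update (V x y) j z = V x z := fun x y z => by simp [hV]
  have hVo : ∀ x y l, l ≠ i → l ≠ j → V x y l = v l := fun x y l h1 h2 => by simp [hV, h1, h2]
  set x := v i; set y := v j; set u := x + y with hu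
  have e1 : Function.update v i (x ^ m) = V (x ^ m) y := by
    simp only [hV]; rw [Function.update_comm hij, Function.update_eq_self j v]
  have e2 : Function.update v j (y ^ m) = V x (y ^ m) := by
    simp only [hV]; rw [Function.update_eq_self i v]
  have hxy : Unimod (V (x ^ m) y) := e1 ▸ hv.update_pow i m
  have addi : ∀ a b c d, d = a + c * b → RowEquiv (V a b) (V d b) := fun a b c d h => by
    have := RowEquiv.update_add (V a b) hij.symm c
    rwa [hVi, hVj, hui, ← h] at this
  have addj : ∀ a b c d, d = b + c * a → RowEquiv (V a b) (V a d) := fun a b c d h => by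
    have := RowEquiv.update_add (V a b) hij c
    rwa [hVi, hVj, huj, ← h] at this
  rw [e1, e2]
  obtain ⟨s, hs⟩ : y ∣ u ^ m - x ^ m := by
    have := sub_dvd_pow_sub_pow u x m; rwa [hu, add_sub_cancel_left] at this
  obtain ⟨s', hs'⟩ : x ∣ y ^ m - u ^ m := by
    have := sub_dvd_pow_sub_pow y u m; rw [hu, sub_add_cancel_right] at this
    exact (neg_dvd.mp this)
  have h1 : RowEquiv (V (x ^ m) y) (V (u ^ m) y) := addi _ _ s _ (by linear_combination hs)
  have h3 := RowEquiv.update_add_nilpotent hι h2 (hxy.of_rowEquiv h1) hij (n := -u) (m := m)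
    (by rw [hVi, neg_pow]; exact dvd_mul_left _ _)
  rw [hVj, huj] at h3
  have h4 : RowEquiv (V (u ^ m) (y + -u)) (V x (u ^ m)) :=
    ((addi _ _ (-1) (u ^ m + x) (by rw [hu]; ring)).trans
      (addj _ _ 1 (u ^ m) (by rw [hu]; ring))).trans (addi _ _ (-1) x (by ring))
  exact ((h1.trans h3).trans h4).trans (addj _ _ s' _ (by linear_combination hs'))

end PowerShift

section
variable {ι R : Type*} [Fintype ι] [DecidableEq ι] [CommRing R]

namespace ElemMat

theorem diagonal_pair_mem {i j : ι} (hij : i ≠ j) {x x' : R} (h : x * x' = 1) :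
    diagonal (Function.update (Function.update 1 i x) j x') ∈ ElemMat ι R := by
  have W : ∀ y y' : R, y * y' = 1 → transvection i j y * transvection j i (-y') *
      transvection i j y = 1 + single i i (-1) + single j j (-1) + single i j y
        + single j i (-y') := by
    intro y y' h
    have h' : y' * y = 1 := by rw [mul_comm, h]
    simp only [transvection, mul_add, add_mul, mul_one, one_mul, single_mul_single_same,
      single_mul_single_of_ne _ _ _ _ hij.symm, mul_neg,
      neg_mul, h, h', add_zero]
    ext a b
    simp only [Matrix.add_apply, Matrix.single_apply]
    split_ifs <;> ring
  have key : diagonal (Function.update (Function.update 1 i x) j x') =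
      (transvection i j x * transvection j i (-x') * transvection i j x) *
      (transvection i j (-1) * transvection j i (- -1) * transvection i j (-1)) := by
    rw [W x x' h, W (-1) (-1) (by ring)]
    simp only [mul_add, add_mul, mul_one, one_mul, single_mul_single_same,
      single_mul_single_of_ne _ _ _ _ hij, single_mul_single_of_ne _ _ _ _ hij.symm, mul_neg,
      add_zero, neg_neg]
    have hji := hij.symm
    ext a b
    simp only [Matrix.add_apply, Matrix.single_apply, diagonal_apply, Function.update_apply,
      Matrix.one_apply, Pi.one_apply]
    by_cases ha : a = i
    · subst ha
      by_cases hb : b = a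
      · subst hb; simp [hij, hji]
      · by_cases hb' : b = j
        · subst hb'; simp [hij, hji]
        · simp [hji, Ne.symm hb, Ne.symm hb']
    · by_cases ha' : a = j
      · subst ha'
        by_cases hb : b = i
        · subst hb; simp [hij, hji]
        · by_cases hb' : b = a
          · subst hb'; simp [hij]
          · simp [hij, Ne.symm hb, Ne.symm hb']
      · simp [ha, ha', Ne.symm ha, Ne.symm ha']
  rw [key]
  have t1 := fun c : R => transvection_mem hij c
  have t2 := fun c : R => transvection_mem hij.symm c
  exact mul_mem (mul_mem (mul_mem (t1 _) (t2 _)) (t1 _)) (mul_mem (mul_mem (t1 _) (t2 _)) (t1 _))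

theorem diagonal_of_unit_mem (i : ι) {c c' : R} (h : c * c' = 1) (s : Finset ι) (hs : i ∉ s) :
    diagonal (fun j => if j = i then c' ^ s.card else if j ∈ s then c else 1) ∈
      ElemMat ι R := by
  induction s using Finset.induction_on with
  | empty =>
    convert one_mem (ElemMat ι R)
    ext a b
    simp [diagonal_apply, Matrix.one_apply]
  | insert j s hj ih =>
    have hij : i ≠ j := fun h => hs (by simp [h])
    have := mul_mem (ih (fun h => hs (by simp [h]))) (diagonal_pair_mem hij (x := c') (x' := c)
      (by rw [mul_comm, h]))
    rw [diagonal_mul_diagonal] at this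
    convert this using 2
    ext k
    by_cases hk : k = i
    · subst hk
      simp [hij, Finset.card_insert_of_notMem hj, pow_succ]
    · by_cases hk' : k = j
      · subst hk'; simp [hk, hj]
      · simp [hk, hk']

end ElemMat

/-- A row that occurs as a row of an invertible matrix. -/
def Completable (v : ι → R) : Prop := ∃ M N : Matrix ι ι R, M * N = 1 ∧ ∃ i, M i = v

theorem Completable.of_matrix {κ : Type*} [Fintype κ] [DecidableEq κ] (e : κ ≃ ι)
    (M : Matrix κ ι R) (N : Matrix ι κ R) (h : M * N = 1) (i : κ) : Completable (M i) := by
  refine ⟨M.submatrix e.symm id, N.submatrix id e.symm, ?_, e i, ?_⟩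
  · have := submatrix_mul_equiv M N e.symm (Equiv.refl ι) e.symm
    rw [h, submatrix_one_equiv] at this
    exact this
  · ext j; simp

theorem Completable.comp_equiv {κ : Type*} [Fintype κ] [DecidableEq κ] (e : κ ≃ ι)
    {v : ι → R} (h : Completable v) : Completable (v ∘ e) := by
  obtain ⟨M, N, h, i, rfl⟩ := h
  refine ⟨M.submatrix e e, N.submatrix e e, ?_, e.symm i, ?_⟩
  · rw [submatrix_mul_equiv, h, submatrix_one_equiv]
  · ext j; simp

theorem Completable.map {S : Type*} [CommRing S] (f : R →+* S) {v : ι → R}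
    (h : Completable v) : Completable (f ∘ v) := by
  obtain ⟨M, N, h, i, rfl⟩ := h
  refine ⟨M.map f, N.map f, ?_, i, ?_⟩
  · rw [← Matrix.map_mul, h, Matrix.map_one _ (map_zero f) (map_one f)]
  · ext j; simp

theorem Completable.of_rowEquiv {v w : ι → R} (h : Completable v) (hw : RowEquiv v w) :
    Completable w := by
  obtain ⟨M, N, h, i, rfl⟩ := h
  obtain ⟨g, hg, rfl⟩ := hw
  obtain ⟨g', hg', h1, h2⟩ := ElemMat.exists_inv hg
  refine ⟨M * g, g' * N, ?_, i, ?_⟩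
  · rw [Matrix.mul_assoc, ← Matrix.mul_assoc g, h1, Matrix.one_mul, h]
  · rfl

theorem Completable.exists_vecMul {v : ι → R} (h : Completable v) :
    ∃ M N : Matrix ι ι R, M * N = 1 ∧ ∃ i, v ᵥ* M = Pi.single i 1 := by
  obtain ⟨M, N, h, i, rfl⟩ := h
  refine ⟨N, M, mul_eq_one_comm.mp h, i, ?_⟩
  ext j
  have := congrFun (congrFun h i) j
  rw [Matrix.one_apply] at this
  simp only [Pi.single_apply, eq_comm (a := j)]
  rw [← this]; rfl

/-- If `a` becomes completable modulo `c`, then `(a, c ^ card)` is completable. -/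
theorem Completable.sumElim_pow {a : ι → R} {c : R}
    (h : Completable (Ideal.Quotient.mk (Ideal.span {c}) ∘ a)) :
    Completable (Sum.elim a (fun _ : Unit => c ^ Fintype.card ι)) := by
  obtain ⟨Hb, Hb', hH, i₀, hi₀⟩ := h
  have hs : Function.Surjective (Ideal.Quotient.mk (Ideal.span {c})) := Ideal.Quotient.mk_surjective
  have hk : ∀ M : Matrix ι ι R, ∀ c : R, M.map (Ideal.Quotient.mk (Ideal.span {c})) = 0 →
      ∃ Z : Matrix ι ι R, M = c • Z := by
    intro M c hM
    have : ∀ i j, ∃ z, M i j = c * z := by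
      intro i j
      have := congrFun (congrFun hM i) j
      simp only [Matrix.map_apply, Matrix.zero_apply, Ideal.Quotient.eq_zero_iff_mem,
        Ideal.mem_span_singleton'] at this
      obtain ⟨z, hz⟩ := this
      exact ⟨z, by rw [← hz, mul_comm]⟩
    choose Z hZ using this
    exact ⟨Matrix.of Z, by ext i j; simp [hZ]⟩
  have hcl : ∀ M : Matrix ι ι R, ∀ c : R,
      (c • M).map (Ideal.Quotient.mk (Ideal.span {c})) = 0 := by
    intro M c
    ext i j
    simp
  choose f hf using hs
  let H : Matrix ι ι R := Matrix.of fun i j => if i = i₀ then a j else f (Hb i j)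
  let H' : Matrix ι ι R := Matrix.of fun i j => f (Hb' i j)
  have hHm : H.map (Ideal.Quotient.mk (Ideal.span {c})) = Hb := by
    ext i j
    by_cases hi : i = i₀
    · subst hi; simp [H, hi₀]
    · simp [H, hi, hf]
  have hHm' : H'.map (Ideal.Quotient.mk (Ideal.span {c})) = Hb' := by
    ext i j; simp [H', hf]
  obtain ⟨Z, hZ⟩ := hk (H * H' - 1) c (by
    rw [Matrix.map_sub _ (fun a b => map_sub _ a b), Matrix.map_mul, hHm, hHm', hH,
      Matrix.map_one _ (map_zero _) (map_one _), sub_self])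
  obtain ⟨Z', hZ'⟩ := hk (H' * H - 1) c (by
    rw [Matrix.map_sub _ (fun a b => map_sub _ a b), Matrix.map_mul, hHm, hHm',
      mul_eq_one_comm.mp hH, Matrix.map_one _ (map_zero _) (map_one _), sub_self])
  replace hZ : H * H' = 1 + c • Z := by rw [← hZ]; abel
  replace hZ' : H' * H = 1 + c • Z' := by rw [← hZ']; abel
  -- `c` is invertible modulo `det H`
  obtain ⟨x, hx⟩ : ∃ x, c * x - 1 ∈ Ideal.span {H.det} := by
    have : Ideal.Quotient.mk (Ideal.span {c}) (H.det * H'.det - 1) = 0 := by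
      rw [map_sub, map_mul, map_one, RingHom.map_det, RingHom.map_det]
      simp only [RingHom.mapMatrix_apply]
      rw [hHm, hHm', ← det_mul, hH, det_one, sub_self]
    rw [Ideal.Quotient.eq_zero_iff_mem, Ideal.mem_span_singleton'] at this
    obtain ⟨y, hy⟩ := this
    exact ⟨-y, Ideal.mem_span_singleton'.mpr ⟨-H'.det, by linear_combination hy⟩⟩
  set q := Ideal.Quotient.mk (Ideal.span {H.det}) with hq
  have hcx : q c * q x = 1 := by
    rw [← map_mul, ← sub_eq_zero, ← map_one q, ← map_sub, Ideal.Quotient.eq_zero_iff_mem]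
    exact hx
  let Dg : Matrix ι ι R := diagonal (Function.update 1 i₀ (c ^ Fintype.card ι))
  obtain ⟨ε, hε, hεm⟩ := ElemMat.exists_lift (f := q) Ideal.Quotient.mk_surjective
    (ElemMat.diagonal_of_unit_mem i₀ hcx (Finset.univ.erase i₀) (by simp))
  obtain ⟨ε', hε', hεε', hε'ε⟩ := ElemMat.exists_inv hε
  obtain ⟨W, hW⟩ := hk (c • 1 - Dg * ε) H.det (by
    rw [Matrix.map_sub _ (fun a b => map_sub _ a b), Matrix.map_mul, hεm, sub_eq_zero]
    have h1 : Dg.map q = diagonal (Function.update 1 i₀ (q c ^ Fintype.card ι)) := by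
      rw [Matrix.diagonal_map (map_zero q)]
      congr 1
      ext j
      by_cases hj : j = i₀
      · subst hj; simp
      · simp [hj]
    rw [h1, diagonal_mul_diagonal]
    ext i j
    by_cases hij : i = j
    · subst hij
      by_cases hi : i = i₀
      · subst hi
        obtain ⟨m, hm⟩ : ∃ m, Fintype.card ι = m + 1 :=
          ⟨Fintype.card ι - 1, by have := Fintype.card_pos_iff.mpr ⟨i⟩; omega⟩
        have : (q c)^ (m+1) * (q x) ^ m = q c := by
          rw [pow_succ, mul_right_comm, ← mul_pow, hcx, one_pow, one_mul]
        simp [Finset.card_erase_of_mem, Finset.card_univ, hm]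
        exact this.symm
      · simp [hi, hq]
    · simp [hij])
  have hW' : c • (1 : Matrix ι ι R) = Dg * ε + H * (H.adjugate * W) := by
    rw [← Matrix.mul_assoc, mul_adjugate, smul_mul_assoc, Matrix.one_mul, ← hW]; abel
  -- an invertible matrix of twice the size
  let Y : Matrix ι ι R := (Z' * (H.adjugate * W) - H') * ε'
  have hc' : ∀ M : Matrix ι ι R, (c • (1 : Matrix ι ι R)) * M = M * (c • 1) := by simp
  have hcs : ∀ M : Matrix ι ι R, c • M = (c • (1 : Matrix ι ι R)) * M := by simp
  have hΘ : fromBlocks H (c • 1) (-Z') (-H') * fromBlocks 1 (-(H.adjugate * W)) 0 1 *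
      fromBlocks 1 0 0 ε' = fromBlocks H Dg (-Z') Y := by
    simp only [fromBlocks_multiply, Matrix.mul_one, Matrix.mul_zero, add_zero, zero_add, hW']
    congr 1
    · rw [Matrix.mul_neg, neg_add_eq_sub, add_sub_cancel_right, Matrix.mul_assoc, hεε', Matrix.mul_one]
    · simp only [Y, Matrix.neg_mul, Matrix.mul_neg, neg_neg, sub_eq_add_neg]
  obtain ⟨Ξ, hΞ⟩ : ∃ Ξ, fromBlocks H Dg (-Z') Y * Ξ = 1 := by
    refine ⟨fromBlocks 1 0 0 ε * fromBlocks 1 (H.adjugate * W) 0 1 *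
      (fromBlocks 1 0 (Z * H - H * Z') 1 * fromBlocks H' (c • 1) (-Z) (-H)), ?_⟩
    apply mul_eq_one_comm.mp
    have h1 : fromBlocks H' (c • 1) (-Z) (-H) * fromBlocks H (c • 1) (-Z') (-H') =
        fromBlocks 1 0 (H * Z' - Z * H) 1 := by
      simp only [fromBlocks_multiply, hZ', hZ, Matrix.mul_neg, Matrix.neg_mul, neg_neg, hcs Z,
        hcs Z', hc' Z]
      simp [sub_eq_neg_add]
    have h2 : fromBlocks 1 0 (Z * H - H * Z') 1 * fromBlocks 1 0 (H * Z' - Z * H) 1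
        = (1 : Matrix (ι ⊕ ι) (ι ⊕ ι) R) := by
      simp [fromBlocks_multiply]
    have h3 : fromBlocks 1 (H.adjugate * W) 0 1 * fromBlocks 1 (-(H.adjugate * W)) 0 1
        = (1 : Matrix (ι ⊕ ι) (ι ⊕ ι) R) := by
      simp [fromBlocks_multiply]
    have h4 : fromBlocks 1 0 0 ε * fromBlocks 1 0 0 ε' = (1 : Matrix (ι ⊕ ι) (ι ⊕ ι) R) := by
      simp [fromBlocks_multiply, hεε']
    rw [← hΘ]
    calc _ = fromBlocks 1 0 0 ε * (fromBlocks 1 (H.adjugate * W) 0 1 *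
      (fromBlocks 1 0 (Z * H - H * Z') 1 * (fromBlocks H' (c • 1) (-Z) (-H) *
        fromBlocks H (c • 1) (-Z') (-H'))) * fromBlocks 1 (-(H.adjugate * W)) 0 1) *
      fromBlocks 1 0 0 ε' := by simp only [Matrix.mul_assoc]
      _ = 1 := by rw [h1, h2, Matrix.mul_one, h3, Matrix.mul_one, h4]
  clear_value Y
  -- remove the rows and columns where `Dg` is the identity
  obtain ⟨P, Q, P', Q', rfl⟩ : ∃ P Q P' Q', Ξ = fromBlocks P Q P' Q' :=
    ⟨_, _, _, _, (fromBlocks_toBlocks Ξ).symm⟩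
  rw [fromBlocks_multiply, ← fromBlocks_one, fromBlocks_inj] at hΞ
  obtain ⟨e1, e2, -, e4⟩ := hΞ
  let S : Matrix Unit ι R := replicateRow Unit (Pi.single i₀ 1)
  let S' : Matrix ι Unit R := replicateCol Unit (Pi.single i₀ 1)
  let D : Matrix ι ι R := 1 - S' * S
  have hSS' : S * S' = 1 := by
    ext i j; simp [S, S', Matrix.mul_apply, Pi.single_apply]
  have hSD : S * Dg * S' * S = S * Dg := by
    ext i j
    by_cases hj : j = i₀ <;>
    simp [S, S', Dg, Matrix.mul_apply, diagonal_apply, Pi.single_apply, Function.update_apply, hj]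
  have hDD : D * Dg = D := by
    ext i j
    by_cases hj : j = i₀
    · subst hj
      simp only [D, S, S', Dg, Matrix.mul_apply, diagonal_apply, 
        Function.update_apply, Matrix.one_apply, Matrix.sub_apply]
      by_cases hi : i = j <;> simp [hi]
    · simp [D, S, S', Dg, Matrix.mul_apply, diagonal_apply, Pi.single_apply,
        Function.update_apply, Matrix.one_apply, hj]
  have h5 : S' * S = 1 - D := by simp [D]
  clear_value D
  have hM : fromBlocks (S * H) (S * Dg * S') (-Z' - Y * D * H) (Y * S') *
      ((fromBlocks (P * S') Q (S * P' * S') (S * Q') : Matrix (ι ⊕ Unit) (Unit ⊕ ι) R) *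
        (fromBlocks 1 0 (-((-Z' - Y * D * H) * (P * S') + Y * S' * (S * P' * S'))) 1 :
          Matrix (Unit ⊕ ι) (Unit ⊕ ι) R)) = 1 := by
    rw [← Matrix.mul_assoc, fromBlocks_multiply]
    have a1 : S * H * (P * S') + S * Dg * S' * (S * P' * S') = 1 := by
      simp only [← Matrix.mul_assoc, hSD]
      rw [← Matrix.add_mul, Matrix.mul_assoc, Matrix.mul_assoc S, ← Matrix.mul_add, e1,
        Matrix.mul_one, hSS']
    have a2 : S * H * Q + S * Dg * S' * (S * Q') = 0 := by
      simp only [← Matrix.mul_assoc, hSD]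
      rw [Matrix.mul_assoc, Matrix.mul_assoc, ← Matrix.mul_add, e2, Matrix.mul_zero]
    have a3 : (-Z' - Y * D * H) * Q + Y * S' * (S * Q') = 1 := by
      have : D * H * Q + D * Q' = 0 := by
        rw [← hDD, Matrix.mul_assoc, Matrix.mul_assoc D Dg Q', hDD, ← Matrix.mul_add, e2,
          Matrix.mul_zero]
      rw [Matrix.mul_assoc Y S', ← Matrix.mul_assoc S', h5, Matrix.sub_mul, Matrix.sub_mul 1,
        Matrix.one_mul, Matrix.mul_sub, Matrix.mul_assoc Y, Matrix.mul_assoc Y,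
        eq_neg_of_add_eq_zero_left this, Matrix.mul_neg]
      refine Eq.trans ?_ e4
      abel
    rw [a1, a2, a3, fromBlocks_multiply]
    simp
  have := Completable.of_matrix (Equiv.sumComm Unit ι) _ _ hM (Sum.inl ())
  convert this using 1
  ext (j | j)
  · have : ∀ k, (if k = i₀ then if k = i₀ then a j else 0 else if k = i₀ then f (Hb k j) else 0)
        = if k = i₀ then a j else 0 := by intro k; split_ifs <;> rfl
    simp [S, H, Matrix.mul_apply, Pi.single_apply, this]
  · simp [S, S', Dg, Matrix.mul_apply, Pi.single_apply, diagonal_apply, Function.update_apply]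

end

section
variable {R : Type*} [CommRing R]

/-- Suslin's theorem on rows of factorial type. -/
theorem Completable.pow_max {R : Type*} [CommRing R] {m : ℕ} {z : Fin (m + 1) → R}
    (hz : Unimod z) : Completable fun i : Fin (m + 1) => z i ^ max 1 (i : ℕ) := by
  induction m generalizing R with
  | zero =>
    obtain ⟨w, hw⟩ := hz
    refine ⟨Matrix.of fun _ j => z j, Matrix.of fun i _ => w i, ?_, 0, ?_⟩
    · ext i j
      fin_cases i; fin_cases j
      simpa [Matrix.mul_apply, dotProduct] using hw
    · ext j; fin_cases j; simp
  | succ m ih =>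
    have h1 : Unimod fun i : Fin (m + 1) =>
        Ideal.Quotient.mk (Ideal.span {z (Fin.last _)}) (z i.castSucc) := by
      obtain ⟨w, hw⟩ := hz
      refine ⟨fun i => Ideal.Quotient.mk _ (w i.castSucc), ?_⟩
      have := congrArg (Ideal.Quotient.mk (Ideal.span {z (Fin.last _)})) hw
      rw [dotProduct, Fin.sum_univ_castSucc] at this
      simp only [map_add, map_sum, map_mul, map_one] at this
      rw [Ideal.Quotient.eq_zero_iff_mem.mpr (Ideal.mem_span_singleton_self _), zero_mul,
        add_zero] at this
      exact this
    have h2 := ih h1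
    have h3 : Completable (Ideal.Quotient.mk (Ideal.span {z (Fin.last _)}) ∘
        fun i : Fin (m + 1) => z i.castSucc ^ max 1 (i : ℕ)) := by
      convert h2 using 1
      ext i; simp
    have h4 := h3.sumElim_pow.comp_equiv
      ((finSumFinEquiv (m := m + 1) (n := 1)).symm.trans (Equiv.sumCongr (Equiv.refl _) (Equiv.ofUnique _ _)))
    convert h4 using 1
    ext i
    refine Fin.lastCases ?_ (fun i => ?_) i
    · have : finSumFinEquiv.symm (Fin.last (m+1)) = Sum.inr (0 : Fin 1) := by
        rw [Equiv.symm_apply_eq]; rfl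
      simp [this]
    · have : finSumFinEquiv.symm i.castSucc = (Sum.inl i : Fin (m+1) ⊕ Fin 1) := by
        rw [Equiv.symm_apply_eq]; rfl
      simp [this]
end

section
open Polynomial
variable {A : Type*} [CommRing A]

theorem exists_pseudo_remainder {s : A} {f : A[X]} {n j : ℕ} (hf : f.degree ≤ n)
    (hfn : f.coeff n = s ^ j) (g : A[X]) :
    ∃ K, ∃ r : A[X], r.degree < (n : ℕ) ∧ f ∣ C (s ^ K) * g - r := by
  have key : ∀ N, ∀ g : A[X], g.degree < (N : ℕ) →
      ∃ K, ∃ r : A[X], r.degree < (n : ℕ) ∧ f ∣ C (s ^ K) * g - r := by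
    intro N
    induction N with
    | zero =>
      intro g hg
      exact ⟨0, g, hg.trans_le (by exact_mod_cast Nat.zero_le n), by simp⟩
    | succ N ih =>
      intro g hg
      by_cases hN : N + 1 ≤ n
      · exact ⟨0, g, hg.trans_le (by exact_mod_cast hN), by simp⟩
      · push Not at hN
        obtain ⟨K, r, hr, hd⟩ := ih (C (s ^ j) * g - C (g.coeff N) * X ^ (N - n) * f) (by
          rw [degree_lt_iff_coeff_zero] at hg ⊢
          rw [degree_le_iff_coeff_zero] at hf
          intro m hm
          have e : (C (g.coeff N) * X ^ (N - n) * f).coeff m = g.coeff N * f.coeff (m - (N - n)) := by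
            rw [mul_assoc, coeff_C_mul, coeff_X_pow_mul', if_pos (by omega)]
          rw [coeff_sub, coeff_C_mul, e]
          rcases hm.eq_or_lt with rfl | hm'
          · rw [show N - (N - n) = n by omega, hfn]; ring
          · rw [hg m (by omega), hf (m - (N - n)) (by exact_mod_cast (by omega : n < m - (N - n)))]
            ring)
        refine ⟨K + j, r, hr, ?_⟩
        have := dvd_add hd (Dvd.intro_left (C (s ^ K) * (C (g.coeff N) * X ^ (N - n))) rfl)
        convert this using 1
        rw [pow_add, C_mul]; ring
  exact key (g.natDegree + 1) g (degree_le_natDegree.trans_lt (by exact_mod_cast Nat.lt_succ_self _))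

theorem exists_pseudo_remainders {κ : Type*} [Fintype κ] {s : A} {f : A[X]} {n j : ℕ}
    (hf : f.degree ≤ n) (hfn : f.coeff n = s ^ j) (g : κ → A[X]) :
    ∃ K, ∃ r : κ → A[X], ∀ i, (r i).degree < (n : ℕ) ∧ f ∣ C (s ^ K) * g i - r i := by
  choose K r hr hd using fun i => exists_pseudo_remainder hf hfn (g i)
  refine ⟨Finset.univ.sup K, fun i => C (s ^ (Finset.univ.sup K - K i)) * r i, fun i => ⟨?_, ?_⟩⟩
  · have := hr i
    rw [degree_lt_iff_coeff_zero] at this ⊢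
    intro m hm
    rw [coeff_C_mul, this m hm, mul_zero]
  · have hle : K i ≤ Finset.univ.sup K := Finset.le_sup (Finset.mem_univ i)
    have := (hd i).mul_left (C (s ^ (Finset.univ.sup K - K i)))
    convert this using 1
    rw [mul_sub, ← mul_assoc, ← C_mul, ← pow_add, Nat.sub_add_cancel hle]

theorem pow_mul_coeff_mem_leadingCoeffNth {I : Ideal A[X]} {n j : ℕ} {s : A} {f : A[X]} (hf : f ∈ I)
    (hfd : f.degree ≤ (n + 1 : ℕ)) (hfn : f.coeff (n + 1) = s ^ j) {h : A[X]} (hh : h ∈ I)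
    (hd : h.degree < (n + 1 : ℕ)) (k : ℕ) : ∃ M, s ^ M * h.coeff k ∈ I.leadingCoeffNth n := by
  have key : ∀ i k, i + k = n → ∀ h ∈ I, h.degree < (n + 1 : ℕ) →
      ∃ M, s ^ M * h.coeff k ∈ I.leadingCoeffNth n := by
    intro i
    induction i with
    | zero =>
      rintro k hk h hh hd
      refine ⟨0, mem_leadingCoeffNth_iff.mpr ⟨h, hh, ?_, ?_⟩⟩
      · exact Order.lt_succ_iff.mp (by exact_mod_cast hd)
      · simp [← hk]
    | succ i ih =>
      rintro k hk h hh hd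
      obtain ⟨M, hM⟩ := ih (k + 1) (by omega) (C (s ^ j) * X * h - C (h.coeff n) * f)
        (I.sub_mem (I.mul_mem_left _ hh) (I.mul_mem_left _ hf)) (by
          rw [degree_lt_iff_coeff_zero] at hd ⊢
          rw [degree_le_iff_coeff_zero] at hfd
          intro m hm
          obtain ⟨m, rfl⟩ : ∃ m', m = m' + 1 := ⟨m - 1, by omega⟩
          rw [coeff_sub, mul_assoc, coeff_C_mul, coeff_X_mul, coeff_C_mul]
          rcases hm.eq_or_lt with hm' | hm'
          · obtain rfl : n = m := by omega
            rw [hfn]; ring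
          · rw [hd m (by omega), hfd (m + 1) (by exact_mod_cast hm')]; ring)
      have hn : h.coeff n ∈ I.leadingCoeffNth n := mem_leadingCoeffNth_iff.mpr
        ⟨h, hh, Order.lt_succ_iff.mp (by exact_mod_cast hd), rfl⟩
      refine ⟨M + j, ?_⟩
      rw [coeff_sub, mul_assoc, coeff_C_mul, coeff_X_mul, coeff_C_mul] at hM
      have := Ideal.add_mem _ hM (Ideal.mul_mem_left _ (s ^ M * f.coeff (k + 1)) hn)
      convert this using 1
      rw [pow_add]; ring
  by_cases hk : k ≤ n
  · exact key (n - k) k (by omega) h hh hd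
  · rw [degree_lt_iff_coeff_zero] at hd
    exact ⟨0, by rw [hd k (by omega)]; simp⟩

/-- Lowering the degree of an entry whose leading coefficient is a power of `s`. -/
theorem exists_rowEquiv_degree_le [IsNoetherianRing A] {d : ℕ} {s : A}
    (hA : ∀ p : Ideal A, p.IsPrime → s ∉ p → p.height < d) (hd : 2 ≤ d) {ι : Type*} [Fintype ι]
    [DecidableEq ι] (hι : Fintype.card ι = d + 1) {v : ι → A[X]} (hv : Unimod v) {i₀ l : ι}
    (hi₀ : C s ∣ v i₀ - 1) {n j : ℕ} (hn : 1 ≤ n) (hl : (v l).degree ≤ (n + 1 : ℕ))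
    (hlc : (v l).coeff (n + 1) = s ^ j) :
    ∃ w, RowEquiv v w ∧ C s ∣ w i₀ - 1 ∧ ∃ l j, (w l).degree ≤ n ∧ (w l).coeff n = s ^ j := by
  obtain ⟨t, ht0, htl⟩ := exists_third (by omega) i₀ l
  obtain ⟨K, r, hr⟩ := exists_pseudo_remainders (κ := Fin (n + 1) ⊕ ι) hl hlc
    (Sum.elim (fun b => X ^ (b : ℕ) * v t) v)
  let Ω : Matrix (Fin (n + 1)) (Fin (n + 1)) A := Matrix.of fun a b => (r (Sum.inl b)).coeff a
  let W : ι → Fin (n + 1) → A := fun i a => (r (Sum.inr i)).coeff a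
  let J : Finset ι := {l, t}ᶜ
  have hJ : J.card = d - 1 := by
    rw [Finset.card_compl, Finset.card_pair htl.symm]; omega
  have hJm : ∀ i, i ∈ J ↔ i ≠ l ∧ i ≠ t := by simp [J]
  obtain ⟨c, hc⟩ := exists_add_mul_height (fun x : ι × Fin (n + 1) => (Ω.adjugate *ᵥ W x.1) x.2)
    (s * Ω.det) (J ×ˢ Finset.univ)
  let lam : ι → A[X] := fun i => C s * ∑ b : Fin (n + 1), C (c (i, b)) * X ^ (b : ℕ)
  let v' : ι → A[X] := fun i => if i ∈ J then v i + lam i * v t else v i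
  have hv't : v' t = v t := by simp [v', J]
  have hv'l : v' l = v l := by simp [v', J]
  have hvv' : RowEquiv v v' := RowEquiv.of_dvd t hv't fun i => by
    by_cases hi : i ∈ J <;> simp [v', hi]
  have hv'i₀ : C s ∣ v' i₀ - 1 := by
    by_cases hi : i₀ ∈ J
    · simp only [v', hi, if_true]
      rw [add_sub_right_comm]
      exact dvd_add hi₀ ⟨(∑ b : Fin (n + 1), C (c (i₀, b)) * X ^ (b : ℕ)) * v t, by simp only [lam]; ring⟩
    · simpa [v', hi] using hi₀
  have hv'u := hv.of_rowEquiv hvv'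
  let h : ι → A[X] := fun i => r (Sum.inr i) + ∑ b : Fin (n + 1), C (s * c (i, b)) * r (Sum.inl b)
  have hhd : ∀ i, (h i).degree < (n + 1 : ℕ) := by
    intro i
    refine (degree_add_le _ _).trans_lt (max_lt (hr _).1 ?_)
    have : ∀ b ∈ Finset.univ, C (s * c (i, b)) * r (Sum.inl b) ∈ degreeLT A (n + 1) := fun b _ => by
      rw [mem_degreeLT, degree_lt_iff_coeff_zero]
      have := (hr (Sum.inl b)).1
      rw [degree_lt_iff_coeff_zero] at this
      intro m hm
      rw [coeff_C_mul, this m hm, mul_zero]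
    exact mem_degreeLT.mp (Submodule.sum_mem _ this)
  have hhc : ∀ i (a : Fin (n + 1)), (h i).coeff a = W i a + s * (Ω *ᵥ fun b => c (i, b)) a := by
    intro i a
    simp only [h, coeff_add, finsetSum_coeff, coeff_C_mul, W, mulVec, dotProduct, Ω, Matrix.of_apply,
      Finset.mul_sum]
    congr 1
    exact Finset.sum_congr rfl fun b _ => by ring
  have hhv : ∀ i ∈ J, v l ∣ C (s ^ K) * v' i - h i := by
    intro i hi
    have h1 := (hr (Sum.inr i)).2
    have h2 := Finset.dvd_sum (s := Finset.univ) fun b _ =>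
      ((hr (Sum.inl b)).2).mul_left (C (s * c (i, b)))
    convert dvd_add h1 h2 using 1
    simp only [v', hi, if_true, h, lam, Sum.elim_inl, Sum.elim_inr, mul_sub, Finset.sum_sub_distrib,
      mul_add, Finset.mul_sum, Finset.sum_mul, C_mul]
    have : ∀ b : Fin (n + 1), C (s ^ K) * (C s * (C (c (i, b)) * X ^ (b : ℕ)) * v t) =
      C s * C (c (i, b)) * (C (s ^ K) * (X ^ (b : ℕ) * v t)) := fun b => by ring
    simp only [this]
    ring
  let I : Ideal A[X] := Ideal.span (Set.image v' {t}ᶜ)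
  have hIv : ∀ i ≠ t, v' i ∈ I := fun i hi => Ideal.subset_span ⟨i, hi, rfl⟩
  have hIl : v l ∈ I := by rw [← hv'l]; exact hIv l htl.symm
  have hIh : ∀ i ∈ J, h i ∈ I := by
    intro i hi
    obtain ⟨q, hq⟩ := hhv i hi
    rw [show h i = C (s ^ K) * v' i - v l * q by rw [← hq]; ring]
    exact I.sub_mem (I.mul_mem_left _ (hIv i ((hJm i).mp hi).2)) (I.mul_mem_right _ hIl)
  obtain ⟨M, hM⟩ : ∃ M, s ^ M ∈ I.leadingCoeffNth n := by
    by_contra hcon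
    push Not at hcon
    obtain ⟨p, hp, hle, hdis⟩ := Ideal.exists_le_prime_disjoint (I.leadingCoeffNth n)
      (Submonoid.powers s) (by
        rw [Set.disjoint_left]
        rintro x hx ⟨M, rfl⟩
        exact hcon M hx)
    have hsp : s ∉ p := fun h => Set.disjoint_left.mp hdis h ⟨1, by simp⟩
    have hhp : ∀ i ∈ J, ∀ k, (h i).coeff k ∈ p := by
      intro i hi k
      obtain ⟨M, hM⟩ := pow_mul_coeff_mem_leadingCoeffNth hIl hl hlc (hIh i hi) (hhd i) k
      exact (hp.mem_or_mem (hle hM)).resolve_left fun h => hsp (hp.mem_of_pow_mem _ h)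
    have hdet : Ω.det ∈ p := by
      have := hc p hp (by
        rintro ⟨i, a⟩ hia
        have hi : i ∈ J := (Finset.mem_product.mp hia).1
        have : (Ω.adjugate *ᵥ W i) a + c (i, a) * (s * Ω.det) =
            (Ω.adjugate *ᵥ fun k : Fin (n + 1) => (h i).coeff k) a := by
          have : (fun k : Fin (n + 1) => (h i).coeff k) = W i + s • (Ω *ᵥ fun b => c (i, b)) := by
            ext k; rw [hhc]; rfl
          rw [this, mulVec_add, mulVec_smul, mulVec_mulVec, adjugate_mul, smul_mulVec, one_mulVec]
          simp; ring
        rw [this]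
        simp only [mulVec, dotProduct]
        exact Ideal.sum_mem _ fun k _ => Ideal.mul_mem_left _ _ (hhp i hi k))
      rcases this with h | h
      · exact (hp.mem_or_mem h).resolve_left hsp
      · exfalso
        have h3 := h.trans_lt (hA p hp hsp)
        rw [Finset.card_product, hJ, Finset.card_univ, Fintype.card_fin] at h3
        have h4 : (d - 1) * (n + 1) < d := by exact_mod_cast h3
        obtain ⟨e, rfl⟩ : ∃ e, d = e + 2 := ⟨d - 2, by omega⟩
        rw [show e + 2 - 1 = e + 1 by omega] at h4
        nlinarith
    let φ : A →+* FractionRing (A ⧸ p) := (algebraMap (A ⧸ p) _).comp (Ideal.Quotient.mk p)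
    have hφ : ∀ a, φ a = 0 ↔ a ∈ p := fun a => by
      simp [φ, Ideal.Quotient.eq_zero_iff_mem]
    obtain ⟨u, hu0, hu⟩ := Matrix.exists_mulVec_eq_zero_iff (M := φ.mapMatrix Ω) |>.mpr (by
      rw [← RingHom.map_det, hφ]; exact hdet)
    let U : (FractionRing (A ⧸ p))[X] := ∑ b : Fin (n + 1), C (u b) * X ^ (b : ℕ)
    have hUc : ∀ b : Fin (n + 1), U.coeff b = u b := by
      intro b
      simp only [U, finsetSum_coeff, coeff_C_mul, coeff_X_pow, Fin.val_inj]
      simp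
    have hUd : U.degree < (n + 1 : ℕ) := by
      refine mem_degreeLT.mp (Submodule.sum_mem _ fun b _ => ?_)
      rw [mem_degreeLT]
      exact (degree_C_mul_X_pow_le _ _).trans_lt (by exact_mod_cast b.2)
    have hsu : IsUnit (C (φ (s ^ K))) := by
      refine isUnit_C.mpr (IsUnit.mk0 _ ?_)
      rw [Ne, hφ]
      exact fun h => hsp (hp.mem_of_pow_mem _ h)
    have hmap : ∀ g r : A[X], v l ∣ C (s ^ K) * g - r → ∀ w : (FractionRing (A ⧸ p))[X],
        (v l).map φ ∣ w * r.map φ → (v l).map φ ∣ w * g.map φ := by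
      intro g r hgr w hw
      have h1 := (Polynomial.map_dvd φ hgr).mul_left w
      rw [Polynomial.map_sub, Polynomial.map_mul, Polynomial.map_C, mul_sub,
        dvd_sub_left hw, mul_left_comm] at h1
      exact (hsu.dvd_mul_left).mp h1
    have hUt : (v l).map φ ∣ U * (v t).map φ := by
      have h1 := Finset.dvd_sum (s := Finset.univ) fun b _ =>
        ((hr (Sum.inl b)).2 |> Polynomial.map_dvd φ).mul_left (C (u b))
      have h2 : ∑ b, C (u b) * (r (Sum.inl b)).map φ = 0 := by
        ext m
        simp only [finsetSum_coeff, coeff_C_mul, coeff_map, coeff_zero]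
        by_cases hm : m < n + 1
        · have := congrFun hu ⟨m, hm⟩
          simp only [mulVec, dotProduct, RingHom.mapMatrix_apply, Matrix.map_apply, Ω, Matrix.of_apply,
            Pi.zero_apply] at this
          rw [← this]
          exact Finset.sum_congr rfl fun b _ => mul_comm _ _
        · refine Finset.sum_eq_zero fun b _ => ?_
          have := (hr (Sum.inl b)).1
          rw [degree_lt_iff_coeff_zero] at this
          rw [this m (by omega), map_zero, mul_zero]
      simp only [Polynomial.map_sub, Polynomial.map_mul, mul_sub, Finset.sum_sub_distrib, h2, sub_zero,
        Sum.elim_inl, Polynomial.map_C, Polynomial.map_pow, Polynomial.map_X] at h1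
      rw [← hsu.dvd_mul_left]
      convert h1 using 1
      simp only [U, Finset.sum_mul, Finset.mul_sum]
      exact Finset.sum_congr rfl fun b _ => by ring
    have hUi : ∀ i, (v l).map φ ∣ U * (v' i).map φ := by
      intro i
      by_cases hi : i ∈ J
      · refine hmap _ _ (hhv i hi) U ?_
        rw [show (h i).map φ = 0 from ?_, mul_zero]
        · exact dvd_zero _
        · ext m; rw [coeff_map, coeff_zero, hφ]; exact hhp i hi m
      · by_cases hil : i = l
        · rw [hil, hv'l]; exact Dvd.intro_left _ rfl
        · have hit : i = t := by by_contra hit; exact hi ((hJm i).mpr ⟨hil, hit⟩)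
          rw [hit, hv't]; exact hUt
    have hU : (v l).map φ ∣ U := by
      obtain ⟨w, hw⟩ := hv'u
      have h1 := congrArg (Polynomial.map φ) hw
      rw [dotProduct, Polynomial.map_sum, Polynomial.map_one] at h1
      rw [← mul_one U, ← h1, Finset.mul_sum]
      refine Finset.dvd_sum fun i _ => ?_
      rw [Polynomial.map_mul, ← mul_assoc]
      exact (hUi i).mul_right _
    have hU0 : U = 0 := by
      refine eq_zero_of_dvd_of_degree_lt hU (hUd.trans_le ?_)
      refine le_degree_of_ne_zero ?_
      rw [coeff_map, hlc, Ne, hφ]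
      exact fun h => hsp (hp.mem_of_pow_mem _ h)
    exact hu0 (by ext b; rw [← hUc b, hU0]; simp)
  obtain ⟨K', r', hr', q, hq⟩ := exists_pseudo_remainder hl hlc (v t)
  have hmem : s ^ M - s ^ (K' + 2 * M) * r'.coeff n ∈ I.leadingCoeffNth n := by
    refine sub_mem hM (Ideal.mul_mem_right _ _ ?_)
    rw [show K' + 2 * M = (K' + M) + M by ring, pow_add]
    exact Ideal.mul_mem_left _ _ hM
  obtain ⟨g, hg, hgd, hgc⟩ := mem_leadingCoeffNth_iff.mp hmem
  have hr'' : r'.degree ≤ n := Order.lt_succ_iff.mp (by exact_mod_cast hr')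
  refine ⟨Function.update v' t (C (s ^ (K' + 2 * M)) * r' + g), ?_, ?_, t, M, ?_, ?_⟩
  · obtain ⟨y, hy⟩ := hv'i₀
    have h1 := RowEquiv.scale_sq (by omega) hv'u (i := i₀) (j := t) ht0.symm (t := C (s ^ (K' + M)))
      (t' := (-y) ^ (K' + M)) (by
        rw [C_pow, ← mul_pow]
        refine dvd_trans ?_ (sub_one_dvd_pow_sub_one _ _)
        exact ⟨-1, by linear_combination hy⟩)
    refine hvv'.trans (h1.trans ?_)
    have h2 := RowEquiv.update_of_mem (v := Function.update v' t (C (s ^ (K' + M)) ^ 2 * v' t)) t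
      (x := C (s ^ (K' + 2 * M)) * r' + g) (by
        have : Function.update v' t (C (s ^ (K' + M)) ^ 2 * v' t) '' {t}ᶜ = Set.image v' {t}ᶜ := by
          refine Set.image_congr fun i hi => ?_
          rw [Function.update_of_ne hi]
        rw [this, Function.update_self, hv't]
        have e : C (s ^ (K' + 2 * M)) * r' + g - C (s ^ (K' + M)) ^ 2 * v t =
            g - (C (s ^ (K' + 2 * M)) * q) * v l := by
          have : C (s ^ (K' + M)) ^ 2 = C (s ^ (K' + 2 * M)) * C (s ^ K') := by
            rw [← C_pow, ← C_mul]; congr 1; ring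
          rw [this]
          linear_combination (-C (s ^ (K' + 2 * M))) * hq
        rw [e]
        exact I.sub_mem hg (I.mul_mem_left _ hIl))
    simpa using h2
  · rw [Function.update_of_ne ht0.symm]; exact hv'i₀
  · rw [Function.update_self]
    refine (degree_add_le _ _).trans (max_le ?_ hgd)
    rw [degree_le_iff_coeff_zero] at hr'' ⊢
    intro m hm
    rw [coeff_C_mul, hr'' m hm, mul_zero]
  · rw [Function.update_self, coeff_add, coeff_C_mul, hgc]; ring

theorem exists_add_sum_notMem_primes {ι : Type*} (T : Finset (Ideal A)) (hT : ∀ p ∈ T, p.IsPrime)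
    (x : A) (y : ι → A) (S : Finset ι) :
    ∃ t : ι → A, ∀ p ∈ T, x + ∑ j ∈ S, t j * y j ∈ p → x ∈ p ∧ ∀ j ∈ S, y j ∈ p := by
  classical
  induction S using Finset.induction_on with
  | empty => exact ⟨0, fun p _ h => by simpa using h⟩
  | insert j S hj ih =>
    obtain ⟨t, ht⟩ := ih
    obtain ⟨c, hc⟩ := exists_add_mul_notMem_primes T hT (x + ∑ j ∈ S, t j * y j) (y j)
    refine ⟨Function.update t j c, fun p hp h => ?_⟩
    have e : ∑ k ∈ S, Function.update t j c k * y k = ∑ k ∈ S, t k * y k :=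
      Finset.sum_congr rfl fun k hk => by
        rw [Function.update_of_ne (show k ≠ j from fun h => hj (h ▸ hk))]
    rw [Finset.sum_insert hj, e, Function.update_self] at h
    have h1 := hc p hp (by convert h using 1; ring)
    have h2 := ht p hp (by
      have := p.sub_mem h (p.mul_mem_left c h1)
      convert this using 1; ring)
    exact ⟨h2.1, fun k hk => (Finset.mem_insert.mp hk).elim (fun h => h ▸ h1) (h2.2 k)⟩

theorem exists_rowEquiv_C_of_degree_le_one {s : A} {ι : Type*} [Fintype ι]
    [DecidableEq ι] (hι : 3 ≤ Fintype.card ι) (T : Finset (Ideal A))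
    (hT : ∀ p ∈ T, p.IsPrime ∧ s ∉ p) {v : ι → A[X]} (hv : Unimod v) {i₀ l : ι}
    (hi₀ : C s ∣ v i₀ - 1) {j : ℕ} (hl : (v l).degree ≤ 1) (hlc : (v l).coeff 1 = s ^ j) :
    ∃ w, RowEquiv v w ∧ ∃ i c, w i = C c ∧ ∀ p ∈ T, c ∉ p := by
  obtain ⟨i, hi0, hil⟩ := exists_third hι i₀ l
  obtain ⟨K, r, hr⟩ := exists_pseudo_remainders (n := 1) (by exact_mod_cast hl) hlc v
  obtain ⟨x, rfl⟩ : ∃ x : ι → A, r = fun k => C (x k) := by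
    refine ⟨fun k => (r k).coeff 0, funext fun k => ?_⟩
    exact eq_C_of_degree_le_zero (Order.lt_succ_iff.mp (by exact_mod_cast (hr k).1))
  obtain ⟨t, ht⟩ := exists_add_sum_notMem_primes T (fun p hp => (hT p hp).1) (x i) x ({i, l}ᶜ)
  set x' := x i + ∑ j ∈ ({i, l} : Finset ι)ᶜ, t j * x j with hx'
  have hx'T : ∀ p ∈ T, x' ∉ p := by
    intro p hp hxp
    have := (hT p hp).1
    obtain ⟨h1, h2⟩ := ht p hp hxp
    have h3 : ∀ k, (v l).map (Ideal.Quotient.mk p) ∣ C (Ideal.Quotient.mk p (s ^ K)) *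
        (v k).map (Ideal.Quotient.mk p) := by
      intro k
      by_cases hkl : k = l
      · rw [hkl]; exact Dvd.intro_left _ rfl
      · have hk : x k ∈ p := by
          by_cases hki : k = i
          · rw [hki]; exact h1
          · exact h2 k (by simp [hki, hkl])
        have := Polynomial.map_dvd (Ideal.Quotient.mk p) (hr k).2
        simpa [Ideal.Quotient.eq_zero_iff_mem.mpr hk] using this
    obtain ⟨w, hw⟩ := hv
    have h4 : (v l).map (Ideal.Quotient.mk p) ∣ C (Ideal.Quotient.mk p (s ^ K)) := by
      have h5 := congrArg (Polynomial.map (Ideal.Quotient.mk p)) hw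
      rw [dotProduct, Polynomial.map_sum, Polynomial.map_one] at h5
      rw [← mul_one (C _), ← h5, Finset.mul_sum]
      refine Finset.dvd_sum fun k _ => ?_
      rw [Polynomial.map_mul, ← mul_assoc]
      exact (h3 k).mul_right _
    have hs : ∀ m, Ideal.Quotient.mk p (s ^ m) ≠ 0 := fun m h =>
      (hT p hp).2 ((hT p hp).1.mem_of_pow_mem _ (Ideal.Quotient.eq_zero_iff_mem.mp h))
    have h6 := degree_le_of_dvd h4 (C_ne_zero.mpr (hs K))
    rw [degree_C (hs K)] at h6
    have h7 : ((1 : ℕ) : WithBot ℕ) ≤ ((v l).map (Ideal.Quotient.mk p)).degree :=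
      le_degree_of_ne_zero (by rw [coeff_map, hlc]; exact hs j)
    exact absurd (h7.trans h6) (by decide)
  set vi := v i + ∑ j ∈ ({i, l} : Finset ι)ᶜ, C (t j) * v j with hvi
  have hvl : ∀ y, v l ∈ Ideal.span (Function.update v i y '' {i}ᶜ) := fun y =>
    Ideal.subset_span ⟨l, fun h => hil h.symm, Function.update_of_ne hil.symm _ _⟩
  have h1 : RowEquiv v (Function.update v i vi) := by
    refine RowEquiv.update_add_of_mem v i (Ideal.sum_mem _ fun k hk => Ideal.mul_mem_left _ _ ?_)
    refine Ideal.subset_span ⟨k, ?_, rfl⟩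
    simp only [Finset.mem_compl, Finset.mem_insert, not_or] at hk
    exact hk.1
  obtain ⟨y, hy⟩ := hi₀
  have h2 := RowEquiv.scale_sq hι (hv.of_rowEquiv h1) (i := i₀) (j := i) hi0.symm (t := C (s ^ K))
      (t' := (-y) ^ K) (by
        rw [C_pow, ← mul_pow, Function.update_of_ne hi0.symm]
        refine dvd_trans ?_ (sub_one_dvd_pow_sub_one _ _)
        exact ⟨-1, by linear_combination hy⟩)
  rw [Function.update_self, Function.update_idem] at h2
  have hd : v l ∣ C (s ^ K) * vi - C x' := by
    have := dvd_add (hr i).2 (Finset.dvd_sum (s := ({i, l} : Finset ι)ᶜ) fun k _ =>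
      ((hr k).2).mul_left (C (t k)))
    convert this using 1
    simp only [hvi, hx', map_add, map_sum, C_mul, mul_sub, Finset.sum_sub_distrib, mul_add,
      Finset.mul_sum, mul_left_comm (C (s ^ K))]
    ring
  have h3 := RowEquiv.update_of_mem (v := Function.update v i (C (s ^ K) ^ 2 * vi)) i
    (x := C (s ^ K * x')) (by
      rw [Function.update_self]
      obtain ⟨q, hq⟩ := hd
      rw [show C (s ^ K * x') - C (s ^ K) ^ 2 * vi = -(C (s ^ K) * q) * v l by
        rw [C_mul]; linear_combination (-C (s ^ K)) * hq]
      exact Ideal.mul_mem_left _ _ (hvl _))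
  rw [Function.update_idem] at h3
  refine ⟨_, h1.trans (h2.trans h3), i, s ^ K * x', Function.update_self _ _ _, fun p hp h => ?_⟩
  rcases (hT p hp).1.mem_or_mem h with h | h
  · exact (hT p hp).2 ((hT p hp).1.mem_of_pow_mem _ h)
  · exact hx'T p hp h

theorem exists_rowEquiv_C_of_coeff_eq [IsNoetherianRing A] {d : ℕ} {s : A}
    (hA : ∀ p : Ideal A, p.IsPrime → s ∉ p → p.height < d) (hd : 2 ≤ d) {ι : Type*} [Fintype ι]
    [DecidableEq ι] (hι : Fintype.card ι = d + 1) (T : Finset (Ideal A))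
    (hT : ∀ p ∈ T, p.IsPrime ∧ s ∉ p) (n : ℕ) : ∀ {v : ι → A[X]} (hv : Unimod v) {i₀ l : ι}
    (hi₀ : C s ∣ v i₀ - 1) {j : ℕ} (hl : (v l).degree ≤ n) (hlc : (v l).coeff n = s ^ j),
    ∃ w, RowEquiv v w ∧ ∃ i c, w i = C c ∧ ∀ p ∈ T, c ∉ p := by
  induction n with
  | zero =>
    intro v hv i₀ l hi₀ j hl hlc
    refine ⟨v, RowEquiv.refl _, l, s ^ j, ?_, fun p hp h =>
      (hT p hp).2 ((hT p hp).1.mem_of_pow_mem _ h)⟩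
    rw [← hlc]; exact eq_C_of_degree_le_zero hl
  | succ n ih =>
    intro v hv i₀ l hi₀ j hl hlc
    rcases Nat.eq_zero_or_pos n with rfl | hn
    · exact exists_rowEquiv_C_of_degree_le_one (by omega) T hT hv hi₀ (by exact_mod_cast hl) hlc
    · obtain ⟨w, hw, hw0, l, j, h1, h2⟩ := exists_rowEquiv_degree_le hA hd hι hv hi₀ hn hl hlc
      obtain ⟨w', hw', h⟩ := ih (hv.of_rowEquiv hw) hw0 h1 h2
      exact ⟨w', hw.trans hw', h⟩

theorem HeightLE.quotient {d : ℕ} (h : HeightLE A (d + 1)) {c : A} (hc : ∀ p ∈ minimalPrimes A, c ∉ p) :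
    HeightLE (A ⧸ Ideal.span {c}) d := by
  have key : ∀ n : ℕ, ∀ q : Ideal (A ⧸ Ideal.span {c}), q.IsPrime →
      (q.comap (Ideal.Quotient.mk _)).height < (n + 1 : ℕ) → q.height < n := by
    intro n
    induction n with
    | zero =>
      intro q hq h
      exfalso
      have : (q.comap (Ideal.Quotient.mk _)).height = 0 := by
        simpa using Order.lt_one_iff.mp (by exact_mod_cast h)
      refine hc _ (Ideal.height_eq_zero_iff.mp this) ?_
      rw [Ideal.mem_comap, Ideal.Quotient.eq_zero_iff_mem.mpr (Ideal.mem_span_singleton_self c)]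
      exact q.zero_mem
    | succ n ih =>
      intro q hq h
      have h' : (q.comap (Ideal.Quotient.mk (Ideal.span {c}))).height ≤ ((n + 1 : ℕ) : ℕ∞) := by
        rwa [Nat.cast_add_one (n + 1), ENat.lt_add_one_iff (ENat.natCast_ne_top _)] at h
      rw [Ideal.height_le_iff] at h'
      refine lt_of_le_of_lt (b := (n : ℕ∞)) (Ideal.height_le_iff.mpr fun q' hq' hlt => ?_)
        (by exact_mod_cast Nat.lt_succ_self n)
      refine ih q' hq' (h' _ inferInstance ?_)
      exact (Ideal.comap_mono hlt.le).lt_of_ne fun h =>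
        hlt.ne (Ideal.comap_injective_of_surjective _ Ideal.Quotient.mk_surjective h)
  intro q hq
  have := key (d + 1) q hq ((h _ inferInstance).trans_lt (by exact_mod_cast Nat.lt_succ_self _))
  rwa [Nat.cast_add_one d, ENat.lt_add_one_iff (ENat.natCast_ne_top _)] at this
end

section
open Polynomial
variable {A : Type*} [CommRing A]

theorem degree_C_mul_le {a : A} {f : A[X]} : (C a * f).degree ≤ f.degree := by
  rw [← smul_eq_C_mul]; exact degree_smul_le _ _

theorem height_lt_of_notMem [IsNoetherianRing A] [IsLocalRing A] {d : ℕ} {s : A} (h : HeightLE A d)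
    (hs : s ∈ IsLocalRing.maximalIdeal A) (p : Ideal A) (hp : p.IsPrime) (hsp : s ∉ p) :
    p.height < d :=
  Ideal.height_le_iff.mp (h _ inferInstance) p hp
    ((IsLocalRing.le_maximalIdeal hp.ne_top).lt_of_ne fun e => hsp (e ▸ hs))

theorem exists_mem_coeff_eq_pow [IsNoetherianRing A] {d : ℕ} {s : A}
    (hA : ∀ p : Ideal A, p.IsPrime → s ∉ p → p.height < d) (J : Ideal A[X])
    (hJ : ∀ P : Ideal A[X], P.IsPrime → J ≤ P → C s ∈ P ∨ (d : ℕ∞) ≤ P.height) :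
    ∃ F ∈ J, ∃ N j, F.degree ≤ (N : ℕ) ∧ F.coeff N = s ^ j := by
  letI := Polynomial.algebra A (Localization.Away s)
  have := Polynomial.isLocalization (Submonoid.powers s) (Localization.Away s)
  have hmap : ∀ f : A[X], algebraMap A[X] (Localization.Away s)[X] f =
    f.map (algebraMap A (Localization.Away s)) := fun f => rfl
  have : IsNoetherianRing (Localization.Away s) :=
    IsLocalization.isNoetherianRing (Submonoid.powers s) _ inferInstance
  have hD : HeightLE (Localization.Away s) (d - 1) := by
    intro q hq
    rw [← IsLocalization.height_under (Submonoid.powers s)]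
    have : s ∉ q.under A := fun h => hq.ne_top (Ideal.eq_top_of_isUnit_mem _ h
      (IsLocalization.Away.algebraMap_isUnit s))
    have := hA _ inferInstance this
    rcases d with _ | d
    · simp at this
    · rwa [Nat.cast_add_one d, ENat.lt_add_one_iff (ENat.natCast_ne_top _)] at this
  obtain ⟨g, hg, hgm⟩ := exists_monic_mem_of_forall_prime
    (J.map (algebraMap A[X] (Localization.Away s)[X])) (fun P hP hle => by
      by_contra! hcon
      have h1 := height_le_of_forall_not_monic hD P hcon
      have h2 := IsLocalization.height_under ((Submonoid.powers s).map C) P (R := A[X])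
      rcases hJ (P.under A[X]) inferInstance (Ideal.map_le_iff_le_comap.mp hle) with h | h
      · refine hP.ne_top (Ideal.eq_top_of_isUnit_mem _ h ?_)
        exact IsLocalization.map_units (M := (Submonoid.powers s).map C) _
          ⟨C s, Submonoid.mem_map_of_mem _ (Submonoid.mem_powers s)⟩
      · rw [h2] at h
        have h3 := h.trans h1
        have h4 : d = 0 := by
          have : d ≤ d - 1 := by exact_mod_cast h3
          omega
        subst h4
        have := hA ((P.under A[X]).under A) inferInstance (fun h => by
          refine hP.ne_top (Ideal.eq_top_of_isUnit_mem _ (x := algebraMap A[X] _ (C s)) h ?_)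
          exact IsLocalization.map_units (M := (Submonoid.powers s).map C) _
            ⟨C s, Submonoid.mem_map_of_mem _ (Submonoid.mem_powers s)⟩)
        simp at this)
  rw [IsLocalization.mem_map_algebraMap_iff ((Submonoid.powers s).map C)] at hg
  obtain ⟨⟨⟨f, hf⟩, ⟨_, _, ⟨k, rfl⟩, rfl⟩⟩, h⟩ := hg
  simp only [hmap] at h
  set N := g.natDegree
  have hco : ∀ i, algebraMap A (Localization.Away s) (f.coeff i) = g.coeff i * algebraMap A _ (s ^ k) := by
    intro i
    have := congrArg (fun p => p.coeff i) h
    simp only [coeff_map, map_C, coeff_mul_C] at this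
    exact this.symm
  obtain ⟨⟨_, _, ⟨m, rfl⟩, rfl⟩, hm⟩ := IsLocalization.exists_of_eq (M := (Submonoid.powers s).map C)
    (S := (Localization.Away s)[X]) (x := f)
    (y := (∑ i ∈ Finset.range N, C (f.coeff i) * X ^ i) + C (s ^ k) * X ^ N) (by
      rw [hmap, hmap]
      ext i
      simp only [coeff_map, coeff_add, finsetSum_coeff, coeff_C_mul, coeff_X_pow, map_add, 
        mul_ite, mul_one, mul_zero, apply_ite (algebraMap A (Localization.Away s)), map_zero,
        Finset.sum_ite_eq, Finset.mem_range]
      rw [hco]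
      rcases lt_trichotomy i N with hi | rfl | hi
      · simp [hi, hi.ne]
      · rw [show g.coeff N = 1 from hgm.coeff_natDegree]; simp
      · rw [coeff_eq_zero_of_natDegree_lt hi]
        simp [hi.ne', hi.not_gt])
  refine ⟨C (s ^ m) * f, J.mul_mem_left _ hf, N, m + k, ?_, ?_⟩
  · erw [hm]
    refine (degree_C_mul_le).trans ((degree_add_le _ _).trans (max_le ?_ (degree_C_mul_X_pow_le _ _)))
    refine (degree_sum_le _ _).trans (Finset.sup_le fun i hi => ?_)
    exact (degree_C_mul_X_pow_le _ _).trans (by exact_mod_cast (Finset.mem_range.mp hi).le)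
  · erw [hm]
    rw [coeff_C_mul, coeff_add, finsetSum_coeff, coeff_C_mul, coeff_X_pow_self]
    rw [Finset.sum_eq_zero fun i hi => by
      rw [coeff_C_mul_X_pow, if_neg (Finset.mem_range.mp hi).ne']]
    rw [zero_add, mul_one, pow_add]

theorem exists_rowEquiv_coeff_eq [IsNoetherianRing A] [IsLocalRing A] {d : ℕ} {s : A}
    (h : HeightLE A d) (hd : 2 ≤ d) {ι : Type*} [Fintype ι] [DecidableEq ι]
    (hι : Fintype.card ι = d + 1) (hsm : s ∈ IsLocalRing.maximalIdeal A)
    (hs : ∀ p ∈ minimalPrimes A, s ∉ p) {v : ι → A[X]} (hv : Unimod v) :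
    ∃ w, RowEquiv v w ∧ ∃ i₀ n j, C s ∣ w i₀ - 1 ∧ (w i₀).degree ≤ (n : ℕ) ∧ (w i₀).coeff n = s ^ j := by
  obtain ⟨e, rfl⟩ : ∃ e, d = e + 1 := ⟨d - 1, by omega⟩
  have : Nonempty ι := Fintype.card_pos_iff.mp (by omega)
  obtain ⟨i₀⟩ := this
  have hA := height_lt_of_notMem h hsm
  set I := Ideal.span {s}
  have hI : I ≤ IsLocalRing.maximalIdeal A := (Ideal.span_singleton_le_iff_mem _).mpr hsm
  have : Nontrivial (A ⧸ I) := Ideal.Quotient.nontrivial_iff.mpr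
    (ne_top_of_le_ne_top (IsLocalRing.maximalIdeal.isMaximal A).ne_top hI)
  have : IsLocalRing (A ⧸ I) := .of_surjective' _ Ideal.Quotient.mk_surjective
  have hq := rowEquiv_single_polynomial (HeightLE.quotient h hs) (by omega) (by omega)
    (hv.map (mapRingHom (Ideal.Quotient.mk I))) i₀
  obtain ⟨v', hvv', hv'⟩ := RowEquiv.exists_lift
    (Polynomial.map_surjective (Ideal.Quotient.mk I) Ideal.Quotient.mk_surjective) hq
  have hv'i : C s ∣ v' i₀ - 1 := by
    rw [C_dvd_iff_dvd_coeff]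
    intro k
    have h1 := congrFun hv' i₀
    simp only [Function.comp_apply, coe_mapRingHom, Pi.single_eq_same] at h1
    have h2 : ((v' i₀ - 1).map (Ideal.Quotient.mk I)).coeff k = 0 := by
      rw [Polynomial.map_sub, h1, Polynomial.map_one, sub_self, coeff_zero]
    rw [coeff_map, Ideal.Quotient.eq_zero_iff_mem, Ideal.mem_span_singleton] at h2
    exact h2
  have hv'u := hv.of_rowEquiv hvv'
  obtain ⟨c, hc⟩ := exists_add_mul_height v' (C s * v' i₀) (Finset.univ.erase i₀)
  set w : ι → A[X] := fun j => if j = i₀ then v' i₀ else v' j + c j * (C s * v' i₀) with hw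
  have hwi : w i₀ = v' i₀ := by simp [hw]
  have hvw : RowEquiv v' w := RowEquiv.of_dvd i₀ hwi fun j => by
    by_cases hj : j = i₀
    · simp [hw, hj]
    · simp only [hw, if_neg hj, add_sub_cancel_left]
      exact ⟨c j * C s, by ring⟩
  have hwu := hv'u.of_rowEquiv hvw
  obtain ⟨F, hF, N, j, hFN, hFj⟩ := exists_mem_coeff_eq_pow hA (Ideal.span (w '' {i₀}ᶜ))
    (fun P hP hle => by
      have hmem : ∀ i, i ≠ i₀ → w i ∈ P := fun i hi => hle (Ideal.subset_span ⟨i, hi, rfl⟩)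
      rcases hc P hP (fun i hi => by
        have := hmem i (Finset.ne_of_mem_erase hi)
        simpa only [hw, if_neg (Finset.ne_of_mem_erase hi)] using this) with h | h
      · rcases hP.mem_or_mem h with h | h
        · exact Or.inl h
        · exfalso
          obtain ⟨i, hi⟩ := hwu.exists_notMem hP.ne_top
          refine hi ?_
          by_cases hii : i = i₀
          · rw [hii, hwi]; exact h
          · exact hmem i hii
      · right
        rw [Finset.card_erase_of_mem (Finset.mem_univ _), Finset.card_univ, hι] at h
        simpa using h)
  set E := (v' i₀).natDegree + 1
  refine ⟨Function.update w i₀ (w i₀ + C s * X ^ E * F), (hvv'.trans hvw).trans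
    (RowEquiv.update_add_of_mem w i₀ (Ideal.mul_mem_left _ _ hF)), i₀, E + N, j + 1, ?_, ?_, ?_⟩
  · rw [Function.update_self, hwi]
    convert dvd_add hv'i (Dvd.intro (X ^ E * F) rfl) using 1
    ring
  · rw [Function.update_self, hwi]
    refine (degree_add_le _ _).trans (max_le ?_ ?_)
    · exact degree_le_natDegree.trans (by exact_mod_cast (by omega))
    · rw [mul_assoc]
      refine (degree_C_mul_le).trans ((degree_mul_le _ _).trans ?_)
      push_cast
      exact add_le_add (degree_X_pow_le _) hFN
  · rw [Function.update_self, hwi, coeff_add, coeff_eq_zero_of_natDegree_lt (by omega), mul_assoc,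
      coeff_C_mul, add_comm E N, coeff_X_pow_mul, hFj]
    ring

/-- Over a local ring of dimension at most `d`, a unimodular row of length `d + 1` over the
polynomial ring can be moved so that it has a constant entry outside all minimal primes. -/
theorem exists_rowEquiv_C [IsNoetherianRing A] [IsLocalRing A] {d : ℕ}
    (h : HeightLE A d) (hd : 2 ≤ d) {ι : Type*} [Fintype ι] [DecidableEq ι]
    (hι : Fintype.card ι = d + 1) {v : ι → A[X]} (hv : Unimod v) :
    ∃ w, RowEquiv v w ∧ ∃ i c, w i = C c ∧ ∀ p ∈ minimalPrimes A, c ∉ p := by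
  have hfin := minimalPrimes.finite_of_isNoetherianRing A
  by_cases hm : ∃ s ∈ IsLocalRing.maximalIdeal A, ∀ p ∈ minimalPrimes A, s ∉ p
  · obtain ⟨s, hsm, hs⟩ := hm
    obtain ⟨w, hvw, i₀, n, j, h1, h2, h3⟩ := exists_rowEquiv_coeff_eq h hd hι hsm hs hv
    obtain ⟨w', hw', i, c, hi, hc⟩ := exists_rowEquiv_C_of_coeff_eq (height_lt_of_notMem h hsm) hd hι
      hfin.toFinset (fun p hp => by
        rw [Set.Finite.mem_toFinset] at hp
        exact ⟨hp.1.1, hs p hp⟩) n (hv.of_rowEquiv hvw) h1 h2 h3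
    exact ⟨w', hvw.trans hw', i, c, hi, fun p hp => hc p (by simpa using hp)⟩
  · push Not at hm
    have h0 : HeightLE A 0 := by
      have : ((IsLocalRing.maximalIdeal A : Ideal A) : Set A) ⊆ ⋃ p ∈ (hfin.toFinset : Set (Ideal A)), (p : Set A) := by
        intro s hs
        obtain ⟨p, hp, hsp⟩ := hm s hs
        simp only [Set.mem_iUnion]
        exact ⟨p, by simpa using hp, hsp⟩
      rw [Ideal.subset_union_prime ⊥ ⊥ (fun p hp _ _ => by
        rw [Set.Finite.mem_toFinset] at hp; exact hp.1.1)] at this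
      obtain ⟨p, hp, hle⟩ := this
      rw [Set.Finite.mem_toFinset] at hp
      intro q hq
      have hqp : q ≤ p := (IsLocalRing.le_maximalIdeal hq.ne_top).trans hle
      have := hp.1.1
      have h1 := Ideal.height_mono hqp
      rw [Ideal.height_eq_zero_iff.mpr hp] at h1
      exact_mod_cast h1
    have : Nonempty ι := Fintype.card_pos_iff.mp (by omega)
    obtain ⟨i₀⟩ := this
    refine ⟨_, rowEquiv_single_polynomial h0 (by omega) (by omega) hv i₀, i₀, 1, by simp, ?_⟩
    intro p hp h1
    exact hp.1.1.ne_top ((Ideal.eq_top_iff_one _).mpr h1)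
end

section Injective
variable {R : Type*} [CommRing R] {ι : Type} [Fintype ι] [DecidableEq ι]

theorem StableRange.exists_span_compl (h : StableRange R (Fintype.card ι - 1)) (i : ι) {v : ι → R}
    (hv : Unimod v) : ∃ c : ι → R, c i = 0 ∧ Ideal.span ((v + v i • c) '' {i}ᶜ) = ⊤ := by
  obtain ⟨c, hc⟩ := h {j : ι // j ≠ i} (by
    rw [Fintype.card_subtype_compl, Fintype.card_subtype_eq]) (fun j => v j) (v i) (by
      rw [← Ideal.span_union, ← top_le_iff, ← unimod_iff_span.mp hv, Ideal.span_le]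
      rintro _ ⟨j, rfl⟩
      by_cases hj : j = i
      · exact Ideal.subset_span (Or.inr (by simp [hj]))
      · exact Ideal.subset_span (Or.inl ⟨⟨j, hj⟩, rfl⟩))
  refine ⟨fun j => if hj : j = i then 0 else c ⟨j, hj⟩, by simp, ?_⟩
  rw [unimod_iff_span] at hc
  rw [← top_le_iff, ← hc]
  refine Ideal.span_mono ?_
  rintro _ ⟨⟨j, hj⟩, rfl⟩
  exact ⟨j, hj, by simp [hj, mul_comm]⟩

theorem StableRange.exists_add_smul (h : StableRange R (Fintype.card ι - 1)) (i : ι) {r : ι → R}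
    {δ : R} (hr : Ideal.span (Set.range r) ⊔ Ideal.span {δ} = ⊤) :
    ∃ y : ι → R, y i = 0 ∧ Unimod (r + δ • y) := by
  set f := Ideal.Quotient.mk (Ideal.span {r i}) with hf
  have hfi : f (r i) = 0 := Ideal.Quotient.eq_zero_iff_mem.mpr (Ideal.mem_span_singleton_self _)
  obtain ⟨c, hc⟩ := (h.of_surjective f Ideal.Quotient.mk_surjective) {j : ι // j ≠ i} (by
    rw [Fintype.card_subtype_compl, Fintype.card_subtype_eq]) (fun j => f (r j)) (f δ) (by
      have := congrArg (Ideal.map f) hr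
      rw [Ideal.map_top, Ideal.map_sup, Ideal.map_span, Ideal.map_span, Set.image_singleton] at this
      rw [← top_le_iff, ← this]
      refine sup_le_sup_right (Ideal.span_le.mpr ?_) _
      rintro _ ⟨_, ⟨j, rfl⟩, rfl⟩
      by_cases hj : j = i
      · rw [hj, hfi]; exact Ideal.zero_mem _
      · exact Ideal.subset_span ⟨⟨j, hj⟩, rfl⟩)
  choose c' hc' using fun j => Ideal.Quotient.mk_surjective (c j)
  refine ⟨fun j => if hj : j = i then 0 else c' ⟨j, hj⟩, by simp, unimod_of_forall_prime ?_⟩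
  intro p hp
  by_contra! hcon
  have hi : r i ∈ p := by simpa using hcon i
  have hle : Ideal.span {r i} ≤ p := (Ideal.span_singleton_le_iff_mem _).mpr hi
  obtain ⟨w, hw⟩ := hc
  choose w' hw' using fun j => Ideal.Quotient.mk_surjective (w j)
  refine hp.ne_top ((Ideal.eq_top_iff_one _).mpr ?_)
  have h1 : f (1 - ∑ j : {j : ι // j ≠ i}, (r j + c' j * δ) * w' j) = 0 := by
    rw [map_sub, map_one, map_sum, ← hw, dotProduct, sub_eq_zero]
    refine Finset.sum_congr rfl fun j _ => ?_
    rw [map_mul, map_add, map_mul, hc', hw']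
  rw [hf, Ideal.Quotient.eq_zero_iff_mem] at h1
  have h2 : ∑ j : {j : ι // j ≠ i}, (r j + c' j * δ) * w' j ∈ p :=
    p.sum_mem fun j _ => p.mul_mem_right _ (by
      have := hcon j
      simpa [j.2, mul_comm] using this)
  have := p.add_mem (hle h1) h2
  simpa using this

/-- The matrix in `GL_n` obtained from `[[a, p], [r, δ]]` by clearing the last row and column, using
the elementary operations given by `y` and `z`. -/
def clearLast (a : Matrix ι ι R) (p r : ι → R) (δ : R) (y z : ι → R) : Matrix ι ι R :=
  a + vecMulVec p y - vecMulVec (p + (a + vecMulVec p y) *ᵥ z) (r + δ • y)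

/-- Right cosets of the elementary group. -/
def ElemRel (M N : Matrix ι ι R) : Prop := ∃ g ∈ ElemMat ι R, N = M * g

theorem ElemRel.symm {M N : Matrix ι ι R} (h : ElemRel M N) : ElemRel N M := by
  obtain ⟨g, hg, rfl⟩ := h
  obtain ⟨k, hk, h1, h2⟩ := ElemMat.exists_inv hg
  exact ⟨k, hk, by rw [mul_assoc, h1, mul_one]⟩

theorem ElemRel.trans {M N P : Matrix ι ι R} (h : ElemRel M N) (h' : ElemRel N P) :
    ElemRel M P := by
  obtain ⟨g, hg, rfl⟩ := h
  obtain ⟨k, hk, rfl⟩ := h'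
  exact ⟨g * k, mul_mem hg hk, by rw [mul_assoc]⟩

theorem ElemRel.of_mul {M N g : Matrix ι ι R} (hg : g ∈ ElemMat ι R)
    (h : ElemRel (M * g) (N * g)) : ElemRel M N :=
  (ElemRel.trans ⟨g, hg, rfl⟩ h).trans (ElemRel.symm ⟨g, hg, rfl⟩)

theorem ElemRel.mem_iff {M N : Matrix ι ι R} (h : ElemRel M N) :
    M ∈ ElemMat ι R ↔ N ∈ ElemMat ι R := by
  obtain ⟨g, hg, rfl⟩ := h
  exact (ElemMat.mul_mem_cancel_right hg).symm

variable {a : Matrix ι ι R} {p r : ι → R} {δ : R} {y z : ι → R}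

theorem clearLast_add_right (hι : 3 ≤ Fintype.card ι) (hr : Unimod (r + δ • y))
    (hz : δ + (r + δ • y) ⬝ᵥ z = 1) {z' : ι → R} (hz' : δ + (r + δ • y) ⬝ᵥ z' = 1) :
    ElemRel (clearLast a p r δ y z) (clearLast a p r δ y z') := by
  have h0 : (r + δ • y) ⬝ᵥ (z - z') = 0 := by
    rw [dotProduct_sub, eq_sub_of_add_eq' hz, eq_sub_of_add_eq' hz', sub_self]
  refine ⟨1 + vecMulVec (z - z') (r + δ • y), ?_, ?_⟩
  · have := ElemMat.transpose_mem (ElemMat.vecMulVec_of_unimod hι _ (z - z') hr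
      (by rw [dotProduct_comm]; exact h0))
    simpa [transpose_add, transpose_vecMulVec] using this
  · unfold clearLast
    rw [mul_add, mul_one, sub_mul, vecMulVec_mul_vecMulVec, h0, mul_vecMulVec, mulVec_sub]
    simp only [add_vecMulVec, sub_vecMulVec, zero_smul, vecMulVec_zero]
    abel

theorem clearLast_add_left (hz : δ + (r + δ • y) ⬝ᵥ z = 1) {w : ι → R}
    (hw : ∀ i, z i = 0 ∨ w i = 0) :
    ElemRel (clearLast a p r δ y z) (clearLast a p r δ (y + w) z) := by
  have h0 : w ⬝ᵥ z = 0 := Finset.sum_eq_zero fun i _ => by rcases hw i with h | h <;> simp [h]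
  refine ⟨1 + vecMulVec (-z) w, ElemMat.vecMulVec_disjoint _ _ fun i => by
    rcases hw i with h | h <;> simp [h], ?_⟩
  unfold clearLast
  have h1 : (r + δ • y) ⬝ᵥ z = 1 - δ := eq_sub_of_add_eq' hz
  set b := a + vecMulVec p y
  set ρ := r + δ • y
  have e1 : a + vecMulVec p (y + w) = b + vecMulVec p w := by rw [vecMulVec_add, ← add_assoc]
  have e2 : r + δ • (y + w) = ρ + δ • w := by rw [smul_add, ← add_assoc]
  rw [e1, e2, add_mulVec, vecMulVec_mulVec, h0, mul_add, mul_one, sub_mul, mul_vecMulVec,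
    vecMulVec_mul_vecMulVec, dotProduct_neg, h1]
  ext i j
  simp [vecMulVec_apply, mulVec_neg]
  ring

theorem clearLast_mul {g h : Matrix ι ι R} (hg : g * h = 1) :
    clearLast (a * g) p (r ᵥ* g) δ (y ᵥ* g) (h *ᵥ z) = clearLast a p r δ y z * g := by
  unfold clearLast
  have e1 : a * g + vecMulVec p (y ᵥ* g) = (a + vecMulVec p y) * g := by
    rw [add_mul, vecMulVec_mul]
  have e2 : r ᵥ* g + δ • y ᵥ* g = (r + δ • y) ᵥ* g := by
    rw [add_vecMul, smul_vecMul]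
  rw [e1, e2, mulVec_mulVec, mul_assoc, hg, mul_one, sub_mul, vecMulVec_mul]

theorem clearLast_unique_of_span (hι : 3 ≤ Fintype.card ι) (i : ι) (hri : r i = 1)
    (hy : Ideal.span ((r + δ • y) '' {i}ᶜ) = ⊤) (hz : δ + r ⬝ᵥ z = 1) {z' : ι → R}
    (hz' : δ + (r + δ • y) ⬝ᵥ z' = 1) :
    ElemRel (clearLast a p r δ 0 z) (clearLast a p r δ y z') := by
  obtain ⟨x, hx0, hx⟩ : ∃ x : ι → R, x i = 0 ∧ (r + δ • y) ⬝ᵥ x = 1 := by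
    have h1 : (1 : R) ∈ Ideal.span ((r + δ • y) '' {i}ᶜ) := hy ▸ Submodule.mem_top
    refine Submodule.span_induction (p := fun t _ => ∃ x : ι → R, x i = 0 ∧ (r + δ • y) ⬝ᵥ x = t)
      ?_ ?_ ?_ ?_ h1
    · rintro _ ⟨j, hj, rfl⟩
      exact ⟨Pi.single j 1, Pi.single_eq_of_ne (Ne.symm hj) _, by simp⟩
    · exact ⟨0, rfl, by simp⟩
    · rintro _ _ _ _ ⟨x, hx, rfl⟩ ⟨x', hx', rfl⟩
      exact ⟨x + x', by simp [hx, hx'], by rw [dotProduct_add]⟩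
    · rintro t _ _ ⟨x, hx, rfl⟩
      exact ⟨t • x, by simp [hx], by rw [dotProduct_smul]⟩
  set z1 := (1 - δ) • x
  have hz1i : z1 i = 0 := by simp [z1, hx0]
  have hz1 : δ + (r + δ • y) ⬝ᵥ z1 = 1 := by rw [dotProduct_smul, hx]; simp
  set w : ι → R := Pi.single i (-y i)
  have hwz : w ⬝ᵥ z1 = 0 := by simp [w, hz1i]
  have hz1' : δ + (r + δ • (y + w)) ⬝ᵥ z1 = 1 := by
    rw [smul_add, ← add_assoc, add_dotProduct, smul_dotProduct, hwz, smul_zero, add_zero, hz1]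
  have hywi : (y + w) i = 0 := by simp [w]
  have hri' : (r + δ • (y + w)) i = 1 := by
    rw [Pi.add_apply, Pi.smul_apply, hywi, smul_zero, add_zero, hri]
  set z2 : ι → R := Pi.single i (1 - δ)
  have hz2 : δ + (r + δ • (y + w)) ⬝ᵥ z2 = 1 := by
    rw [dotProduct_single, hri']; ring
  have hz2' : δ + (r + δ • (0 : ι → R)) ⬝ᵥ z2 = 1 := by simp [z2, hri]
  have s1 := clearLast_add_right (a := a) (p := p) hι
    ((unimod_iff_span).mpr (top_le_iff.mp (hy ▸ Ideal.span_mono (Set.image_subset_range _ _)))) hz' hz1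
  have s2 := clearLast_add_left (a := a) (p := p) hz1 (w := w) fun j => by
    by_cases hj : j = i
    · left; rw [hj, hz1i]
    · right; exact Pi.single_eq_of_ne hj _
  have s3 := clearLast_add_right (a := a) (p := p) hι
    (unimod_of_apply_eq_one (i := i) (by rw [hri']; exact isUnit_one)) hz1' hz2
  have s4 := clearLast_add_left (a := a) (p := p) hz2 (w := -(y + w)) fun j => by
    by_cases hj : j = i
    · right; rw [hj, Pi.neg_apply, hywi, neg_zero]
    · left; exact Pi.single_eq_of_ne hj _
  rw [add_neg_cancel] at s4
  have s5 := clearLast_add_right (a := a) (p := p) (y := 0) hι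
    (unimod_of_apply_eq_one (i := i) (by simp [hri])) hz2' (by simpa using hz)
  exact ((((s1.trans s2).trans s3).trans s4).trans s5).symm

theorem clearLast_unique_zero (hι : 3 ≤ Fintype.card ι) (h : StableRange R (Fintype.card ι - 1))
    (hr : Unimod r) (hy : Unimod (r + δ • y)) (hz : δ + r ⬝ᵥ z = 1) {z' : ι → R}
    (hz' : δ + (r + δ • y) ⬝ᵥ z' = 1) :
    ElemRel (clearLast a p r δ 0 z) (clearLast a p r δ y z') := by
  obtain ⟨i⟩ : Nonempty ι := Fintype.card_pos_iff.mp (by omega)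
  obtain ⟨g, hg, hrg⟩ := hr.rowEquiv_single h (by omega) i
  obtain ⟨g', hg', hgg', hg'g⟩ := ElemMat.exists_inv hg
  obtain ⟨κ, hκi, hκ⟩ := h.exists_span_compl i (hy.vecMul hgg')
  have hk : 1 + vecMulVec (Pi.single i 1) κ ∈ ElemMat ι R := ElemMat.vecMulVec_disjoint _ _ fun j => by
    by_cases hj : j = i
    · right; rw [hj, hκi]
    · left; exact Pi.single_eq_of_ne hj _
  set k := 1 + vecMulVec (Pi.single i 1) κ with hkdef
  have hvk : ∀ v : ι → R, v ᵥ* k = v + v i • κ := fun v => by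
    rw [hkdef, vecMul_add, vecMul_one, vecMul_vecMulVec]; simp
  obtain ⟨l, hl, h1, h2⟩ := ElemMat.exists_inv (mul_mem hg hk)
  refine ElemRel.of_mul (mul_mem hg hk) ?_
  rw [← clearLast_mul h1, ← clearLast_mul h1, zero_vecMul]
  refine clearLast_unique_of_span hι i ?_ ?_ ?_ ?_
  · rw [← vecMul_vecMul, hrg, hvk]; simp [hκi]
  · rw [← smul_vecMul, ← add_vecMul, ← vecMul_vecMul, hvk]; exact hκ
  · rw [dotProduct_mulVec, vecMul_vecMul, h1, vecMul_one, hz]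
  · rw [← smul_vecMul, ← add_vecMul, dotProduct_mulVec, vecMul_vecMul, h1, vecMul_one, hz']

theorem clearLast_lower (x : ι → R) :
    clearLast (a + vecMulVec p x) p (r + δ • x) δ (y - x) z = clearLast a p r δ y z := by
  have e1 : a + vecMulVec p x + vecMulVec p (y - x) = a + vecMulVec p y := by
    rw [add_assoc, ← vecMulVec_add, add_sub_cancel]
  have e2 : r + δ • x + δ • (y - x) = r + δ • y := by rw [add_assoc, ← smul_add, add_sub_cancel]
  unfold clearLast
  rw [e1, e2]

theorem clearLast_unique (hι : 3 ≤ Fintype.card ι) (h : StableRange R (Fintype.card ι - 1))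
    (hy : Unimod (r + δ • y)) (hz : δ + (r + δ • y) ⬝ᵥ z = 1) {y' z' : ι → R}
    (hy' : Unimod (r + δ • y')) (hz' : δ + (r + δ • y') ⬝ᵥ z' = 1) :
    ElemRel (clearLast a p r δ y z) (clearLast a p r δ y' z') := by
  rw [← clearLast_lower y, ← clearLast_lower (y := y') y, sub_self]
  have e : r + δ • y + δ • (y' - y) = r + δ • y' := by rw [add_assoc, ← smul_add, add_sub_cancel]
  exact clearLast_unique_zero hι h hy (by rwa [e]) hz (by rwa [e])

theorem clearLast_upper {i : ι} (t : R) (hyi : y i = 0) :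
    clearLast a (p + a *ᵥ Pi.single i t) r (δ + r ⬝ᵥ Pi.single i t) y
      (z - Pi.single i t - Pi.single i (t * (y ⬝ᵥ z))) =
    clearLast a p r δ y z * (1 + vecMulVec (Pi.single i t) y) := by
  set e : ι → R := Pi.single i t
  have h0 : y ⬝ᵥ e = 0 := by simp [e, hyi]
  have hse : Pi.single i (t * (y ⬝ᵥ z)) = (y ⬝ᵥ z) • e := by
    rw [← Pi.single_smul, smul_eq_mul, mul_comm]
  have hb : a + vecMulVec (p + a *ᵥ e) y = (a + vecMulVec p y) * (1 + vecMulVec e y) := by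
    rw [mul_add, mul_one, add_mul, vecMulVec_mul_vecMulVec, h0, add_vecMulVec, mul_vecMulVec]
    simp [add_assoc]
  have hr : r + (δ + r ⬝ᵥ e) • y = (r + δ • y) ᵥ* (1 + vecMulVec e y) := by
    rw [vecMul_add, vecMul_one, vecMul_vecMulVec, add_dotProduct, smul_dotProduct, h0, add_smul]
    simp [add_assoc]
  have hz : (1 + vecMulVec e y) *ᵥ (z - e - (y ⬝ᵥ z) • e) = z - e := by
    rw [add_mulVec, one_mulVec, vecMulVec_mulVec, dotProduct_sub, dotProduct_sub, dotProduct_smul, h0]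
    ext j
    simp
  have hp : p + a *ᵥ e + ((a + vecMulVec p y) * (1 + vecMulVec e y)) *ᵥ (z - e - (y ⬝ᵥ z) • e) =
      p + (a + vecMulVec p y) *ᵥ z := by
    rw [← mulVec_mulVec, hz, mulVec_sub, add_mulVec _ _ e, vecMulVec_mulVec, h0]
    ext j
    simp
  unfold clearLast
  rw [hb, hse, hp, hr, sub_mul, vecMulVec_mul]

/-- Some admissible choice clears the last row and column of `[[a, p], [r, δ]]` to an elementary
matrix. -/
def ClearsElem (a : Matrix ι ι R) (p r : ι → R) (δ : R) : Prop :=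
  ∃ y z : ι → R, Unimod (r + δ • y) ∧ δ + (r + δ • y) ⬝ᵥ z = 1 ∧
    clearLast a p r δ y z ∈ ElemMat ι R

theorem ClearsElem.congr {a' : Matrix ι ι R} {p' r' : ι → R} {δ' : R} (h : ClearsElem a' p' r' δ')
    (ha : a = a') (hp : p = p') (hr : r = r') (hδ : δ = δ') : ClearsElem a p r δ := by
  subst ha hp hr hδ; exact h

theorem ClearsElem.mul (h : ClearsElem a p r δ) {g : Matrix ι ι R} (hg : g ∈ ElemMat ι R) :
    ClearsElem (a * g) p (r ᵥ* g) δ := by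
  obtain ⟨y, z, h1, h2, h3⟩ := h
  obtain ⟨k, hk, hgk, hkg⟩ := ElemMat.exists_inv hg
  refine ⟨y ᵥ* g, k *ᵥ z, ?_, ?_, ?_⟩
  · rw [← smul_vecMul, ← add_vecMul]; exact h1.vecMul hgk
  · rw [← smul_vecMul, ← add_vecMul, dotProduct_mulVec, vecMul_vecMul, hgk, vecMul_one, h2]
  · rw [clearLast_mul hgk]; exact mul_mem h3 hg

theorem ClearsElem.lower (h : ClearsElem a p r δ) (x : ι → R) :
    ClearsElem (a + vecMulVec p x) p (r + δ • x) δ := by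
  obtain ⟨y, z, h1, h2, h3⟩ := h
  have e : r + δ • x + δ • (y - x) = r + δ • y := by rw [add_assoc, ← smul_add, add_sub_cancel]
  exact ⟨y - x, z, by rwa [e], by rwa [e], by rwa [clearLast_lower]⟩

theorem ClearsElem.upper (hι : 3 ≤ Fintype.card ι) (h : StableRange R (Fintype.card ι - 1))
    (H : ClearsElem a p r δ) (i : ι) (t : R) :
    ClearsElem a (p + a *ᵥ Pi.single i t) r (δ + r ⬝ᵥ Pi.single i t) := by
  obtain ⟨y₀, z₀, h1, h2, h3⟩ := H
  obtain ⟨y, hyi, hy⟩ := h.exists_add_smul i (r := r) (δ := δ) (by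
    rw [Ideal.eq_top_iff_one, ← h2]
    refine Ideal.add_mem _ (Ideal.mem_sup_right (Ideal.mem_span_singleton_self _))
      (Ideal.sum_mem _ fun j _ => Ideal.mul_mem_right _ _ (Ideal.add_mem _
        (Ideal.mem_sup_left (Ideal.subset_span ⟨j, rfl⟩))
        (Ideal.mul_mem_right _ _ (Ideal.mem_sup_right (Ideal.mem_span_singleton_self _))))))
  obtain ⟨x, hx⟩ := hy
  have hz : δ + (r + δ • y) ⬝ᵥ ((1 - δ) • x) = 1 := by rw [dotProduct_smul, hx]; simp
  have h4 := (clearLast_unique hι h (a := a) (p := p) h1 h2 ⟨x, hx⟩ hz).mem_iff.mp h3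
  set z := (1 - δ) • x
  have hg : 1 + vecMulVec (Pi.single i t) y ∈ ElemMat ι R := ElemMat.vecMulVec_disjoint _ _ fun j => by
    by_cases hj : j = i
    · right; rw [hj, hyi]
    · left; exact Pi.single_eq_of_ne hj _
  have hr : r + (δ + r ⬝ᵥ Pi.single i t) • y = r + δ • y + ((r + δ • y) ⬝ᵥ Pi.single i t) • y := by
    rw [add_dotProduct, smul_dotProduct, dotProduct_single y, hyi, add_smul]
    simp [add_assoc]
  refine ⟨y, z - Pi.single i t - Pi.single i (t * (y ⬝ᵥ z)), ?_, ?_, ?_⟩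
  · rw [hr]
    exact Unimod.of_rowEquiv ⟨x, hx⟩ (RowEquiv.one_add_vecMulVec hg _)
  · rw [hr, ← hz]
    simp only [dotProduct_sub, add_dotProduct, smul_dotProduct, dotProduct_single, hyi, Pi.add_apply,
      Pi.smul_apply, smul_eq_mul]
    ring
  · rw [clearLast_upper t hyi]
    exact mul_mem h4 hg

theorem vecMul_transvection (r : ι → R) (i j : ι) (c : R) :
    r ᵥ* transvection i j c = r + r i • Pi.single j c := by
  rw [transvection, vecMul_add, vecMul_one]
  congr 1
  ext l
  by_cases hl : l = j
  · subst hl; simp [vecMul, dotProduct, single_apply]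
  · simp [vecMul, dotProduct, hl, Ne.symm hl]

theorem clearsElem_of_mem (hι : 3 ≤ Fintype.card ι) (h : StableRange R (Fintype.card ι - 1))
    {X : Matrix (ι ⊕ Unit) (ι ⊕ Unit) R} (hX : X ∈ ElemMat (ι ⊕ Unit) R) :
    ClearsElem X.toBlocks₁₁ (fun i => X (.inl i) (.inr ()))
      (fun i => X (.inr ()) (.inl i)) (X (.inr ()) (.inr ())) := by
  induction hX using Submonoid.closure_induction_right with
  | one =>
    obtain ⟨i⟩ : Nonempty ι := Fintype.card_pos_iff.mp (by omega)
    refine ⟨Pi.single i 1, 0, unimod_of_apply_eq_one (i := i) (by simp), by simp, ?_⟩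
    convert one_mem (ElemMat ι R) using 1
    ext i j
    simp only [clearLast, Matrix.add_apply, Matrix.sub_apply, vecMulVec_apply, mulVec_zero]
    simp [one_apply, toBlocks₁₁]
  | mul_right X hX g hg ih =>
    obtain ⟨i, j, hij, c, rfl⟩ := hg
    rcases i with i | ⟨⟨⟩⟩ <;> rcases j with j | ⟨⟨⟩⟩
    · have hij' : i ≠ j := fun h => hij (by rw [h])
      refine (ih.mul (ElemMat.transvection_mem hij' c)).congr ?_ ?_ ?_ ?_
      · ext k l
        simp only [toBlocks₁₁, of_apply]
        by_cases hl : l = j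
        · subst hl; rw [mul_transvection_apply_same, mul_transvection_apply_same]; rfl
        · rw [mul_transvection_apply_of_ne _ _ _ _ hl,
            mul_transvection_apply_of_ne _ _ _ _ (by simpa using hl)]
          rfl
      · ext k
        rw [mul_transvection_apply_of_ne _ _ _ _ (by simp)]
      · ext l
        rw [vecMul_transvection]
        by_cases hl : l = j
        · subst hl; rw [mul_transvection_apply_same]; simp [mul_comm]
        · rw [mul_transvection_apply_of_ne _ _ _ _ (by simpa using hl)]; simp [hl]
      · rw [mul_transvection_apply_of_ne _ _ _ _ (by simp)]
    · refine (ih.upper hι h i c).congr ?_ ?_ ?_ ?_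
      · ext k l
        simp only [toBlocks₁₁, of_apply]
        rw [mul_transvection_apply_of_ne _ _ _ _ (by simp)]
      · ext k
        rw [mul_transvection_apply_same]
        simp [toBlocks₁₁]
      · ext l
        rw [mul_transvection_apply_of_ne _ _ _ _ (by simp)]
      · rw [mul_transvection_apply_same]
        simp [mul_comm]
    · refine (ih.lower (Pi.single j c)).congr ?_ ?_ ?_ ?_
      · ext k l
        simp only [toBlocks₁₁, of_apply, Matrix.add_apply, vecMulVec_apply]
        by_cases hl : l = j
        · subst hl; rw [mul_transvection_apply_same]; simp [mul_comm]
        · rw [mul_transvection_apply_of_ne _ _ _ _ (by simpa using hl)]; simp [hl]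
      · ext k
        rw [mul_transvection_apply_of_ne _ _ _ _ (by simp)]
      · ext l
        by_cases hl : l = j
        · subst hl; rw [mul_transvection_apply_same]; simp [mul_comm]
        · rw [mul_transvection_apply_of_ne _ _ _ _ (by simpa using hl)]; simp [hl]
      · rw [mul_transvection_apply_of_ne _ _ _ _ (by simp)]
    · exact absurd rfl hij

/-- Injective stability for `K₁`. -/
theorem ElemMat.of_fromBlocks_one (hι : 3 ≤ Fintype.card ι) (h : StableRange R (Fintype.card ι - 1))
    {α : Matrix ι ι R} (hα : fromBlocks α 0 0 (1 : Matrix Unit Unit R) ∈ ElemMat (ι ⊕ Unit) R) :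
    α ∈ ElemMat ι R := by
  obtain ⟨y, z, h1, h2, h3⟩ := clearsElem_of_mem hι h hα
  simp only [fromBlocks_apply₁₂, fromBlocks_apply₂₁, fromBlocks_apply₂₂,
    Matrix.zero_apply, one_apply_eq] at h1 h2 h3
  obtain ⟨i⟩ : Nonempty ι := Fintype.card_pos_iff.mp (by omega)
  have h4 := (clearLast_unique hι h h1 h2 (y' := Pi.single i 1) (z' := 0)
    (unimod_of_apply_eq_one (i := i) (by simp)) (by simp)).mem_iff.mp h3
  convert h4 using 1
  ext k l
  simp only [clearLast, Matrix.add_apply, Matrix.sub_apply, vecMulVec_apply, mulVec_zero]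
  simp [toBlocks₁₁]

theorem ElemMat.of_fromBlocks_one_fin (hι : 3 ≤ Fintype.card ι)
    (h : StableRange R (Fintype.card ι - 1)) (m : ℕ) {α : Matrix ι ι R}
    (hα : fromBlocks α 0 0 (1 : Matrix (Fin m) (Fin m) R) ∈ ElemMat (ι ⊕ Fin m) R) :
    α ∈ ElemMat ι R := by
  induction m with
  | zero =>
    rw [← submatrix_mem_iff (Equiv.sumEmpty ι (Fin 0))]
    convert hα using 1
    ext (i | i) (j | j)
    · rfl
    · exact j.elim0
    · exact i.elim0
    · exact i.elim0
  | succ m ih =>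
    refine ih (ElemMat.of_fromBlocks_one (by simp; omega) (h.mono (by simp; omega)) ?_)
    let e : (ι ⊕ Fin m) ⊕ Unit ≃ ι ⊕ Fin (m + 1) :=
      (Equiv.sumAssoc _ _ _).trans (Equiv.sumCongr (Equiv.refl _)
        ((Equiv.sumCongr (Equiv.refl _) finOneEquiv.symm).trans finSumFinEquiv))
    convert submatrix_mem e hα using 1
    ext ((i | i) | i) ((j | j) | j) <;> simp [e, one_apply, Fin.ext_iff] <;> intro h <;> omega

end Injective

section Skew
variable {R : Type*} [CommRing R] {ι : Type} [Fintype ι] [DecidableEq ι]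

theorem eq_zero_of_eq_neg (h2 : IsUnit (2 : R)) {x : R} (h : x = -x) : x = 0 :=
  h2.mul_left_cancel (by linear_combination h)

theorem eq_fromBlocks_of_skew (h2 : IsUnit (2 : R)) {φ : Matrix (Unit ⊕ ι) (Unit ⊕ ι) R}
    (hφ : φᵀ = -φ) : ∃ (f : Matrix Unit ι R) (Φ : Matrix ι ι R), Φᵀ = -Φ ∧
      φ = fromBlocks 0 f (-fᵀ) Φ := by
  have h : ∀ i j, φ i j = - φ j i := fun i j => congrFun₂ hφ j i
  refine ⟨φ.toBlocks₁₂, φ.toBlocks₂₂, ?_, ?_⟩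
  · ext i j; exact h _ _
  · ext (i | i) (j | j)
    · exact eq_zero_of_eq_neg h2 (h _ _)
    · rfl
    · exact h _ _
    · rfl

theorem ElemMat.one_add_mul_mem (hι : 3 ≤ Fintype.card ι) (p : Matrix ι Unit R)
    (f : Matrix Unit ι R) (hp : ∃ q : Matrix Unit ι R, q * p = 1) (hfp : f * p = 0) :
    1 + p * f ∈ ElemMat ι R := by
  have e : p * f = vecMulVec (fun i => p i ()) (f ()) := by
    ext i j; simp [mul_apply, vecMulVec_apply]
  rw [e]
  obtain ⟨q, hq⟩ := hp
  refine ElemMat.vecMulVec_of_unimod hι _ _ ⟨q (), ?_⟩ ?_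
  · rw [dotProduct_comm]; simpa [mul_apply, dotProduct] using congrFun₂ hq () ()
  · simpa [mul_apply, dotProduct] using congrFun₂ hfp () ()

theorem ElemMat.one_add_mul_mem' (hι : 3 ≤ Fintype.card ι) (p : Matrix ι Unit R)
    (f : Matrix Unit ι R) (hf : ∃ q : Matrix ι Unit R, f * q = 1) (hfp : f * p = 0) :
    1 + p * f ∈ ElemMat ι R := by
  obtain ⟨q, hq⟩ := hf
  have := ElemMat.transpose_mem (ElemMat.one_add_mul_mem hι fᵀ pᵀ
    ⟨qᵀ, by rw [← transpose_mul, hq, transpose_one]⟩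
    (by rw [← transpose_mul, hfp, transpose_zero]))
  simpa using this

theorem transvection_inl_inr (j : ι) (c : R) : transvection (Sum.inl () : Unit ⊕ ι) (Sum.inr j) c =
    fromBlocks 1 (Matrix.single () j c) 0 1 := by
  ext (i | i) (k | k) <;> simp [transvection, single_apply, one_apply]

theorem transvection_inr_inl (j : ι) (c : R) : transvection (Sum.inr j : Unit ⊕ ι) (Sum.inl ()) c =
    fromBlocks 1 0 (Matrix.single j () c) 1 := by
  ext (i | i) (k | k) <;> simp [transvection, single_apply, one_apply]

theorem transvection_inr_inr (i j : ι) (c : R) : transvection (Sum.inr i : Unit ⊕ ι) (Sum.inr j) c =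
    fromBlocks 1 0 0 (transvection i j c) := by
  ext (i | i) (k | k) <;> simp [transvection, single_apply, one_apply]

theorem skew_congr {κ : Type*} {φ : Matrix ι ι R} (hφ : φᵀ = -φ) (g : Matrix ι κ R) :
    (gᵀ * φ * g)ᵀ = -(gᵀ * φ * g) := by
  simp [transpose_mul, hφ, Matrix.mul_assoc]

theorem congr_one_fromBlocks (f : Matrix Unit ι R) (Φ g : Matrix ι ι R) :
    (fromBlocks (1 : Matrix Unit Unit R) 0 0 g)ᵀ * fromBlocks 0 f (-fᵀ) Φ * fromBlocks 1 0 0 g =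
      fromBlocks 0 (f * g) (-(gᵀ * fᵀ)) (gᵀ * Φ * g) := by
  simp [fromBlocks_transpose, fromBlocks_multiply]

/-- The congruence class of a skew form under `E(Unit ⊕ ι)` is its class under `E(ι)`. -/
theorem exists_congr_one_fromBlocks (h2 : IsUnit (2 : R)) (hι : 3 ≤ Fintype.card ι)
    {ε : Matrix (Unit ⊕ ι) (Unit ⊕ ι) R} (hε : ε ∈ ElemMat (Unit ⊕ ι) R) :
    ∀ φ : Matrix (Unit ⊕ ι) (Unit ⊕ ι) R, φᵀ = -φ → IsUnit φ →
      ∃ g ∈ ElemMat ι R, εᵀ * φ * ε =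
        (fromBlocks (1 : Matrix Unit Unit R) 0 0 g)ᵀ * φ * fromBlocks 1 0 0 g := by
  induction hε using Submonoid.closure_induction with
  | one => exact fun φ _ _ => ⟨1, one_mem _, by rw [fromBlocks_one]⟩
  | mul x y hx hy ihx ihy =>
    intro φ h1 hu
    obtain ⟨g, hg, e⟩ := ihx φ h1 hu
    have hx' : IsUnit x := by
      rw [isUnit_iff_isUnit_det, ElemMat.det_eq_one hx]; exact isUnit_one
    obtain ⟨g', hg', e'⟩ := ihy (xᵀ * φ * x) (skew_congr h1 x)
      (((isUnit_transpose x).mpr hx').mul hu |>.mul hx')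
    refine ⟨g * g', mul_mem hg hg', ?_⟩
    have : fromBlocks (1 : Matrix Unit Unit R) 0 0 (g * g') =
        fromBlocks 1 0 0 g * fromBlocks 1 0 0 g' := by simp [fromBlocks_multiply]
    rw [this, transpose_mul, transpose_mul]
    calc yᵀ * xᵀ * φ * (x * y) = yᵀ * (xᵀ * φ * x) * y := by simp only [Matrix.mul_assoc]
      _ = _ := by rw [e', e]; simp only [Matrix.mul_assoc]
  | mem ε hε =>
    intro φ h1 hu
    obtain ⟨i, j, hij, c, rfl⟩ := hε
    obtain ⟨ψ, hψ⟩ := hu.exists_right_inv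
    obtain ⟨f, Φ, hΦ, rfl⟩ := eq_fromBlocks_of_skew h2 h1
    rw [← fromBlocks_toBlocks ψ, ← fromBlocks_one, fromBlocks_multiply, fromBlocks_inj] at hψ
    obtain ⟨e1, e2, e3, e4⟩ := hψ
    simp only [Matrix.zero_mul, zero_add, Matrix.neg_mul] at e1 e2 e3 e4
    generalize ψ.toBlocks₁₁ = a at *
    generalize ψ.toBlocks₁₂ = q at *
    generalize ψ.toBlocks₂₁ = p at *
    generalize ψ.toBlocks₂₂ = Ψ at *
    rcases i with i | i <;> rcases j with j | j
    · exact absurd rfl hij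
    · rw [transvection_inl_inr]
      generalize Matrix.single () j c = x
      set v := Ψ * xᵀ
      have hfv : f * v = 0 := by rw [← Matrix.mul_assoc, e2, Matrix.zero_mul]
      refine ⟨1 + v * f, ElemMat.one_add_mul_mem' hι _ _ ⟨p, e1⟩ hfv, ?_⟩
      have hv : Φ * v = xᵀ + fᵀ * (q * xᵀ) := by
        have := congrArg (· * xᵀ) e4
        simp only [Matrix.add_mul, Matrix.neg_mul, Matrix.one_mul, Matrix.mul_assoc] at this
        rwa [neg_add_eq_sub, sub_eq_iff_eq_add] at this
      have hv' : vᵀ * Φ = -x - (x * qᵀ) * f := by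
        have := congrArg transpose hv
        simp only [transpose_mul, transpose_add, transpose_transpose, hΦ] at this
        rw [Matrix.mul_neg, neg_eq_iff_eq_neg] at this
        rw [this]; abel
      have hs : q * xᵀ = x * qᵀ := by
        ext ⟨⟩ ⟨⟩; simp [mul_apply, mul_comm]
      have hvv : vᵀ * Φ * v = 0 := by
        ext ⟨⟩ ⟨⟩
        exact eq_zero_of_eq_neg h2 (congrFun₂ (skew_congr hΦ v) () ())
      have hfvf : f * (v * f) = 0 := by rw [← Matrix.mul_assoc, hfv, Matrix.zero_mul]
      have hvf : vᵀ * fᵀ = 0 := by rw [← transpose_mul, hfv, transpose_zero]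
      rw [congr_one_fromBlocks, fromBlocks_transpose]
      have e5 : (1 + v * f)ᵀ * Φ * (1 + v * f) = Φ + fᵀ * (vᵀ * Φ) + Φ * v * f
          + fᵀ * (vᵀ * Φ * v) * f := by
        rw [transpose_add, transpose_mul, transpose_one]
        simp only [Matrix.add_mul, Matrix.mul_add, Matrix.one_mul, Matrix.mul_one,
          Matrix.mul_assoc, add_assoc]
      rw [e5, hvv, hv', hv, hs, Matrix.mul_add, hfvf, transpose_add, transpose_mul, Matrix.add_mul,
        Matrix.mul_assoc fᵀ, hvf]
      simp only [fromBlocks_multiply, transpose_one, transpose_zero,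
        Matrix.one_mul, Matrix.mul_one, Matrix.zero_mul,
        Matrix.mul_zero, add_zero, zero_add, Matrix.add_mul, Matrix.mul_neg,
        Matrix.neg_mul, Matrix.mul_assoc, Matrix.mul_sub, neg_zero]
      congr 1
      abel
    · rw [transvection_inr_inl]
      generalize Matrix.single i () c = y
      have hp : Φ * p = fᵀ * a := by rw [neg_add_eq_sub, sub_eq_zero] at e3; exact e3
      have ha : a = 0 := by
        have h1 : pᵀ * Φ * p = a := by
          rw [Matrix.mul_assoc, hp, ← Matrix.mul_assoc, ← transpose_mul, e1, transpose_one,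
            Matrix.one_mul]
        ext ⟨⟩ ⟨⟩
        rw [← h1]
        exact eq_zero_of_eq_neg h2 (congrFun₂ (skew_congr hΦ p) () ())
      rw [ha, Matrix.mul_zero] at hp
      have hp' : pᵀ * Φ = 0 := by
        have := congrArg transpose hp
        rwa [transpose_mul, hΦ, Matrix.mul_neg, transpose_zero, neg_eq_zero] at this
      refine ⟨1 + p * (yᵀ * Φ), ElemMat.one_add_mul_mem hι _ _ ⟨f, e1⟩
        (by rw [Matrix.mul_assoc, hp, Matrix.mul_zero]), ?_⟩
      have e5 : Φ * (1 + p * (yᵀ * Φ)) = Φ := by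
        rw [Matrix.mul_add, Matrix.mul_one, ← Matrix.mul_assoc, hp, Matrix.zero_mul, add_zero]
      have e6 : (1 + p * (yᵀ * Φ))ᵀ * Φ = Φ := by
        have := congrArg transpose e5
        rw [transpose_mul, hΦ, Matrix.mul_neg] at this
        exact neg_injective this
      have e7 : f * (1 + p * (yᵀ * Φ)) = f + yᵀ * Φ := by
        rw [Matrix.mul_add, Matrix.mul_one, ← Matrix.mul_assoc, e1, Matrix.one_mul]
      have e8 : (1 + p * (yᵀ * Φ))ᵀ * fᵀ = fᵀ - Φ * y := by
        rw [← transpose_mul, e7, transpose_add, transpose_mul, transpose_transpose, hΦ,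
          Matrix.neg_mul, sub_eq_add_neg]
      rw [congr_one_fromBlocks, e6, e5, e7, e8, fromBlocks_transpose]
      have h1 : yᵀ * Φ * y = 0 := by
        ext ⟨⟩ ⟨⟩
        exact eq_zero_of_eq_neg h2 (congrFun₂ (skew_congr hΦ y) () ())
      have h3 : yᵀ * fᵀ = f * y := by
        ext ⟨⟩ ⟨⟩; simp [mul_apply, mul_comm]
      simp only [fromBlocks_multiply, transpose_one, transpose_zero,
        Matrix.one_mul, Matrix.mul_one, Matrix.zero_mul,
        Matrix.mul_zero, add_zero, zero_add, Matrix.add_mul, Matrix.mul_neg,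
        h1, h3, neg_add_cancel, neg_sub]
      congr 1
      abel
    · rw [transvection_inr_inr]
      exact ⟨_, ElemMat.transvection_mem (fun h => hij (by rw [h])) c, rfl⟩

/-- The orthogonal sum of a form and a hyperbolic plane, whose basis comes first and last. -/
def hyp (φ : Matrix ι ι R) : Matrix (Unit ⊕ (ι ⊕ Unit)) (Unit ⊕ (ι ⊕ Unit)) R :=
  fromBlocks 0 (fromCols 0 1) (-(fromCols 0 1)ᵀ) (fromBlocks φ 0 0 0)

theorem hyp_skew {φ : Matrix ι ι R} (hφ : φᵀ = -φ) : (hyp φ)ᵀ = -hyp φ := by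
  simp [hyp, fromBlocks_transpose, fromBlocks_neg, hφ]

theorem hyp_isUnit {φ : Matrix ι ι R} (hφ : IsUnit φ) : IsUnit (hyp φ) := by
  obtain ⟨ψ, hψ⟩ := hφ.exists_right_inv
  refine IsUnit.of_mul_eq_one (fromBlocks 0 (-fromCols 0 1) (fromCols 0 1)ᵀ (fromBlocks ψ 0 0 0)) ?_
  rw [hyp, fromBlocks_multiply]
  ext (i | i | i) (j | j | j) <;>
    simp [mul_apply, Fintype.sum_sum_type, one_apply]
  rw [← mul_apply, hψ, one_apply]

theorem exists_congr_of_hyp (h2 : IsUnit (2 : R)) (hι : 3 ≤ Fintype.card ι)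
    (h : StableRange R (Fintype.card ι - 1)) {φ φ' : Matrix ι ι R} (hφ : φᵀ = -φ) (hu : IsUnit φ)
    {ε : Matrix (Unit ⊕ (ι ⊕ Unit)) (Unit ⊕ (ι ⊕ Unit)) R} (hε : ε ∈ ElemMat _ R)
    (he : hyp φ' = εᵀ * hyp φ * ε) : ∃ g ∈ ElemMat ι R, φ' = gᵀ * φ * g := by
  obtain ⟨g, hg, e⟩ := exists_congr_one_fromBlocks h2 (by simp; omega) hε _ (hyp_skew hφ)
    (hyp_isUnit hu)
  rw [← he, hyp, hyp, congr_one_fromBlocks, fromBlocks_inj] at e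
  obtain ⟨-, e1, -, e2⟩ := e
  rw [← fromBlocks_toBlocks g] at e1 e2 hg
  generalize g.toBlocks₁₁ = a at *
  generalize g.toBlocks₁₂ = b at *
  generalize g.toBlocks₂₁ = c at *
  generalize g.toBlocks₂₂ = d at *
  rw [fromCols_mul_fromBlocks] at e1
  simp only [Matrix.zero_mul, Matrix.one_mul, zero_add] at e1
  obtain ⟨rfl, rfl⟩ := fromCols_inj e1
  simp only [fromBlocks_transpose, fromBlocks_multiply, fromBlocks_inj, Matrix.mul_zero,
    Matrix.zero_mul, add_zero] at e2
  refine ⟨a, ElemMat.of_fromBlocks_one hι h ?_, e2.1⟩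
  have := mul_mem (ElemMat.upper_mem (-b)) hg
  simpa [fromBlocks_multiply] using this

theorem exists_congr_eq_hyp (h2 : IsUnit (2 : R)) (h : StableRange R (Fintype.card ι))
    {ψ : Matrix (Unit ⊕ (ι ⊕ Unit)) (Unit ⊕ (ι ⊕ Unit)) R} (hψ : ψᵀ = -ψ) (hu : IsUnit ψ) :
    ∃ ε ∈ ElemMat (Unit ⊕ (ι ⊕ Unit)) R, ∃ φ : Matrix ι ι R, φᵀ = -φ ∧ εᵀ * ψ * ε = hyp φ := by
  obtain ⟨f, Φ, hΦ, rfl⟩ := eq_fromBlocks_of_skew h2 hψ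
  obtain ⟨χ, hχ⟩ := hu.exists_right_inv
  rw [← fromBlocks_toBlocks χ, ← fromBlocks_one, fromBlocks_multiply, fromBlocks_inj] at hχ
  have hf : Unimod (f ()) := ⟨fun i => χ.toBlocks₂₁ i (), by
    simpa [mul_apply, dotProduct] using congrFun₂ hχ.1 () ()⟩
  obtain ⟨g, hg, e⟩ := hf.rowEquiv_single h (by simp) (Sum.inr ())
  have hfg : f * g = fromCols 0 1 := by
    ext ⟨⟩ j
    have := congrFun e j
    rcases j with j | j <;> simpa [vecMul, dotProduct, mul_apply] using this
  have hfg' : gᵀ * fᵀ = (fromCols 0 1)ᵀ := by rw [← hfg, transpose_mul]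
  have hs := skew_congr hΦ g
  generalize e1 : gᵀ * Φ * g = Φ' at hs
  rw [← fromBlocks_toBlocks Φ', fromBlocks_transpose, fromBlocks_neg, fromBlocks_inj] at hs
  obtain ⟨s1, s2, s3, s4⟩ := hs
  have s5 : Φ'.toBlocks₂₂ = 0 := by
    ext ⟨⟩ ⟨⟩; exact eq_zero_of_eq_neg h2 (congrFun₂ s4 () ())
  have s6 : Φ'.toBlocks₂₁ = -Φ'.toBlocks₁₂ᵀ := by rw [s3, neg_neg]
  refine ⟨fromBlocks 1 0 0 g * fromBlocks 1 (fromCols (-Φ'.toBlocks₁₂ᵀ) 0) 0 1,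
    mul_mem (ElemMat.one_fromBlocks_mem hg) (ElemMat.upper_mem _), Φ'.toBlocks₁₁, s1, ?_⟩
  rw [transpose_mul]
  have e2 := congr_one_fromBlocks f Φ g
  rw [hfg, hfg', e1, ← fromBlocks_toBlocks Φ', s5, s6] at e2
  rw [Matrix.mul_assoc, Matrix.mul_assoc, ← Matrix.mul_assoc (fromBlocks 0 f _ _),
    ← Matrix.mul_assoc (fromBlocks 1 0 0 g)ᵀ, ← Matrix.mul_assoc (fromBlocks 1 0 0 g)ᵀ, e2, hyp,
    fromBlocks_transpose, fromBlocks_multiply, fromBlocks_multiply]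
  generalize Φ'.toBlocks₁₂ = y
  ext (i | i | i) (j | j | j) <;> simp [mul_apply, one_apply]

end Skew

section HypSum
variable {R : Type*} [CommRing R] {ι κ : Type} [Fintype ι] [DecidableEq ι] [Fintype κ]
  [DecidableEq κ]

/-- The orthogonal sum of a form and a hyperbolic space. -/
def hypSum (φ : Matrix ι ι R) (κ : Type) [DecidableEq κ] :
    Matrix (ι ⊕ (κ ⊕ κ)) (ι ⊕ (κ ⊕ κ)) R :=
  fromBlocks φ 0 0 (fromBlocks 0 1 (-1) 0)

/-- `φ` and `ψ` are congruent by an elementary matrix. -/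
def ElemCongr (φ ψ : Matrix ι ι R) : Prop := ∃ g ∈ ElemMat ι R, ψ = gᵀ * φ * g

theorem ElemCongr.refl (φ : Matrix ι ι R) : ElemCongr φ φ := ⟨1, one_mem _, by simp⟩

theorem ElemCongr.trans {φ ψ χ : Matrix ι ι R} (h : ElemCongr φ ψ) (h' : ElemCongr ψ χ) :
    ElemCongr φ χ := by
  obtain ⟨g, hg, rfl⟩ := h
  obtain ⟨g', hg', rfl⟩ := h'
  exact ⟨g * g', mul_mem hg hg', by simp only [transpose_mul, Matrix.mul_assoc]⟩

theorem ElemCongr.submatrix {φ ψ : Matrix ι ι R} (h : ElemCongr φ ψ) (e : κ ≃ ι) :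
    ElemCongr (φ.submatrix e e) (ψ.submatrix e e) := by
  obtain ⟨g, hg, rfl⟩ := h
  refine ⟨_, ElemMat.submatrix_mem e hg, ?_⟩
  rw [transpose_submatrix, submatrix_mul_equiv, submatrix_mul_equiv]

theorem ElemCongr.map {S : Type*} [CommRing S] (f : R →+* S) {φ ψ : Matrix ι ι R}
    (h : ElemCongr φ ψ) : ElemCongr (φ.map f) (ψ.map f) := by
  obtain ⟨g, hg, rfl⟩ := h
  exact ⟨_, ElemMat.map_mem f hg, by simp [Matrix.map_mul, transpose_map]⟩

theorem ElemCongr.hypSum {φ ψ : Matrix ι ι R} (h : ElemCongr φ ψ) :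
    ElemCongr (hypSum φ κ) (hypSum ψ κ) := by
  obtain ⟨g, hg, rfl⟩ := h
  exact ⟨_, ElemMat.fromBlocks_one_mem hg, by
    simp [_root_.hypSum, fromBlocks_multiply, fromBlocks_transpose]⟩

theorem hypSum_skew {φ : Matrix ι ι R} (hφ : φᵀ = -φ) : (hypSum φ κ)ᵀ = -hypSum φ κ := by
  simp [hypSum, fromBlocks_transpose, fromBlocks_neg, hφ]

theorem hypSum_mul {φ ψ : Matrix ι ι R} (h : φ * ψ = 1) :
    hypSum φ κ * fromBlocks ψ 0 0 (fromBlocks 0 (-1) 1 0) = 1 := by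
  simp [hypSum, fromBlocks_multiply, h, fromBlocks_one]

theorem hypSum_map {S : Type*} [CommRing S] (f : R →+* S) (φ : Matrix ι ι R) :
    (hypSum φ κ).map f = hypSum (φ.map f) κ := by
  ext (i | i | i) (j | j | j) <;> simp [hypSum, one_apply, apply_ite f]

theorem hypSum_isUnit {φ : Matrix ι ι R} (hφ : IsUnit φ) : IsUnit (hypSum φ κ) := by
  obtain ⟨ψ, hψ⟩ := hφ.exists_right_inv
  exact IsUnit.of_mul_eq_one _ (hypSum_mul hψ)

/-- Split off the first hyperbolic plane. -/
def hypEquiv (ι κ : Type) : ι ⊕ (Option κ ⊕ Option κ) ≃ Unit ⊕ ((ι ⊕ (κ ⊕ κ)) ⊕ Unit) where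
  toFun
    | .inl i => .inr (.inl (.inl i))
    | .inr (.inl none) => .inl ()
    | .inr (.inl (some k)) => .inr (.inl (.inr (.inl k)))
    | .inr (.inr none) => .inr (.inr ())
    | .inr (.inr (some k)) => .inr (.inl (.inr (.inr k)))
  invFun
    | .inr (.inl (.inl i)) => .inl i
    | .inl () => .inr (.inl none)
    | .inr (.inl (.inr (.inl k))) => .inr (.inl (some k))
    | .inr (.inr ()) => .inr (.inr none)
    | .inr (.inl (.inr (.inr k))) => .inr (.inr (some k))
  left_inv := by rintro (i | ⟨_ | i⟩ | ⟨_ | i⟩) <;> rfl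
  right_inv := by rintro (⟨⟩ | ((i | i | i) | ⟨⟨⟩⟩)) <;> rfl

theorem hypSum_option (φ : Matrix ι ι R) :
    hypSum φ (Option κ) = (hyp (hypSum φ κ)).submatrix (hypEquiv ι κ) (hypEquiv ι κ) := by
  ext (i | ⟨_ | i⟩ | ⟨_ | i⟩) (j | ⟨_ | j⟩ | ⟨_ | j⟩) <;>
    simp [hypSum, hyp, hypEquiv, one_apply]

theorem hypSum_equiv {κ' : Type} [DecidableEq κ'] (e : κ ≃ κ') (φ : Matrix ι ι R) :
    hypSum φ κ = (hypSum φ κ').submatrix (Equiv.sumCongr (Equiv.refl ι) (Equiv.sumCongr e e))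
      (Equiv.sumCongr (Equiv.refl ι) (Equiv.sumCongr e e)) := by
  ext (i | i | i) (j | j | j) <;> simp [hypSum, one_apply]

theorem elemCongr_submatrix_iff {φ ψ : Matrix ι ι R} (e : κ ≃ ι) :
    ElemCongr (φ.submatrix e e) (ψ.submatrix e e) ↔ ElemCongr φ ψ :=
  ⟨fun h => by simpa using h.submatrix e.symm, fun h => h.submatrix e⟩

/-- Skew forms may be cancelled. -/
theorem elemCongr_of_hypSum (h2 : IsUnit (2 : R)) (hι : 3 ≤ Fintype.card ι)
    (h : StableRange R (Fintype.card ι - 1)) {φ φ' : Matrix ι ι R} (hφ : φᵀ = -φ) (hu : IsUnit φ)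
    (κ : Type) [Finite κ] : ∀ [DecidableEq κ] [Fintype κ],
      ElemCongr (hypSum φ κ) (hypSum φ' κ) → ElemCongr φ φ' := by
  induction κ using Finite.induction_empty_option with
  | of_equiv e ih =>
    rename_i α β
    intro _ _ H
    have := Fintype.ofEquiv _ e.symm
    have : DecidableEq α := Classical.decEq _
    refine ih ?_
    rw [hypSum_equiv e, hypSum_equiv e φ']
    exact H.submatrix _
  | h_empty =>
    intro _ _ H
    rw [← elemCongr_submatrix_iff (Equiv.sumEmpty ι (PEmpty ⊕ PEmpty))]
    convert H using 1 <;>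
    · ext (i | i) (j | j)
      · rfl
      all_goals exact isEmptyElim ‹PEmpty ⊕ PEmpty›
  | h_option ih =>
    rename_i α _
    intro i₁ i₂ H
    have : DecidableEq α := Classical.decEq _
    obtain rfl := Subsingleton.elim i₁ (Option.instDecidableEq)
    obtain rfl := Subsingleton.elim i₂ instFintypeOption
    refine ih ?_
    rw [hypSum_option, hypSum_option] at H
    obtain ⟨ε, hε, e⟩ := (elemCongr_submatrix_iff _).mp H
    exact exists_congr_of_hyp h2 (by simp; omega) (h.mono (by simp; omega)) (hypSum_skew hφ)
      (hypSum_isUnit hu) hε e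

/-- Skew forms split off hyperbolic planes. -/
theorem exists_elemCongr_hypSum (h2 : IsUnit (2 : R)) (h : StableRange R (Fintype.card ι))
    (κ : Type) [Finite κ] : ∀ [DecidableEq κ] [Fintype κ]
      (ψ : Matrix (ι ⊕ (κ ⊕ κ)) (ι ⊕ (κ ⊕ κ)) R), ψᵀ = -ψ → IsUnit ψ →
      ∃ φ : Matrix ι ι R, φᵀ = -φ ∧ ElemCongr ψ (hypSum φ κ) := by
  induction κ using Finite.induction_empty_option with
  | of_equiv e ih =>
    rename_i α β
    intro _ _ ψ hψ hu
    have := Fintype.ofEquiv _ e.symm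
    have : DecidableEq α := Classical.decEq _
    let e' := Equiv.sumCongr (Equiv.refl ι) (Equiv.sumCongr e e)
    obtain ⟨φ, h1, h3⟩ := ih (ψ.submatrix e' e') (by
      rw [transpose_submatrix, hψ]; rfl) ((isUnit_submatrix_equiv e' e').mpr hu)
    refine ⟨φ, h1, (elemCongr_submatrix_iff e').mp ?_⟩
    rwa [← hypSum_equiv e]
  | h_empty =>
    intro _ _ ψ hψ hu
    let e := (Equiv.sumEmpty ι (PEmpty ⊕ PEmpty)).symm
    refine ⟨ψ.submatrix e e, by rw [transpose_submatrix, hψ]; rfl, ?_⟩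
    convert ElemCongr.refl ψ using 1
    ext (i | i) (j | j)
    · rfl
    all_goals exact isEmptyElim ‹PEmpty ⊕ PEmpty›
  | h_option ih =>
    rename_i α _
    intro i₁ i₂ ψ hψ hu
    have : DecidableEq α := Classical.decEq _
    obtain rfl := Subsingleton.elim i₁ (Option.instDecidableEq)
    obtain rfl := Subsingleton.elim i₂ instFintypeOption
    let e := (hypEquiv ι α).symm
    obtain ⟨ε, hε, χ, h1, h3⟩ := exists_congr_eq_hyp h2 (h.mono (by simp)) (ψ := ψ.submatrix e e)
      (by rw [transpose_submatrix, hψ]; rfl) ((isUnit_submatrix_equiv e e).mpr hu)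
    have hχ : IsUnit χ := by
      have hε' : IsUnit ε := by
        rw [isUnit_iff_isUnit_det, ElemMat.det_eq_one hε]; exact isUnit_one
      have h4 : IsUnit (hyp χ) := by
        rw [← h3]
        exact (((isUnit_transpose ε).mpr hε').mul ((isUnit_submatrix_equiv e e).mpr hu)).mul hε'
      obtain ⟨ω, hω⟩ := h4.exists_right_inv
      rw [hyp, ← fromBlocks_toBlocks ω, ← fromBlocks_one, fromBlocks_multiply, fromBlocks_inj] at hω
      have h5 := hω.2.2.2
      rw [← fromBlocks_toBlocks ω.toBlocks₂₂, ← fromBlocks_toBlocks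
        (-(fromCols 0 1)ᵀ * ω.toBlocks₁₂), fromBlocks_multiply, fromBlocks_add, ← fromBlocks_one,
        fromBlocks_inj] at h5
      refine IsUnit.of_mul_eq_one ω.toBlocks₂₂.toBlocks₁₁ ?_
      rw [← h5.1, Matrix.zero_mul, add_zero, right_eq_add]
      ext i j
      simp [toBlocks₁₁, mul_apply]
    obtain ⟨φ, h4, h5⟩ := ih χ h1 hχ
    refine ⟨φ, h4, ?_⟩
    have h6 : ElemCongr (ψ.submatrix e e) (hyp (hypSum φ α)) := by
      refine ElemCongr.trans ⟨ε, hε, h3.symm⟩ ?_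
      obtain ⟨g, hg, e⟩ := h5
      refine ⟨fromBlocks 1 0 0 (fromBlocks g 0 0 1), ElemMat.one_fromBlocks_mem
        (ElemMat.fromBlocks_one_mem hg), ?_⟩
      rw [hyp, hyp, congr_one_fromBlocks, e]
      simp only [fromBlocks_transpose, fromBlocks_multiply]
      ext (i | i | i) (j | j | j) <;> simp [mul_apply, one_apply]
    rw [← elemCongr_submatrix_iff e]
    convert h6 using 1
    rw [hypSum_option, submatrix_submatrix]
    simp [e]

end HypSum

section Linearize
open Polynomial
variable {B : Type*} [CommRing B]

theorem map_eq_of_natDegree_le_one {ι : Type} (M : Matrix ι ι B[X])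
    (h : ∀ i j, (M i j).natDegree ≤ 1) :
    M = (M.map (evalRingHom 0)).map (C : B →+* B[X]) + (X : B[X]) • (M.map fun p => p.coeff 1).map C := by
  ext1 i j
  simp only [Matrix.add_apply, Matrix.smul_apply, Matrix.map_apply, coe_evalRingHom, smul_eq_mul]
  conv_lhs => rw [(M i j).eq_X_add_C_of_natDegree_le_one (h i j)]
  rw [← coeff_zero_eq_eval_zero]
  ring

/-- Regroup hyperbolic summands. -/
def hypSumEquiv (ι κ κ' : Type) :
    (ι ⊕ (κ ⊕ κ)) ⊕ (κ' ⊕ κ') ≃ ι ⊕ ((κ ⊕ κ') ⊕ (κ ⊕ κ')) where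
  toFun
    | .inl (.inl i) => .inl i
    | .inl (.inr (.inl k)) => .inr (.inl (.inl k))
    | .inl (.inr (.inr k)) => .inr (.inr (.inl k))
    | .inr (.inl k) => .inr (.inl (.inr k))
    | .inr (.inr k) => .inr (.inr (.inr k))
  invFun
    | .inl i => .inl (.inl i)
    | .inr (.inl (.inl k)) => .inl (.inr (.inl k))
    | .inr (.inr (.inl k)) => .inl (.inr (.inr k))
    | .inr (.inl (.inr k)) => .inr (.inl k)
    | .inr (.inr (.inr k)) => .inr (.inr k)
  left_inv := by rintro ((i | i | i) | i | i) <;> rfl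
  right_inv := by rintro (i | (i | i) | i | i) <;> rfl

theorem hypSum_hypSum {R : Type*} [CommRing R] {ι κ κ' : Type} [DecidableEq κ]
    [DecidableEq κ'] (φ : Matrix ι ι R) :
    hypSum (hypSum φ κ) κ' =
      (hypSum φ (κ ⊕ κ')).submatrix (hypSumEquiv ι κ κ') (hypSumEquiv ι κ κ') := by
  ext ((i | i | i) | i | i) ((j | j | j) | j | j) <;>
    simp [hypSum, hypSumEquiv, one_apply]

theorem natDegree_fromBlocks_le {ι κ : Type*} {n : ℕ} {M : Matrix ι ι B[X]} {N : Matrix ι κ B[X]}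
    {P : Matrix κ ι B[X]} {Q : Matrix κ κ B[X]} (hM : ∀ i j, (M i j).natDegree ≤ n)
    (hN : ∀ i j, (N i j).natDegree ≤ n) (hP : ∀ i j, (P i j).natDegree ≤ n)
    (hQ : ∀ i j, (Q i j).natDegree ≤ n) :
    ∀ i j, (fromBlocks M N P Q i j).natDegree ≤ n := by
  rintro (i | i) (j | j)
  · exact hM i j
  · exact hN i j
  · exact hP i j
  · exact hQ i j

theorem exists_elemCongr_linear (h2 : IsUnit (2 : B)) (m : ℕ) :
    ∀ (ι : Type) [Fintype ι] [DecidableEq ι] (φ : Matrix ι ι B[X]), φᵀ = -φ →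
      (∀ i j, (φ i j).natDegree ≤ m + 1) →
      ∃ (κ : Type) (_ : Fintype κ) (_ : DecidableEq κ)
        (K : Matrix (ι ⊕ (κ ⊕ κ)) (ι ⊕ (κ ⊕ κ)) B),
        ElemCongr (hypSum φ κ)
          ((hypSum (φ.map (evalRingHom 0)) κ).map (C : B →+* B[X]) + (X : B[X]) • K.map C) := by
  induction m with
  | zero =>
    intro ι _ _ φ hφ hd
    refine ⟨Empty, inferInstance, inferInstance, (hypSum φ Empty).map fun p => p.coeff 1, ?_⟩
    rw [← hypSum_map, ← map_eq_of_natDegree_le_one]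
    · exact ElemCongr.refl _
    · rintro (i | i | i) (j | j | j)
      · exact hd i j
      all_goals exact isEmptyElim ‹Empty›
  | succ m ih =>
    intro ι _ _ φ hφ hd
    obtain ⟨t, ht⟩ := h2.exists_right_inv
    set V : Matrix ι ι B := φ.map fun p => p.coeff (m + 2) with hV
    set L : Matrix ι ι B[X] := ((-t) • V).map C with hL
    have hVs : ∀ i j, V i j = - V j i := fun i j => by
      have := congrFun₂ hφ j i
      simp only [transpose_apply, Matrix.neg_apply] at this
      simp only [hV, Matrix.map_apply, this, coeff_neg]
    set Y : Matrix (ι ⊕ ι) ι B[X] := fromRows ((X : B[X]) • 1) ((X : B[X]) ^ (m + 1) • L) with hY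
    set E : Matrix (ι ⊕ (ι ⊕ ι)) (ι ⊕ (ι ⊕ ι)) B[X] := fromBlocks 1 0 Y 1 with hE
    have hEm : E ∈ ElemMat _ _ := ElemMat.lower_mem _
    have hE0 : E.map (evalRingHom 0) = 1 := by
      have hY0 : Y.map (evalRingHom (0 : B)) = 0 := by
        ext (i | i) j <;> simp [hY]
      rw [hE, fromBlocks_map, hY0]
      simp
    set H : Matrix (ι ⊕ ι) (ι ⊕ ι) B[X] := fromBlocks 0 1 (-1) 0 with hH
    have hHY : H * Y = fromRows ((X : B[X]) ^ (m + 1) • L) (-((X : B[X]) • 1)) := by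
      rw [hH, hY, fromBlocks_mul_fromRows]; simp
    have hYH : Yᵀ * H = fromCols (-((X : B[X]) ^ (m + 1) • Lᵀ)) ((X : B[X]) • 1) := by
      rw [hH, hY, transpose_fromRows, fromCols_mul_fromBlocks]; simp
    have hYHY : Yᵀ * (H * Y) = (X : B[X]) ^ (m + 2) • (L - Lᵀ) := by
      rw [hHY, hY, transpose_fromRows, fromCols_mul_fromRows]
      simp only [transpose_smul, transpose_one, Matrix.smul_mul, Matrix.one_mul, Matrix.mul_neg,
        Matrix.mul_smul, Matrix.mul_one, smul_smul, smul_sub]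
      rw [← pow_succ, ← pow_succ', sub_eq_add_neg]
    have hψ : Eᵀ * hypSum φ ι * E = fromBlocks (φ + (X : B[X]) ^ (m + 2) • (L - Lᵀ))
        (fromCols (-((X : B[X]) ^ (m + 1) • Lᵀ)) ((X : B[X]) • 1))
        (fromRows ((X : B[X]) ^ (m + 1) • L) (-((X : B[X]) • 1))) H := by
      rw [← hYHY, ← hYH, ← hHY, hE, hypSum, fromBlocks_transpose, fromBlocks_multiply,
        fromBlocks_multiply]
      simp [← hH, Matrix.mul_assoc]
    obtain ⟨κ, _, _, K, hK⟩ := ih _ (Eᵀ * hypSum φ ι * E) (skew_congr (hypSum_skew hφ) E) (by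
      rw [hψ]
      have hCX : ∀ c : B, ((X : B[X]) ^ (m + 1) * C c).natDegree ≤ m + 1 := fun c => by
        rw [mul_comm]; exact natDegree_C_mul_X_pow_le _ _
      have hLd : ∀ i j, ((X : B[X]) ^ (m + 1) * L i j).natDegree ≤ m + 1 := fun i j => hCX _
      have hX : ∀ i j, ((X : B[X]) * (1 : Matrix ι ι B[X]) i j).natDegree ≤ m + 1 := fun i j => by
        rw [one_apply]
        split_ifs
        · rw [mul_one]; exact natDegree_X_le.trans (by omega)
        · simp
      have hH' : ∀ i j, (H i j).natDegree ≤ m + 1 := by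
        rintro (i | i) (j | j) <;> simp [hH, one_apply] <;> split_ifs <;> simp
      refine natDegree_fromBlocks_le ?_ ?_ ?_ hH'
      · intro i j
        have e : (φ + (X : B[X]) ^ (m + 2) • (L - Lᵀ)) i j
            = φ i j - C ((φ i j).coeff (m + 2)) * X ^ (m + 2) := by
          have e1 : L i j - L j i = - C (V i j) := by
            simp only [hL, Matrix.map_apply, Matrix.smul_apply, smul_eq_mul]
            rw [hVs j i, ← map_sub, ← map_neg]
            congr 1
            linear_combination (-V i j) * ht
          simp only [Matrix.add_apply, Matrix.smul_apply, Matrix.sub_apply, transpose_apply,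
            smul_eq_mul, e1]
          rw [hV, Matrix.map_apply]; ring
        rw [e, natDegree_le_iff_coeff_eq_zero]
        intro N hN
        rw [coeff_sub, coeff_C_mul_X_pow]
        rcases eq_or_ne N (m + 2) with rfl | hN'
        · simp
        · rw [if_neg hN', sub_zero]
          exact coeff_eq_zero_of_natDegree_lt ((hd i j).trans_lt (by omega))
      · rintro i (j | j)
        · rw [fromCols_apply_inl, Matrix.neg_apply, natDegree_neg]
          exact hLd j i
        · exact hX i j
      · rintro (i | i) j
        · exact hLd i j
        · rw [fromRows_apply_inr, Matrix.neg_apply, natDegree_neg]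
          exact hX i j)
    have hc : (Eᵀ * hypSum φ ι * E).map (evalRingHom 0) = hypSum (φ.map (evalRingHom 0)) ι := by
      rw [Matrix.map_mul, Matrix.map_mul, transpose_map, hE0, hypSum_map]; simp
    rw [hc] at hK
    have h1 : ElemCongr (hypSum (hypSum φ ι) κ) (hypSum (Eᵀ * hypSum φ ι * E) κ) :=
      ElemCongr.hypSum ⟨E, hEm, rfl⟩
    have h3 := h1.trans hK
    let e := (hypSumEquiv ι ι κ).symm
    refine ⟨ι ⊕ κ, inferInstance, inferInstance, K.submatrix e e, ?_⟩
    rw [hypSum_hypSum, hypSum_hypSum] at h3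
    convert h3.submatrix e using 1
    · rw [submatrix_submatrix]; simp [e]
    · ext1 i j
      simp [e]

end Linearize

section LinearRoot
open Polynomial
variable {B : Type*} [CommRing B] {ι : Type*} [Fintype ι] [DecidableEq ι]

theorem isNilpotent_of_one_add_X_smul_mul {N : Matrix ι ι B} {G : Matrix ι ι B[X]}
    (h : (1 + (X : B[X]) • N.map (C : B →+* B[X])) * G = 1) : IsNilpotent N := by
  have h1 : ∀ n, G.map (fun p => p.coeff (n + 1)) = -(N * G.map fun p => p.coeff n) := by
    intro n
    ext i j
    have := congrArg (fun p => p.coeff (n + 1)) (congrFun₂ h i j)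
    simp only [Matrix.add_mul, Matrix.one_mul, Matrix.smul_mul, Matrix.add_apply,
      Matrix.smul_apply, smul_eq_mul, coeff_add, coeff_X_mul] at this
    have h0 : ((1 : Matrix ι ι B[X]) i j).coeff (n + 1) = 0 := by
      rw [one_apply]; split_ifs <;> simp [coeff_one]
    rw [h0, Matrix.mul_apply, finsetSum_coeff] at this
    simp only [Matrix.map_apply, coeff_C_mul] at this
    simp only [Matrix.map_apply, Matrix.neg_apply, Matrix.mul_apply]
    linear_combination this
  have h0 : G.map (fun p => p.coeff 0) = 1 := by
    ext i j
    have := congrArg (fun p => p.coeff 0) (congrFun₂ h i j)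
    simp only [Matrix.add_mul, Matrix.one_mul, Matrix.smul_mul, Matrix.add_apply,
      Matrix.smul_apply, smul_eq_mul, coeff_add, coeff_X_mul_zero, add_zero] at this
    rw [Matrix.map_apply, this, one_apply, one_apply]
    split_ifs <;> simp
  have hn : ∀ n, G.map (fun p => p.coeff n) = (-N) ^ n := by
    intro n
    induction n with
    | zero => rw [h0, pow_zero]
    | succ n ih => rw [h1, ih, pow_succ', Matrix.neg_mul]
  let d := Finset.univ.sup fun q : ι × ι => (G q.1 q.2).natDegree
  have : (-N) ^ (d + 1) = 0 := by
    rw [← hn]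
    ext i j
    have : (G i j).natDegree ≤ d :=
      Finset.le_sup (f := fun q : ι × ι => (G q.1 q.2).natDegree) (Finset.mem_univ (i, j))
    exact coeff_eq_zero_of_natDegree_lt (by omega)
  rw [← isNilpotent_neg_iff]
  exact ⟨_, this⟩

theorem eq_one_of_pow_eq_one {w : B[X]} {k : ℕ} (hk : IsUnit (k : B)) (h : w ^ k = 1)
    (h0 : w.eval 0 = 1) : w = 1 := by
  have hs : (∑ i ∈ Finset.range k, w ^ i).eval 0 = k := by
    simp [eval_finsetSum, h0]
  have hX : (X : B[X]) ∣ w - 1 := by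
    rw [X_dvd_iff, coeff_zero_eq_eval_zero]; simp [h0]
  obtain ⟨q, hq⟩ := hX
  have hz : (∑ i ∈ Finset.range k, w ^ i) * (w - 1) = 0 := by
    rw [geom_sum_mul, h, sub_self]
  set s := ∑ i ∈ Finset.range k, w ^ i
  have hsq : s * q = 0 := by
    have : X * (s * q) = 0 := by rw [← hz, hq]; ring
    exact (isRegular_X.left) (by simpa using this)
  have hs0 : IsUnit (s.coeff 0) := by rw [coeff_zero_eq_eval_zero, hs]; exact hk
  have hq0 : ∀ n, q.coeff n = 0 := by
    intro n
    induction n using Nat.strong_induction_on with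
    | _ n ih =>
      have := congrArg (fun p => p.coeff n) hsq
      simp only [coeff_mul, coeff_zero] at this
      rw [Finset.sum_eq_single (0, n)] at this
      · exact (hs0.mul_right_eq_zero).1 this
      · rintro ⟨a, b⟩ hab hne
        rw [Finset.HasAntidiagonal.mem_antidiagonal] at hab
        rw [ih b, mul_zero]
        rcases Nat.eq_zero_or_pos a with rfl | ha
        · simp at hab; simp [hab] at hne
        · simp only at hab; omega
      · intro hh; simp at hh
  have : q = 0 := by ext n; simp [hq0]
  rw [this, mul_zero, sub_eq_zero] at hq
  exact hq

/-- An invertible skew matrix linear in `X` is the product of its constant term and a `k`-th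
power of a matrix self-adjoint with respect to it. -/
theorem exists_selfAdjoint_root {J Ji K : Matrix ι ι B} (hJ : Jᵀ = -J) (hJi : J * Ji = 1)
    (hK : Kᵀ = -K) {k : ℕ} (hk : IsUnit (k : B))
    (hdet : (1 + (X : B[X]) • (Ji * K).map (C : B →+* B[X])).det = 1) :
    ∃ h : Matrix ι ι B[X], h.det = 1 ∧ hᵀ * J.map (C : B →+* B[X]) = J.map (C : B →+* B[X]) * h ∧
      J.map (C : B →+* B[X]) * h ^ k = J.map (C : B →+* B[X]) + (X : B[X]) • K.map (C : B →+* B[X]) := by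
  set N := Ji * K with hN
  have hu : IsUnit (1 + (X : B[X]) • N.map (C : B →+* B[X])) := by
    rw [isUnit_iff_isUnit_det, hdet]; exact isUnit_one
  obtain ⟨G, hG⟩ := hu.exists_right_inv
  obtain ⟨m, hm⟩ := isNilpotent_of_one_add_X_smul_mul hG
  obtain ⟨p, hp0, q, hp⟩ := exists_root_one_add_X k hk m
  have hJN : J * N = K := by rw [hN, ← Matrix.mul_assoc, hJi, Matrix.one_mul]
  have hNJ : Nᵀ * J = K := by
    have : Nᵀ * Jᵀ = Kᵀ := by rw [← transpose_mul, hJN]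
    rw [hJ, hK, Matrix.mul_neg] at this
    exact neg_injective this
  set M : Matrix ι ι B[X] := (X : B[X]) • N.map (C : B →+* B[X]) with hM
  set JC := J.map (C : B →+* B[X]) with hJC
  have hJM : JC * M = (X : B[X]) • K.map (C : B →+* B[X]) := by
    rw [hM, hJC, Matrix.mul_smul, ← Matrix.map_mul, hJN]
  have hMJ : Mᵀ * JC = JC * M := by
    rw [hJM, hM, hJC, transpose_smul, Matrix.smul_mul, ← transpose_map, ← Matrix.map_mul, hNJ]
  have hMm : M ^ m = 0 := by
    have : (N.map (C : B →+* B[X])) ^ m = (N ^ m).map (C : B →+* B[X]) := by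
      exact (map_pow (C : B →+* B[X]).mapMatrix N m).symm
    rw [hM, _root_.smul_pow, this, hm]
    simp
  have hpk : (aeval M p) ^ k = 1 + M := by
    have := congrArg (aeval M) hp
    rw [map_mul, map_pow, aeval_X, hMm, zero_mul, map_sub, map_pow, sub_eq_zero, map_add,
      map_one, aeval_X] at this
    exact this
  refine ⟨aeval M p, ?_, ?_, ?_⟩
  · refine eq_one_of_pow_eq_one hk ?_ ?_
    · rw [← det_pow, hpk, hdet]
    · let f : Matrix ι ι B[X] →ₐ[B] Matrix ι ι B := (aeval (0 : B)).mapMatrix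
      have h1 : f M = 0 := by
        ext i j
        simp [f, hM]
      have h2 : f (aeval M p) = 1 := by
        rw [← aeval_algHom_apply, h1, ← coeff_zero_eq_aeval_zero', hp0, map_one]
      have h3 : (evalRingHom (0 : B)) (aeval M p).det = ((evalRingHom (0 : B)).mapMatrix (aeval M p)).det :=
        RingHom.map_det _ _
      rw [← coe_evalRingHom, h3]
      have h4 : (evalRingHom (0 : B)).mapMatrix (aeval M p) = f (aeval M p) := by
        ext i j
        simp [f, coe_aeval_eq_eval]
      rw [h4, h2, det_one]
  · have hpow : ∀ n, (M ^ n)ᵀ * JC = JC * M ^ n := by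
      intro n
      induction n with
      | zero => simp
      | succ n ih =>
        rw [pow_succ, transpose_mul, Matrix.mul_assoc, ih, ← Matrix.mul_assoc, hMJ,
          Matrix.mul_assoc, ← pow_succ', ← pow_succ]
    rw [aeval_eq_sum_range, transpose_sum, Matrix.sum_mul, Matrix.mul_sum]
    exact Finset.sum_congr rfl fun i _ => by
      rw [transpose_smul, Matrix.smul_mul, Matrix.mul_smul, hpow]
  · rw [hpk, Matrix.mul_add, Matrix.mul_one, hJM]

end LinearRoot

section Rel
variable {ι κ : Type} [Fintype ι] [DecidableEq ι] [Fintype κ] [DecidableEq κ]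
  {R : Type*} [CommRing R] {M M' N N' g : Matrix ι ι R}

theorem ElemRel.refl (M : Matrix ι ι R) : ElemRel M M := ⟨1, one_mem _, by simp⟩

theorem ElemRel.of_eq (h : M = N) : ElemRel M N := h ▸ ElemRel.refl M

theorem ElemRel.mul_right (M : Matrix ι ι R) (hg : g ∈ ElemMat ι R) : ElemRel M (M * g) :=
  ⟨g, hg, rfl⟩

theorem ElemRel.mul_left (hι : 3 ≤ Fintype.card ι) (hM : IsUnit M) (hg : g ∈ ElemMat ι R) :
    ElemRel M (g * M) := by
  obtain ⟨L, hL⟩ := hM.exists_left_inv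
  have hL' := mul_eq_one_comm.mp hL
  refine ⟨L * g * M, ElemMat.conj_mem hι hL hg, ?_⟩
  rw [mul_assoc, ← mul_assoc, hL', one_mul]

theorem ElemRel.mul (hι : 3 ≤ Fintype.card ι) (h : ElemRel M M') (h' : ElemRel N N')
    (hN : IsUnit N) : ElemRel (M * N) (M' * N') := by
  obtain ⟨g, hg, rfl⟩ := h
  obtain ⟨k, hk, rfl⟩ := h'
  obtain ⟨l, hl, hl'⟩ := ElemRel.mul_left hι hN hg
  refine ⟨l * k, mul_mem hl hk, ?_⟩
  rw [mul_assoc M g, ← mul_assoc g, hl', mul_assoc, mul_assoc]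

theorem ElemRel.isUnit (h : ElemRel M N) (hM : IsUnit M) : IsUnit N := by
  obtain ⟨g, hg, rfl⟩ := h
  obtain ⟨k, hk, h1, h2⟩ := ElemMat.exists_inv hg
  exact hM.mul (IsUnit.of_mul_eq_one _ h1)

theorem ElemRel.pow (hι : 3 ≤ Fintype.card ι) (h : ElemRel M N) (hM : IsUnit M) (n : ℕ) :
    ElemRel (M ^ n) (N ^ n) := by
  induction n with
  | zero => simpa using ElemRel.refl _
  | succ n ih => rw [pow_succ, pow_succ]; exact ih.mul hι h hM

theorem ElemRel.submatrix (e : κ ≃ ι) (h : ElemRel M N) :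
    ElemRel (M.submatrix e e) (N.submatrix e e) := by
  obtain ⟨g, hg, rfl⟩ := h
  exact ⟨_, ElemMat.submatrix_mem e hg, (submatrix_mul_equiv _ _ _ _ _).symm⟩

theorem ElemRel.fromBlocks_one (h : ElemRel M N) :
    ElemRel (fromBlocks M 0 0 (1 : Matrix κ κ R)) (fromBlocks N 0 0 1) := by
  obtain ⟨g, hg, rfl⟩ := h
  exact ⟨_, ElemMat.fromBlocks_one_mem hg, by simp [fromBlocks_multiply]⟩

theorem ElemRel.of_fromBlocks_one_fin (hι : 3 ≤ Fintype.card ι)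
    (h : StableRange R (Fintype.card ι - 1)) (m : ℕ) (hM : IsUnit M)
    (hh : ElemRel (fromBlocks M 0 0 (1 : Matrix (Fin m) (Fin m) R)) (fromBlocks N 0 0 1)) :
    ElemRel M N := by
  obtain ⟨L, hL⟩ := hM.exists_left_inv
  obtain ⟨g, hg, hgN⟩ := hh
  refine ⟨L * N, ElemMat.of_fromBlocks_one_fin hι h m ?_, ?_⟩
  · have : fromBlocks (L * N) 0 0 (1 : Matrix (Fin m) (Fin m) R) = g := by
      have h1 : fromBlocks L 0 0 (1 : Matrix (Fin m) (Fin m) R) * fromBlocks M 0 0 1 = 1 := by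
        rw [fromBlocks_multiply]; simp [hL]
      calc _ = fromBlocks L 0 0 (1 : Matrix (Fin m) (Fin m) R) * fromBlocks N 0 0 1 := by
              rw [fromBlocks_multiply]; simp
        _ = g := by rw [hgN, ← mul_assoc, h1, one_mul]
    rw [this]; exact hg
  · rw [← mul_assoc, mul_eq_one_comm.mp hL, one_mul]

end Rel

section Mennicke
variable {T : Type*} [CommRing T]

theorem ElemMat.signedSwap_mem {ι : Type*} [Fintype ι] [DecidableEq ι] {i j : ι} (h : i ≠ j) :
    transvection i j (-1 : T) * transvection j i 1 * transvection i j (-1) ∈ ElemMat ι T :=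
  mul_mem (mul_mem (transvection_mem h _) (transvection_mem h.symm _)) (transvection_mem h _)

theorem ElemRel.mennicke {a b c d b' c' d' r s : T} (h1 : a * d - b * c = 1)
    (h2 : a * d' - b' * c' = 1) (h3 : a * s - b * b' * r = 1) :
    ElemRel (!![a, b, 0; c, d, 0; 0, 0, 1] * !![a, b', 0; c', d', 0; 0, 0, 1])
      !![a, b * b', 0; r, s, 0; 0, 0, 1] := by
  have hc : 3 ≤ Fintype.card (Fin 3) := by simp
  have m10 (x : T) : !![1, 0, 0; x, 1, 0; 0, 0, 1] ∈ ElemMat (Fin 3) T := by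
    convert ElemMat.transvection_mem (show (1 : Fin 3) ≠ 0 by decide) x using 1
    ext i j; fin_cases i <;> fin_cases j <;> simp [transvection]
  have m20 (x : T) : !![1, 0, 0; 0, 1, 0; x, 0, 1] ∈ ElemMat (Fin 3) T := by
    convert ElemMat.transvection_mem (show (2 : Fin 3) ≠ 0 by decide) x using 1
    ext i j; fin_cases i <;> fin_cases j <;> simp [transvection]
  have m21 (x : T) : !![1, 0, 0; 0, 1, 0; 0, x, 1] ∈ ElemMat (Fin 3) T := by
    convert ElemMat.transvection_mem (show (2 : Fin 3) ≠ 1 by decide) x using 1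
    ext i j; fin_cases i <;> fin_cases j <;> simp [transvection]
  have m02 (x : T) : !![1, 0, x; 0, 1, 0; 0, 0, 1] ∈ ElemMat (Fin 3) T := by
    convert ElemMat.transvection_mem (show (0 : Fin 3) ≠ 2 by decide) x using 1
    ext i j; fin_cases i <;> fin_cases j <;> simp [transvection]
  have w12 : !![1, 0, 0; 0, 0, 1; 0, -1, (0 : T)] ∈ ElemMat (Fin 3) T := by
    convert ElemMat.signedSwap_mem (T := T) (show (2 : Fin 3) ≠ 1 by decide) using 1
    ext i j; fin_cases i <;> fin_cases j <;>
      simp [transvection, Matrix.mul_apply, Fin.sum_univ_three, single_apply, one_apply]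
  have w02 : !![0, 0, -1; 0, 1, 0; 1, 0, (0 : T)] ∈ ElemMat (Fin 3) T := by
    convert ElemMat.signedSwap_mem (T := T) (show (0 : Fin 3) ≠ 2 by decide) using 1
    ext i j; fin_cases i <;> fin_cases j <;>
      simp [transvection, Matrix.mul_apply, Fin.sum_univ_three, single_apply, one_apply]
  have w01 : !![0, 1, 0; -1, 0, 0; 0, 0, (1 : T)] ∈ ElemMat (Fin 3) T := by
    convert ElemMat.signedSwap_mem (T := T) (show (1 : Fin 3) ≠ 0 by decide) using 1
    ext i j; fin_cases i <;> fin_cases j <;>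
      simp [transvection, Matrix.mul_apply, Fin.sum_univ_three, single_apply, one_apply]
  have u2 : IsUnit !![a, b', 0; c', d', 0; 0, 0, 1] := by
    rw [isUnit_iff_isUnit_det, det_fin_three]
    simp [h2]
  have u1 : IsUnit !![a, b, 0; c, d, 0; 0, 0, 1] := by
    rw [isUnit_iff_isUnit_det, det_fin_three]
    simp [h1]
  have hY : ElemRel !![a, b', 0; c', d', 0; 0, 0, 1] !![1, 0, 0; 0, b', -a; 0, d', -c'] := by
    refine ((ElemRel.mul_left hc u2 (mul_mem (mul_mem (mul_mem w01 w01) w01)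
      (mul_mem (mul_mem w12 w12) w12))).trans (ElemRel.mul_right _ w02)).trans ?_
    refine ElemRel.of_eq ?_
    simp
  have uY := hY.isUnit u2
  refine ((ElemRel.refl _).mul hc hY u2).trans ?_
  have uM := u1.mul uY
  refine ((ElemRel.mul_left hc uM (mul_mem (mul_mem
    (m10 (r * (d' - c' * d * b') + s * (c * c'))) w12) (m21 (-c')))).trans
    (ElemRel.mul_right _ (mul_mem (mul_mem (m02 b) (m20 c)) (m21 (d * b'))))).trans ?_
  refine ElemRel.of_eq ?_
  rw [← sub_eq_zero]
  ext i j
  fin_cases i <;> fin_cases j <;> simp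
  · ring
  · ring
  · ring
  · linear_combination r * h2 + (c * c' - r * b' * c') * h1 + c * c' * h3
  · linear_combination s * h2 + (c' * d * b' - s * b' * c') * h1 - (d' - c' * d * b') * h3
  · linear_combination c' * h1
  · linear_combination c * h1
  · linear_combination d * b' * h1
  · linear_combination h1

end Mennicke

section MennickePow
variable {T : Type*} [CommRing T]

theorem ElemRel.mennicke_pow {a b c d : T} (h1 : a * d - b * c = 1) (n : ℕ) :
    ∀ {r s : T}, a * s - b ^ (n + 1) * r = 1 →
      ElemRel (!![a, b, 0; c, d, 0; 0, 0, 1] ^ (n + 1)) !![a, b ^ (n + 1), 0; r, s, 0; 0, 0, 1] := by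
  have hc : 3 ≤ Fintype.card (Fin 3) := by simp
  have u1 : IsUnit !![a, b, 0; c, d, 0; 0, 0, 1] := by
    rw [isUnit_iff_isUnit_det, det_fin_three]
    simp [h1]
  induction n with
  | zero =>
    intro r s h3
    have m10 : !![1, 0, 0; r * d - s * c, 1, 0; 0, 0, 1] ∈ ElemMat (Fin 3) T := by
      convert ElemMat.transvection_mem (show (1 : Fin 3) ≠ 0 by decide) (r * d - s * c) using 1
      ext i j; fin_cases i <;> fin_cases j <;> simp [transvection]
    rw [zero_add, pow_one] at h3 ⊢
    rw [pow_one]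
    refine (ElemRel.mul_left hc u1 m10).trans (ElemRel.of_eq ?_)
    rw [← sub_eq_zero]
    ext i j
    fin_cases i <;> fin_cases j <;> simp
    · linear_combination r * h1 - c * h3
    · linear_combination s * h1 - d * h3
  | succ n ih =>
    intro r s h3
    have hco : IsCoprime a (b ^ (n + 1)) := IsCoprime.pow_right ⟨d, -c, by linear_combination h1⟩
    obtain ⟨u, v, huv⟩ := hco
    have h4 : a * u - b ^ (n + 1) * (-v) = 1 := by linear_combination huv
    rw [pow_succ _ (n + 1)]
    refine ((ih h4).mul hc (ElemRel.refl _) u1).trans ?_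
    rw [pow_succ b (n + 1)] at h3 ⊢
    exact ElemRel.mennicke h4 h1 h3

end MennickePow

section Blocks
variable {T S : Type*} [CommRing T] [CommRing S] {ι κ : Type} [Fintype ι] [DecidableEq ι]
  [Fintype κ] [DecidableEq κ]

/-- Matrices over a commutative ring of matrices, seen as larger matrices. -/
def blockHom (ι : Type) [Fintype ι] [DecidableEq ι] (F : T →+* Matrix κ κ S) :
    Matrix ι ι T →+* Matrix (ι × κ) (ι × κ) S :=
  (compRingEquiv ι κ S).toRingHom.comp F.mapMatrix

theorem blockHom_apply (F : T →+* Matrix κ κ S) (M : Matrix ι ι T) (x y : ι × κ) :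
    blockHom ι F M x y = F (M x.1 y.1) x.2 y.2 := rfl

theorem ElemMat.blockHom_mem (F : T →+* Matrix κ κ S) {M : Matrix ι ι T} (hM : M ∈ ElemMat ι T) :
    blockHom ι F M ∈ ElemMat (ι × κ) S := by
  induction hM using Submonoid.closure_induction with
  | mem x hx =>
    obtain ⟨i, j, hij, c, rfl⟩ := hx
    rw [transvection, map_add, map_one]
    refine ElemMat.one_add_mem_of_separated _ (fun q => q.1 = i) fun x y hxy => ?_
    rw [blockHom_apply, single_apply] at hxy
    by_cases h : i = x.1 ∧ j = y.1
    · exact ⟨h.1.symm, fun h' => hij (h'.symm.trans h.2.symm)⟩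
    · simp [h] at hxy
  | one => rw [map_one]; exact one_mem _
  | mul x y _ _ hx hy => rw [map_mul]; exact mul_mem hx hy

theorem ElemRel.blockHom (F : T →+* Matrix κ κ S) {M N : Matrix ι ι T} (h : ElemRel M N) :
    ElemRel (blockHom ι F M) (blockHom ι F N) := by
  obtain ⟨g, hg, rfl⟩ := h
  exact ⟨_, ElemMat.blockHom_mem F hg, map_mul _ _ _⟩

/-- Three blocks of size `κ`. -/
def threeBlocks (κ : Type) : (κ ⊕ κ) ⊕ κ ≃ Fin 3 × κ where
  toFun
    | .inl (.inl i) => (0, i)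
    | .inl (.inr i) => (1, i)
    | .inr i => (2, i)
  invFun
    | (0, i) => .inl (.inl i)
    | (1, i) => .inl (.inr i)
    | (2, i) => .inr i
  left_inv := by rintro ((i | i) | i) <;> rfl
  right_inv := by rintro ⟨x, i⟩; fin_cases x <;> rfl

theorem blockHom_submatrix (F : T →+* Matrix κ κ S) (a b c d : T) :
    (blockHom (Fin 3) F !![a, b, 0; c, d, 0; 0, 0, 1]).submatrix (threeBlocks κ) (threeBlocks κ) =
      fromBlocks (fromBlocks (F a) (F b) (F c) (F d)) 0 0 1 := by
  ext ((i | i) | i) ((j | j) | j) <;> simp [threeBlocks, blockHom_apply]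

theorem ElemRel.block_mennicke_pow (hS : StableRange S 3) (F : T →+* Matrix (Fin 2) (Fin 2) S)
    {a b c d : T} (h1 : a * d - b * c = 1) (n : ℕ) {r s : T} (h : a * s - b ^ (n + 1) * r = 1) :
    ElemRel (fromBlocks (F a) (F b) (F c) (F d) ^ (n + 1))
      (fromBlocks (F a) (F (b ^ (n + 1))) (F r) (F s)) := by
  have key := ((ElemRel.mennicke_pow h1 n h).blockHom F).submatrix (threeBlocks (Fin 2))
  have hu : IsUnit (fromBlocks (F a) (F b) (F c) (F d)) := by
    have : fromBlocks (F a) (F b) (F c) (F d) * fromBlocks (F d) (F (-b)) (F (-c)) (F a) = 1 := by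
      rw [fromBlocks_multiply]
      simp only [← map_mul, ← map_add]
      rw [show a * d + b * -c = 1 by linear_combination h1, show a * -b + b * a = 0 by ring,
        show c * d + d * -c = 0 by ring, show c * -b + d * a = 1 by linear_combination h1]
      simp
    exact IsUnit.of_mul_eq_one _ this
  refine ElemRel.of_fromBlocks_one_fin (by simp) (by simpa using hS) 2 (hu.pow _) ?_
  rw [blockHom_submatrix, map_pow] at key
  convert key using 1
  have e1 : ∀ m, (_root_.blockHom (Fin 3) F !![a, b, 0; c, d, 0; 0, 0, 1] ^ m).submatrix
      (threeBlocks (Fin 2)) (threeBlocks (Fin 2)) =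
      fromBlocks (fromBlocks (F a) (F b) (F c) (F d) ^ m) 0 0 1 := by
    intro m
    induction m with
    | zero => simp
    | succ m ih =>
      rw [pow_succ, pow_succ, ← submatrix_mul_equiv _ _ _ (threeBlocks (Fin 2)), ih,
        blockHom_submatrix, fromBlocks_multiply]
      simp
  exact (e1 _).symm

end Blocks

section SkewFour
variable {S : Type*} [CommRing S]

/-- Split off the first index. -/
def unitSumFin (n : ℕ) : Fin (n + 1) ≃ Unit ⊕ Fin n where
  toFun := Fin.cases (.inl ()) .inr
  invFun := Sum.elim (fun _ => 0) Fin.succ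
  left_inv := by intro i; cases i using Fin.cases <;> rfl
  right_inv := by rintro (i | i) <;> rfl

theorem ElemRel.one_corner {n : ℕ} (hn : 3 ≤ n + 1) {M : Matrix (Fin (n + 1)) (Fin (n + 1)) S}
    (hM : IsUnit M) (h1 : M 0 0 = 1) :
    ElemRel M ((fromBlocks 1 0 0 (Matrix.of fun i j : Fin n =>
      M i.succ j.succ - M i.succ 0 * M 0 j.succ)).submatrix (unitSumFin n) (unitSumFin n)) := by
  set e := unitSumFin n
  set β := Matrix.of fun i j : Fin n => M i.succ j.succ - M i.succ 0 * M 0 j.succ with hβ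
  set w : Matrix (Fin n) Unit S := Matrix.of fun i _ => M i.succ 0 with hw
  set v : Matrix Unit (Fin n) S := Matrix.of fun _ j => M 0 j.succ with hv
  have h2 : M.submatrix e.symm e.symm = fromBlocks 1 v w (β + w * v) := by
    ext (i | i) (j | j)
    · simpa [e, unitSumFin] using h1
    · simp [e, unitSumFin, hv]
    · simp [e, unitSumFin, hw]
    · simp [e, unitSumFin, hβ, hw, hv, Matrix.mul_apply]
  have h3 : fromBlocks 1 0 (-w) 1 * M.submatrix e.symm e.symm * fromBlocks 1 (-v) 0 1 =
      fromBlocks 1 0 0 β := by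
    rw [h2, fromBlocks_multiply, fromBlocks_multiply]
    simp
  have hu : IsUnit (M.submatrix e.symm e.symm) := by
    rw [isUnit_iff_isUnit_det, det_submatrix_equiv_self, ← isUnit_iff_isUnit_det]; exact hM
  have h4 := ((ElemRel.mul_left (by simpa [add_comm] using hn) hu (ElemMat.lower_mem (-w))).trans
    (ElemRel.mul_right _ (ElemMat.upper_mem (-v)))).trans (ElemRel.of_eq h3)
  simpa [submatrix_submatrix] using h4.submatrix e

theorem ElemMat.block_swap_mem {κ : Type*} [Fintype κ] [DecidableEq κ] :
    fromBlocks 0 (-1) 1 (0 : Matrix κ κ S) ∈ ElemMat (κ ⊕ κ) S := by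
  convert mul_mem (mul_mem (ElemMat.upper_mem (-1 : Matrix κ κ S)) (ElemMat.lower_mem 1))
    (ElemMat.upper_mem (-1)) using 1
  simp [fromBlocks_multiply]

/-- Powers of the product of a skew form of size four with the inverse of the standard one are,
up to elementary matrices, matrices whose first row involves a power. -/
theorem ElemRel.block_skew_pow (hS : StableRange S 3) {a b c a' b' c' : S}
    (h : a * a' + b * b' + c * c' = 1) (n : ℕ) :
    ElemRel (fromBlocks (a • 1) !![-c', b'; b, c] !![c, -b'; -b, -c'] (a' • 1) ^ (n + 1))
      (fromBlocks !![-c', b'; b, c] ((-a) ^ (n + 1) • 1) (-((-a') ^ (n + 1)) • 1)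
        (-(∑ i ∈ Finset.range (n + 1), (a * a') ^ i) • !![c, -b'; -b, -c'])) := by
  set P : Matrix (Fin 2) (Fin 2) S := !![-c', b'; b, c] with hP
  set Q : Matrix (Fin 2) (Fin 2) S := !![c, -b'; -b, -c'] with hQ
  set g := ∑ i ∈ Finset.range (n + 1), (a * a') ^ i with hg
  have hQP : Q = (c - c') • 1 - P := by
    ext i j; fin_cases i <;> fin_cases j <;> simp [hP, hQ]
  have hPQ : P * Q = (-(b * b' + c * c')) • 1 := by
    ext i j; fin_cases i <;> fin_cases j <;> simp [hP, hQ] <;> ring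
  have hgg : (1 - a * a') * g = 1 - (a * a') ^ (n + 1) := mul_neg_geom_sum _ _
  letI : CommRing (Algebra.adjoin S {P}) := Algebra.adjoinCommRingOfComm S (by
    intro x hx y hy; rw [Set.mem_singleton_iff] at hx hy; rw [hx, hy])
  let F : Algebra.adjoin S {P} →+* Matrix (Fin 2) (Fin 2) S := (Algebra.adjoin S {P}).val.toRingHom
  have hF : Function.Injective F := Subtype.val_injective
  let p : Algebra.adjoin S {P} := ⟨P, Algebra.subset_adjoin rfl⟩
  let q : Algebra.adjoin S {P} := ⟨Q, hQP ▸ sub_mem (Subalgebra.smul_mem _ (one_mem _) _) p.2⟩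
  let cc : S →+* Algebra.adjoin S {P} := algebraMap _ _
  have hp : F p = P := rfl
  have hq : F q = Q := rfl
  have hcc : ∀ x, F (cc x) = x • 1 := fun x => Algebra.algebraMap_eq_smul_one x
  have hpq : p * q = -(cc b * cc b' + cc c * cc c') := by
    rw [← map_mul, ← map_mul, ← map_add, ← map_neg]
    apply hF
    rw [map_mul, hcc, hp, hq, hPQ]
  have hh := congrArg cc h
  simp only [map_add, map_mul, map_one] at hh
  have hgg' := congrArg cc hgg
  simp only [map_sub, map_mul, map_one, map_pow] at hgg'
  have hu : IsUnit (fromBlocks (a • 1) P Q (a' • 1)) := by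
    have : fromBlocks (F (cc a)) (F p) (F q) (F (cc a')) *
        fromBlocks (F (cc a')) (F (-p)) (F (-q)) (F (cc a)) = 1 := by
      rw [fromBlocks_multiply]
      simp only [← map_mul F, ← map_add F]
      rw [show cc a * cc a' + p * -q = 1 by linear_combination hh - hpq,
        show cc a * -p + p * cc a = 0 by ring, show q * cc a' + cc a' * -q = 0 by ring,
        show q * -p + cc a' * cc a = 1 by linear_combination hh - hpq]
      simp
    rw [hcc, hcc, hp, hq] at this
    exact IsUnit.of_mul_eq_one _ this
  have hσ : ElemRel (fromBlocks (a • 1) P Q (a' • 1))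
      (fromBlocks P ((-a) • 1) (a' • 1) (-Q)) := by
    refine (ElemRel.mul_right _ ElemMat.block_swap_mem).trans (ElemRel.of_eq ?_)
    rw [fromBlocks_multiply]; simp
  refine (hσ.pow (by simp) hu _).trans ?_
  have h1 : p * (-q) - cc (-a) * cc a' = 1 := by
    rw [map_neg]
    linear_combination hh - hpq
  have h3 : p * (cc (-g) * q) - cc (-a) ^ (n + 1) * cc (-((-a') ^ (n + 1))) = 1 := by
    rw [map_neg, map_neg, map_neg, map_pow, map_neg]
    have e1 : (-cc a) ^ (n + 1) * (-cc a') ^ (n + 1) = (cc a * cc a') ^ (n + 1) := by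
      rw [← mul_pow]; ring
    linear_combination e1 - cc g * hpq + cc g * hh + hgg'
  have := ElemRel.block_mennicke_pow hS F h1 n h3
  rw [← map_pow] at this
  simp only [map_mul, map_neg F, hcc, hp, hq] at this
  simpa [F] using this

end SkewFour

section SkewFour
variable {S : Type*} [CommRing S]

/-- The general alternating matrix of size four. -/
def skewFour (a b c a' b' c' : S) : Matrix (Fin 4) (Fin 4) S :=
  !![0, a, b, c; -a, 0, c', -b'; -b, -c', 0, a'; -c, b', -a', 0]

theorem skewFour_transpose (a b c a' b' c' : S) :
    (skewFour a b c a' b' c')ᵀ = -skewFour a b c a' b' c' := by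
  ext i j
  fin_cases i <;> fin_cases j <;> simp [skewFour]

theorem det_skewFour (a b c a' b' c' : S) :
    (skewFour a b c a' b' c').det = (a * a' + b * b' + c * c') ^ 2 := by
  rw [skewFour, det_succ_row_zero]
  simp [Fin.sum_univ_succ, det_fin_three, Fin.succAbove]
  ring

theorem exists_eq_skewFour (h2 : IsUnit (2 : S)) {φ : Matrix (Fin 4) (Fin 4) S} (h : φᵀ = -φ) :
    ∃ a b c a' b' c', φ = skewFour a b c a' b' c' := by
  obtain ⟨t, ht⟩ := h2.exists_right_inv
  have hs : ∀ i j, φ i j = -φ j i := fun i j => by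
    have := congrFun₂ h j i
    simpa using this
  have h0 : ∀ i, φ i i = 0 := fun i => by
    linear_combination t * hs i i - φ i i * ht
  refine ⟨φ 0 1, φ 0 2, φ 0 3, φ 2 3, φ 3 1, φ 1 2, ?_⟩
  ext i j
  fin_cases i <;> fin_cases j <;> simp [skewFour, h0]
  · exact hs 1 0
  · exact hs 1 3
  · exact hs 2 0
  · exact hs 2 1
  · exact hs 3 0
  · exact hs 3 2

def twoSumTwo : Fin 2 ⊕ Fin 2 ≃ Fin 4 where
  toFun := Sum.elim ![0, 1] ![2, 3]
  invFun := ![.inl 0, .inl 1, .inr 0, .inr 1]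
  left_inv := by rintro (i | i) <;> fin_cases i <;> rfl
  right_inv i := by fin_cases i <;> rfl

theorem twoSumTwo_symm_apply (i : Fin 4) :
    twoSumTwo.symm i = (![.inl 0, .inl 1, .inr 0, .inr 1] : Fin 4 → Fin 2 ⊕ Fin 2) i := rfl

theorem ElemRel.skewFour_pow (hS : StableRange S 3) {a b c a' b' c' : S}
    (h : a * a' + b * b' + c * c' = 1) (n : ℕ) :
    ∃ β : Matrix (Fin 3) (Fin 3) S, β 0 2 = a ^ (2 * (n + 1)) ∧
      ElemRel ((skewFour (-1) 0 0 (-1) 0 0 * skewFour a b c a' b' c') ^ (n + 1))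
        ((fromBlocks 1 0 0 β).submatrix (unitSumFin 3) (unitSumFin 3)) := by
  have hc : 3 ≤ Fintype.card (Fin 4) := by simp
  set e : Fin 2 ⊕ Fin 2 ≃ Fin 4 := twoSumTwo with he
  set s := skewFour (-1) 0 0 (-1) 0 0 * skewFour a b c a' b' c' with hs
  have hse : s = (fromBlocks (a • 1) !![-c', b'; b, c] !![c, -b'; -b, -c'] (a' • 1)).submatrix
      e.symm e.symm := by
    ext i j
    fin_cases i <;> fin_cases j <;>
    simp [hs, skewFour, he, twoSumTwo_symm_apply]
  have hsu : IsUnit s := by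
    rw [isUnit_iff_isUnit_det, hs, det_mul, det_skewFour, det_skewFour, h]
    simp
  set g := ∑ i ∈ Finset.range (n + 1), (a * a') ^ i with hg
  have hgg : (1 - a * a') * g = 1 - (a * a') ^ (n + 1) := mul_neg_geom_sum _ _
  have key := (ElemRel.block_skew_pow hS h n).submatrix e.symm
  have hpow : ∀ m, s ^ m = (fromBlocks (a • 1) !![-c', b'; b, c] !![c, -b'; -b, -c'] (a' • 1) ^ m).submatrix
      e.symm e.symm := by
    intro m
    induction m with
    | zero => simp
    | succ m ih => rw [pow_succ, pow_succ, ih, hse, submatrix_mul_equiv]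
  rw [← hpow] at key
  rw [← hg] at key
  set γ := (-a) ^ (n + 1) with hγ
  set γ' := (-a') ^ (n + 1) with hγ'
  have hγγ : γ * γ' + (b * b' + c * c') * g = 1 := by
    have : γ * γ' = (a * a') ^ (n + 1) := by rw [hγ, hγ', ← mul_pow]; ring
    linear_combination this + hgg + g * h
  have hτ : (fromBlocks !![-c', b'; b, c] (γ • 1) (-γ' • 1) (-g • !![c, -b'; -b, -c'])).submatrix
      e.symm e.symm = !![-c', b', γ, 0; b, c, 0, γ; -γ', 0, -g * c, g * b'; 0, -γ', g * b, g * c'] := by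
    ext i j
    fin_cases i <;> fin_cases j <;> simp [he, twoSumTwo_symm_apply]
  rw [hτ] at key
  have k1 : 1 + vecMulVec ![b' * g, c' * g, 0, γ'] ![0, 0, 1, 0] ∈ ElemMat (Fin 4) S :=
    ElemMat.vecMulVec_disjoint _ _ fun i => by fin_cases i <;> simp
  have k2 := ElemMat.signedSwap_mem (T := S) (show (0 : Fin 4) ≠ 2 by decide)
  have k3 := ElemMat.signedSwap_mem (T := S) (show (1 : Fin 4) ≠ 0 by decide)
  have hu := key.isUnit (hsu.pow _)
  have key2 := (key.trans (ElemRel.mul_left hc hu k3)).trans (ElemRel.mul_right _ (mul_mem k1 k2))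
  have hsw : ∀ i j : Fin 4, transvection i j (-1 : S) * transvection j i 1 * transvection i j (-1) =
      (1 + single i j (-1)) * (1 + single j i 1) * (1 + single i j (-1)) := fun _ _ => rfl
  have hl : transvection (1 : Fin 4) 0 (-1 : S) * transvection (0 : Fin 4) 1 (1 : S) * transvection (1 : Fin 4) 0 (-1 : S) =
      !![0, 1, 0, 0; -1, 0, 0, 0; 0, 0, 1, 0; 0, 0, 0, 1] := by
    rw [hsw]
    ext i j
    fin_cases i <;> fin_cases j <;> simp [Matrix.mul_apply, Fin.sum_univ_four, Matrix.one_apply, Matrix.single_apply]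
  have hr : transvection (0 : Fin 4) 2 (-1 : S) * transvection (2 : Fin 4) 0 (1 : S) * transvection (0 : Fin 4) 2 (-1 : S) =
      !![0, 0, -1, 0; 0, 1, 0, 0; 1, 0, 0, 0; 0, 0, 0, 1] := by
    rw [hsw]
    ext i j
    fin_cases i <;> fin_cases j <;> simp [Matrix.mul_apply, Fin.sum_univ_four, Matrix.one_apply, Matrix.single_apply]
  have hv : 1 + vecMulVec ![b' * g, c' * g, 0, γ'] ![0, 0, 1, 0] =
      !![1, 0, b' * g, 0; 0, 1, c' * g, 0; 0, 0, 1, 0; 0, 0, γ', 1] := by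
    ext i j
    fin_cases i <;> fin_cases j <;> simp
  rw [hl, hr, hv] at key2
  have h00 : ∀ α ω x y p q r t u, (!![0, 1, 0, 0; -1, 0, 0, 0; 0, 0, 1, 0; 0, 0, 0, 1] *
     !![-c', b', γ, 0; b, c, 0, γ; α, 0, x, y; 0, ω, p, q] *
     (!![1, 0, r, 0; 0, 1, t, 0; 0, 0, 1, 0; 0, 0, u, (1 : S)] *
      !![0, 0, -1, 0; 0, 1, 0, 0; 1, 0, 0, 0; 0, 0, 0, 1]) : Matrix (Fin 4) (Fin 4) S) 0 = ![b * r + c * t + γ * u, c, -b, γ] := by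
    intros
    ext j
    fin_cases j <;> simp [Matrix.mul_apply, Fin.sum_univ_four]
  have h11 : ∀ α ω x y p q r t u, (!![0, 1, 0, 0; -1, 0, 0, 0; 0, 0, 1, 0; 0, 0, 0, 1] *
     !![-c', b', γ, 0; b, c, 0, γ; α, 0, x, y; 0, ω, p, q] *
     (!![1, 0, r, 0; 0, 1, t, 0; 0, 0, 1, 0; 0, 0, u, (1 : S)] *
      !![0, 0, -1, 0; 0, 1, 0, 0; 1, 0, 0, 0; 0, 0, 0, 1]) : Matrix (Fin 4) (Fin 4) S) 1 = ![c' * r - b' * t - γ, -b', -c', 0] := by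
    intros
    ext j
    fin_cases j <;> simp [Matrix.mul_apply, Fin.sum_univ_four] <;> ring
  have key3 := key2.trans (ElemRel.one_corner (by norm_num) (key2.isUnit (hsu.pow _)) (by
    rw [h00]
    simp only [cons_val_zero]
    linear_combination hγγ))
  refine ⟨_, ?_, key3⟩
  have e1 : (Fin.succ 0 : Fin 4) = 1 := rfl
  have e2 : (Fin.succ 2 : Fin 4) = 3 := rfl
  rw [of_apply, e1, e2, h00, h11]
  have : γ * γ = a ^ (2 * (n + 1)) := by rw [hγ, ← pow_two, ← pow_mul, mul_comm, pow_mul, neg_sq, ← pow_mul]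
  simp
  linear_combination this

end SkewFour

section SkewFour
variable {S : Type*} [CommRing S]

theorem ElemRel.conj_diagonal (hS : StableRange S 3) {π : S} (hπ : π * π = 1)
    {s : Matrix (Fin 4) (Fin 4) S} (hs : IsUnit s) :
    ElemRel (diagonal ![π, 1, 1, 1] * s * diagonal ![π, 1, 1, 1]) s := by
  have hc : 3 ≤ Fintype.card (Fin 4) := by simp
  have hDD : diagonal ![π, 1, 1, 1] * diagonal ![π, 1, 1, 1] = (1 : Matrix (Fin 4) (Fin 4) S) := by
    rw [diagonal_mul_diagonal, ← diagonal_one]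
    congr 1
    ext i
    fin_cases i <;> simp [hπ]
  set D : Matrix (Fin 4) (Fin 4) S := diagonal ![π, 1, 1, 1] with hD
  have hDu : IsUnit D := IsUnit.of_mul_eq_one _ hDD
  refine ElemRel.of_fromBlocks_one_fin hc hS 1 ((hDu.mul hs).mul hDu) ?_
  have hd := ElemMat.diagonal_pair_mem (R := S)
    (show (Sum.inl 0 : Fin 4 ⊕ Fin 1) ≠ Sum.inr 0 by simp) hπ
  have hd' : diagonal (Function.update (Function.update 1 (Sum.inl 0 : Fin 4 ⊕ Fin 1) π)
      (Sum.inr 0) π) = fromBlocks D 0 0 (π • 1 : Matrix (Fin 1) (Fin 1) S) := by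
    ext (i | i) (j | j) <;> fin_cases i <;> fin_cases j <;> simp [hD]
  rw [hd'] at hd
  have hE : fromBlocks (D * s * D) 0 0 (1 : Matrix (Fin 1) (Fin 1) S) =
      fromBlocks D 0 0 (π • 1) * fromBlocks s 0 0 1 * fromBlocks D 0 0 (π • 1) := by
    simp [fromBlocks_multiply, smul_smul, hπ]
  have hsu : IsUnit (fromBlocks s 0 0 (1 : Matrix (Fin 1) (Fin 1) S)) := by
    rw [isUnit_iff_isUnit_det] at hs ⊢
    simpa using hs
  rw [hE]
  exact ((ElemRel.mul_left (by simp) hsu hd).trans (ElemRel.mul_right _ hd)).symm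

theorem skewFour_mul_self_eq_one :
    skewFour (-1 : S) 0 0 (-1) 0 0 * skewFour 1 0 0 1 0 0 = 1 := by
  ext i j
  fin_cases i <;> fin_cases j <;>
    simp [skewFour, Matrix.mul_apply, Fin.sum_univ_four]

theorem ElemRel.skewFour_pow_of_sq_eq_one (hS : StableRange S 3) {a b c a' b' c' : S}
    (h : (a * a' + b * b' + c * c') ^ 2 = 1) (n : ℕ) :
    ∃ (β : Matrix (Fin 3) (Fin 3) S) (x : S), β 0 2 = x ^ (2 * (n + 1)) ∧
      ElemRel ((skewFour (-1) 0 0 (-1) 0 0 * skewFour a b c a' b' c') ^ (n + 1))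
        ((fromBlocks 1 0 0 β).submatrix (unitSumFin 3) (unitSumFin 3)) := by
  have hc : 3 ≤ Fintype.card (Fin 4) := by simp
  obtain ⟨π, hπ⟩ : ∃ π, π = a * a' + b * b' + c * c' := ⟨_, rfl⟩
  rw [← hπ, sq] at h
  have h1 : (π * a) * a' + (π * b) * b' + (π * c) * c' = 1 := by
    linear_combination h - π * hπ
  obtain ⟨β, hβ, hr⟩ := ElemRel.skewFour_pow hS h1 n
  refine ⟨β, _, hβ, ElemRel.trans ?_ hr⟩
  have hs1 : IsUnit (skewFour (-1) 0 0 (-1) 0 0 * skewFour (π * a) (π * b) (π * c) a' b' c') := by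
    rw [isUnit_iff_isUnit_det, det_mul, det_skewFour, det_skewFour, h1]
    simp
  have hd := ElemMat.diagonal_pair_mem (R := S) (show (0 : Fin 4) ≠ 1 by simp) h
  have hd' : diagonal (Function.update (Function.update 1 (0 : Fin 4) π) 1 π) =
      diagonal ![π, π, 1, 1] := by
    congr 1
    ext i
    fin_cases i <;> simp
  rw [hd'] at hd
  have heq : skewFour (-1) 0 0 (-1) 0 0 * skewFour a b c a' b' c' = diagonal ![π, π, 1, 1] *
      (diagonal ![π, 1, 1, 1] * (skewFour (-1) 0 0 (-1) 0 0 * skewFour (π * a) (π * b) (π * c) a' b' c') *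
        diagonal ![π, 1, 1, 1]) := by
    ext i j
    fin_cases i <;> fin_cases j <;>
    simp [skewFour, Matrix.mul_apply, Fin.sum_univ_four, diagonal_apply]
    · linear_combination (-a * (π * π + 1)) * h
    · linear_combination (-c') * h
    · linear_combination (-b') * h
    · linear_combination (-a) * h
    · linear_combination (-b) * h
    · linear_combination (-c) * h
    · linear_combination (-c) * h
    · linear_combination (-b) * h
  have hD : IsUnit (diagonal ![π, 1, 1, 1] : Matrix (Fin 4) (Fin 4) S) := by
    rw [isUnit_iff_isUnit_det, det_diagonal, Fin.prod_univ_four]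
    simpa using IsUnit.of_mul_eq_one _ h
  have hu := (hD.mul hs1).mul hD
  have key : ElemRel (skewFour (-1) 0 0 (-1) 0 0 * skewFour a b c a' b' c')
      (skewFour (-1) 0 0 (-1) 0 0 * skewFour (π * a) (π * b) (π * c) a' b' c') := by
    rw [heq]
    exact (ElemRel.mul_left hc hu hd).symm.trans (ElemRel.conj_diagonal hS h hs1)
  exact ElemRel.pow hc key (key.symm.isUnit hs1) _

end SkewFour

section
variable {R : Type*} [CommRing R] {ι κ : Type} [Fintype ι] [DecidableEq ι] [Fintype κ]
  [DecidableEq κ]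

theorem skewFour_map {S : Type*} [CommRing S] (f : R →+* S) (a b c a' b' c' : R) :
    (skewFour a b c a' b' c').map f = skewFour (f a) (f b) (f c) (f a') (f b') (f c') := by
  ext i j
  fin_cases i <;> fin_cases j <;> simp [skewFour]

theorem skewFour_mul_self_eq_one' :
    skewFour (1 : R) 0 0 1 0 0 * skewFour (-1) 0 0 (-1) 0 0 = 1 :=
  mul_eq_one_comm.mp skewFour_mul_self_eq_one

theorem det_hypSum (φ : Matrix ι ι R) :
    (hypSum φ κ).det = φ.det * (fromBlocks 0 1 (-1) 0 : Matrix (κ ⊕ κ) (κ ⊕ κ) R).det := by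
  rw [hypSum, det_fromBlocks_zero₁₂]

theorem isUnit_det_hyperbolic :
    IsUnit (fromBlocks 0 1 (-1) 0 : Matrix (κ ⊕ κ) (κ ⊕ κ) R).det := by
  rw [← isUnit_iff_isUnit_det]
  refine IsUnit.of_mul_eq_one (fromBlocks 0 (-1) 1 0) ?_
  simp [fromBlocks_multiply]

open Polynomial in
theorem exists_selfAdjoint_root_hypSum {m : ℕ} (hm : IsUnit (m : R)) (h2 : IsUnit (2 : R))
    {ψ : Matrix (Fin 4) (Fin 4) R[X]} (hψ : ψᵀ = -ψ) (hdet : ψ.det = 1)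
    (h0 : ψ.map (evalRingHom 0) = skewFour 1 0 0 1 0 0) :
    ∃ (κ : Type) (_ : Fintype κ) (_ : DecidableEq κ) (h : Matrix (Fin 4 ⊕ κ ⊕ κ) (Fin 4 ⊕ κ ⊕ κ) R[X]),
      h.det = 1 ∧ hᵀ * hypSum (skewFour 1 0 0 1 0 0) κ = hypSum (skewFour 1 0 0 1 0 0) κ * h ∧
      ElemCongr (hypSum ψ κ) (hypSum (skewFour 1 0 0 1 0 0) κ * h ^ m) := by
  obtain ⟨κ, _, _, K, hK⟩ := exists_elemCongr_linear h2
    (Finset.univ.sup fun i => Finset.univ.sup fun j => (ψ i j).natDegree) (Fin 4) ψ hψ (fun i j => by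
      have h1 := Finset.le_sup (f := fun j => (ψ i j).natDegree) (Finset.mem_univ j)
      have h2 := Finset.le_sup (f := fun i => Finset.univ.sup fun j => (ψ i j).natDegree) (Finset.mem_univ i)
      exact (h1.trans h2).trans (Nat.le_succ _))
  rw [h0] at hK
  have hJmap : (hypSum (skewFour (1 : R) 0 0 1 0 0) κ).map C = hypSum (skewFour (1 : R[X]) 0 0 1 0 0) κ := by
    rw [hypSum_map, skewFour_map]
    simp
  have hJskew : (hypSum (skewFour (1 : R) 0 0 1 0 0) κ)ᵀ = -hypSum (skewFour (1 : R) 0 0 1 0 0) κ :=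
    hypSum_skew (skewFour_transpose _ _ _ _ _ _)
  have hJi := hypSum_mul (κ := κ) (skewFour_mul_self_eq_one' (R := R))
  set J := hypSum (skewFour (1 : R) 0 0 1 0 0) κ with hJ
  set Ji := fromBlocks (skewFour (-1 : R) 0 0 (-1) 0 0) 0 0
    (fromBlocks 0 (-1) 1 0 : Matrix (κ ⊕ κ) (κ ⊕ κ) R) with hJidef
  have hKs : Kᵀ = -K := by
    obtain ⟨g, -, hg⟩ := hK
    have := skew_congr (hypSum_skew (κ := κ) hψ) g
    rw [← hg] at this
    ext i j
    have hij := congrArg (fun p => Polynomial.coeff p 1) (congrFun₂ this i j)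
    simpa [coeff_C] using hij
  have hdet' : (1 + (X : R[X]) • (Ji * K).map C).det = 1 := by
    have hJiJ : Ji.map (C : R →+* R[X]) * J.map C = 1 := by
      rw [← Matrix.map_mul, mul_eq_one_comm.mp hJi]
      simp
    have e1 : 1 + (X : R[X]) • (Ji * K).map C = Ji.map C * (J.map C + (X : R[X]) • K.map C) := by
      rw [mul_add, hJiJ, mul_smul_comm, ← Matrix.map_mul]
    obtain ⟨g, hgE, hg⟩ := hK
    have hgd := ElemMat.det_eq_one hgE
    have e2 : (hypSum ψ κ).det = (J.map (C : R →+* R[X])).det := by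
      rw [hJmap, det_hypSum, det_hypSum, hdet, det_skewFour]
      norm_num
    rw [e1, hg, det_mul, det_mul, det_mul, det_transpose, hgd, one_mul, mul_one, e2, ← det_mul, hJiJ,
      det_one]
  obtain ⟨h, hd, hh, hpow⟩ := exists_selfAdjoint_root hJskew hJi hKs hm hdet'
  rw [hJmap] at hh hpow hK
  exact ⟨κ, _, _, h, hd, hh, hpow ▸ hK⟩

theorem ElemRel.of_elemCongr_mul {J Ji H φ : Matrix ι ι R} (hι : 3 ≤ Fintype.card ι) (hJ : Ji * J = 1)
    (hH : IsUnit H) (h : ElemCongr (J * H) φ) : ElemRel H (Ji * φ) := by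
  obtain ⟨g, hg, rfl⟩ := h
  have h1 := ElemMat.conj_mem hι hJ (ElemMat.transpose_mem hg)
  have : Ji * (gᵀ * (J * H) * g) = Ji * gᵀ * J * H * g := by simp only [Matrix.mul_assoc]
  rw [this]
  exact (ElemRel.mul_left hι hH h1).trans (ElemRel.mul_right _ hg)

theorem exists_elemCongr_skewFour_pow (h2 : IsUnit (2 : R)) (hS : StableRange R 3) (n : ℕ)
    {h : Matrix (Fin 4 ⊕ κ ⊕ κ) (Fin 4 ⊕ κ ⊕ κ) R} (hd : h.det = 1)
    (hh : hᵀ * hypSum (skewFour 1 0 0 1 0 0) κ = hypSum (skewFour 1 0 0 1 0 0) κ * h) :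
    ∃ (β : Matrix (Fin 3) (Fin 3) R) (x : R), β 0 2 = x ^ (2 * (n + 1)) ∧
      ElemCongr (hypSum (skewFour 1 0 0 1 0 0) κ * h ^ (2 * (n + 1)))
        (hypSum (((fromBlocks 1 0 0 β).submatrix (unitSumFin 3) (unitSumFin 3))ᵀ *
          skewFour 1 0 0 1 0 0 * (fromBlocks 1 0 0 β).submatrix (unitSumFin 3) (unitSumFin 3)) κ) := by
  have hc : 3 ≤ Fintype.card (Fin 4 ⊕ κ ⊕ κ) := by simp; omega
  have hJskew : (hypSum (skewFour (1 : R) 0 0 1 0 0) κ)ᵀ = -hypSum (skewFour (1 : R) 0 0 1 0 0) κ :=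
    hypSum_skew (skewFour_transpose _ _ _ _ _ _)
  have hJi := hypSum_mul (κ := κ) (skewFour_mul_self_eq_one' (R := R))
  have hhu : IsUnit h := by rw [isUnit_iff_isUnit_det, hd]; exact isUnit_one
  set J := hypSum (skewFour (1 : R) 0 0 1 0 0) κ with hJ
  have hJu : IsUnit J := IsUnit.of_mul_eq_one _ hJi
  have hs : (J * h)ᵀ = -(J * h) := by
    rw [transpose_mul, hJskew, mul_neg, hh]
  obtain ⟨φ, hφ, hcong⟩ := exists_elemCongr_hypSum h2 (by simpa using hS.mono (by norm_num : 3 ≤ 4)) κ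
    (J * h) hs (hJu.mul hhu)
  obtain ⟨a, b, c, a', b', c', rfl⟩ := exists_eq_skewFour h2 hφ
  have hPf : (a * a' + b * b' + c * c') ^ 2 = 1 := by
    obtain ⟨g, hgE, hg⟩ := hcong
    have hgd := ElemMat.det_eq_one hgE
    have := congrArg det hg
    rw [det_mul, det_mul, det_mul, det_transpose, hgd, one_mul, mul_one, hd, mul_one, hJ, det_hypSum,
      det_hypSum] at this
    have := (isUnit_det_hyperbolic (R := R) (κ := κ)).mul_right_cancel this
    rw [← det_skewFour, this, det_skewFour]
    norm_num
  obtain ⟨β, x, hx, hr⟩ := ElemRel.skewFour_pow_of_sq_eq_one hS hPf n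
  refine ⟨β, x, hx, ?_⟩
  have k1 := ElemRel.of_elemCongr_mul hc (mul_eq_one_comm.mp hJi) hhu hcong
  have k2 : fromBlocks (skewFour (-1 : R) 0 0 (-1) 0 0) 0 0
    (fromBlocks 0 (-1) 1 0 : Matrix (κ ⊕ κ) (κ ⊕ κ) R) * hypSum (skewFour a b c a' b' c') κ =
      fromBlocks (skewFour (-1 : R) 0 0 (-1) 0 0 * skewFour a b c a' b' c') 0 0 1 := by
    simp [hypSum, fromBlocks_multiply]
  rw [k2] at k1
  have k3 := ElemRel.pow hc k1 hhu (n + 1)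
  have hp : ∀ (M : Matrix (Fin 4) (Fin 4) R) (i : ℕ), fromBlocks M 0 0 (1 : Matrix (κ ⊕ κ) (κ ⊕ κ) R) ^ i = fromBlocks (M ^ i) 0 0 1 := by
    intro M i
    induction i with
    | zero => simp
    | succ i ih => rw [pow_succ, ih, fromBlocks_multiply]; simp [pow_succ]
  rw [hp] at k3
  have k4 := k3.trans hr.fromBlocks_one
  obtain ⟨e, he, hE⟩ := k4
  set Γ := (fromBlocks 1 0 0 β).submatrix (unitSumFin 3) (unitSumFin 3) with hΓ
  refine ⟨e, he, ?_⟩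
  have e1 : hypSum (Γᵀ * skewFour 1 0 0 1 0 0 * Γ) κ = (fromBlocks Γ 0 0 1)ᵀ * J * fromBlocks Γ 0 0 1 := by
    simp [hJ, hypSum, fromBlocks_multiply, fromBlocks_transpose]
  have e2 : ∀ i : ℕ, (h ^ i)ᵀ * J = J * h ^ i := by
    intro i
    induction i with
    | zero => simp
    | succ i ih => rw [pow_succ, transpose_mul, Matrix.mul_assoc, ih, ← Matrix.mul_assoc, hh, Matrix.mul_assoc, ← pow_succ', pow_succ]
  rw [e1, hE, transpose_mul, Matrix.mul_assoc, Matrix.mul_assoc, ← Matrix.mul_assoc _ _ (h ^ _ * e), e2, two_mul, pow_add _ (n + 1)]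
  simp only [Matrix.mul_assoc]

open Polynomial in
theorem exists_elemCongr_map_skewFour {S : Type*} [CommRing S] (f : R[X] →+* S) (hS : StableRange S 3)
    {n : ℕ} (hn : IsUnit ((2 * (n + 1) : ℕ) : R)) {ψ : Matrix (Fin 4) (Fin 4) R[X]} (hψ : ψᵀ = -ψ)
    (hdet : ψ.det = 1) (h0 : ψ.map (evalRingHom 0) = skewFour 1 0 0 1 0 0) :
    ∃ (β : Matrix (Fin 3) (Fin 3) S) (x : S), β 0 2 = x ^ (2 * (n + 1)) ∧
      ElemCongr (ψ.map f) (((fromBlocks 1 0 0 β).submatrix (unitSumFin 3) (unitSumFin 3))ᵀ *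
          skewFour 1 0 0 1 0 0 * (fromBlocks 1 0 0 β).submatrix (unitSumFin 3) (unitSumFin 3)) := by
  have h2 : IsUnit (2 : R) := isUnit_of_dvd_unit ⟨((n + 1 : ℕ) : R), by push_cast; ring⟩ hn
  have h2' : IsUnit (2 : S) := by
    have := h2.map (f.comp C)
    rwa [map_ofNat] at this
  obtain ⟨κ, _, _, h, hd, hh, hc⟩ := exists_selfAdjoint_root_hypSum hn h2 hψ hdet h0
  have hJ : (hypSum (skewFour (1 : R[X]) 0 0 1 0 0) κ).map f = hypSum (skewFour 1 0 0 1 0 0) κ := by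
    rw [hypSum_map, skewFour_map]
    simp
  have hd' : (h.map f).det = 1 := by
    rw [← RingHom.mapMatrix_apply, ← RingHom.map_det, hd, map_one]
  have hh' := congrArg (fun M => M.map f) hh
  simp only [Matrix.map_mul, transpose_map, hJ] at hh'
  have hc' := hc.map f
  rw [hypSum_map, Matrix.map_mul, hJ] at hc'
  obtain ⟨β, x, hx, hr⟩ := exists_elemCongr_skewFour_pow h2' hS n hd' hh'
  refine ⟨β, x, hx, ?_⟩
  have hp : (h ^ (2 * (n + 1))).map f = h.map f ^ (2 * (n + 1)) := map_pow f.mapMatrix h _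
  rw [hp] at hc'
  have hψ' : (ψ.map f)ᵀ = -(ψ.map f) := by
    rw [← transpose_map, hψ]
    ext; simp
  have hψu : IsUnit (ψ.map f) := by
    rw [isUnit_iff_isUnit_det, ← RingHom.mapMatrix_apply, ← RingHom.map_det, hdet, map_one]
    exact isUnit_one
  exact elemCongr_of_hypSum h2' (by simp) (by simpa using hS) hψ' hψu κ (hc'.trans hr)

end

section
variable {R : Type*} [CommRing R]

theorem Unimod.rowEquiv_single_of_isLocalRing [IsLocalRing R] {ι : Type*} [Fintype ι] [DecidableEq ι]
    [Nontrivial ι] {v : ι → R} (hv : Unimod v) (k : ι) : RowEquiv v (Pi.single k 1) := by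
  obtain ⟨i, hi⟩ := hv.exists_notMem (IsLocalRing.maximalIdeal.isMaximal R).ne_top
  obtain ⟨j, hj⟩ := exists_ne i
  rw [IsLocalRing.notMem_maximalIdeal] at hi
  exact (RowEquiv.single_of_isUnit hi hj.symm).trans (RowEquiv.single_single _ _)

theorem rowEquiv_of_elemCongr_skewFour (h2 : IsUnit (2 : R)) {u u' : Fin 3 → R} (hu : u ⬝ᵥ u' = 1)
    {β : Matrix (Fin 3) (Fin 3) R}
    (h : ElemCongr (skewFour (u 0) (u 1) (u 2) (u' 0) (u' 1) (u' 2))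
      (((fromBlocks 1 0 0 β).submatrix (unitSumFin 3) (unitSumFin 3))ᵀ *
          skewFour 1 0 0 1 0 0 * (fromBlocks 1 0 0 β).submatrix (unitSumFin 3) (unitSumFin 3))) :
    RowEquiv u (β 0) := by
  obtain ⟨ε, hε, he⟩ := h.submatrix (unitSumFin 3).symm
  have hφ : ((skewFour (u 0) (u 1) (u 2) (u' 0) (u' 1) (u' 2)).submatrix (unitSumFin 3).symm
      (unitSumFin 3).symm)ᵀ = -((skewFour (u 0) (u 1) (u 2) (u' 0) (u' 1) (u' 2)).submatrix
        (unitSumFin 3).symm (unitSumFin 3).symm) := by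
    rw [transpose_submatrix, skewFour_transpose]
    rfl
  have hu' : IsUnit ((skewFour (u 0) (u 1) (u 2) (u' 0) (u' 1) (u' 2)).submatrix (unitSumFin 3).symm
      (unitSumFin 3).symm) := by
    rw [isUnit_iff_isUnit_det, det_submatrix_equiv_self, det_skewFour]
    have : u 0 * u' 0 + u 1 * u' 1 + u 2 * u' 2 = 1 := by
      rw [← hu, dotProduct, Fin.sum_univ_three]
    rw [this]
    simp
  obtain ⟨g, hg, hgg⟩ := exists_congr_one_fromBlocks h2 (by simp) hε _ hφ hu'
  refine ⟨g, hg, ?_⟩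
  rw [← he] at hgg
  ext j
  have := congrFun₂ hgg (Sum.inl ()) (Sum.inr j)
  have hs : ∀ i : Fin 3, (unitSumFin 3).symm (Sum.inr i) = i.succ := fun _ => rfl
  have hs' : ∀ i : Unit, (unitSumFin 3).symm (Sum.inl i) = 0 := fun _ => rfl
  rw [← submatrix_mul_equiv _ _ _ (unitSumFin 3).symm, ← submatrix_mul_equiv _ _ _ (unitSumFin 3).symm,
    transpose_submatrix, submatrix_submatrix] at this
  simp [Matrix.mul_apply, Fin.sum_univ_three, hs, hs', skewFour] at this
  simp [vecMul, dotProduct, Fin.sum_univ_three]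
  rw [this]

open Polynomial in
theorem exists_rowEquiv_pow_three [IsLocalRing R] {S : Type*} [CommRing S] (f : R[X] →+* S)
    (hS : StableRange S 3) {n : ℕ} (hn : IsUnit ((2 * (n + 1) : ℕ) : R)) {u : Fin 3 → R[X]}
    (hu : Unimod u) :
    ∃ w, RowEquiv (f ∘ u) w ∧ ∃ x, w 2 = x ^ (2 * (n + 1)) := by
  have h2 : IsUnit (2 : R) := isUnit_of_dvd_unit ⟨((n + 1 : ℕ) : R), by push_cast; ring⟩ hn
  have h2' : IsUnit (2 : S) := by
    have := h2.map (f.comp C)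
    rwa [map_ofNat] at this
  obtain ⟨g, hg, hg0⟩ : RowEquiv (evalRingHom 0 ∘ u) (Pi.single 0 1) := by
    exact (hu.map _).rowEquiv_single_of_isLocalRing 0
  set v := u ᵥ* g.map C with hv
  have huv : RowEquiv u v := ⟨_, ElemMat.map_mem C hg, rfl⟩
  have hv0 : ∀ i, (v i).eval 0 = (Pi.single 0 1 : Fin 3 → R) i := by
    intro i
    rw [← hg0]
    simp [hv, vecMul, dotProduct, eval_finsetSum]
  obtain ⟨w, hw⟩ := hu.of_rowEquiv huv
  have hw0 : (w 0).eval 0 = 1 := by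
    have := congrArg (eval 0) hw
    simpa [dotProduct, Fin.sum_univ_three, hv0] using this
  set p := C ((w 1).eval 0) with hp
  set q := C ((w 2).eval 0) with hq
  set w' : Fin 3 → R[X] := ![w 0 + p * v 1 + q * v 2, w 1 - p * v 0, w 2 - q * v 0] with hw'
  have hvw : v ⬝ᵥ w' = 1 := by
    rw [← hw]
    simp [dotProduct, Fin.sum_univ_three, hw']
    ring
  obtain ⟨β, x, hx, hc⟩ := exists_elemCongr_map_skewFour f hS hn
    (skewFour_transpose (v 0) (v 1) (v 2) (w' 0) (w' 1) (w' 2)) (by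
      have : v 0 * w' 0 + v 1 * w' 1 + v 2 * w' 2 = 1 := by
        rw [← hvw, dotProduct, Fin.sum_univ_three]
      rw [det_skewFour, this, one_pow]) (by
      rw [skewFour_map]
      simp [hv0, hw', hw0, hp, hq])
  rw [skewFour_map] at hc
  have key := rowEquiv_of_elemCongr_skewFour (u := f ∘ v) (u' := f ∘ w') h2' (by
    rw [← map_one f, ← hvw, RingHom.map_dotProduct]) hc
  exact ⟨_, (huv.map f).trans key, x, hx⟩

end

section

theorem RowEquiv.pow_prod {ι R : Type*} [Fintype ι] [DecidableEq ι] [CommRing R]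
    (hι : 3 ≤ Fintype.card ι) (h2 : IsUnit (2 : R)) {z : ι → R} (hz : Unimod z) (i : ι) (e : ι → ℕ)
    (s : Finset ι) (hi : i ∉ s) (N : ℕ) :
    RowEquiv (Function.update z i (z i ^ ((∏ j ∈ s, e j) * N)))
      (fun j => if j = i then z i ^ N else if j ∈ s then z j ^ e j else z j) := by
  induction s using Finset.induction_on generalizing N with
  | empty =>
    have : Function.update z i (z i ^ ((∏ j ∈ ∅, e j) * N)) =
        fun j => if j = i then z i ^ N else if j ∈ (∅ : Finset ι) then z j ^ e j else z j := by
      ext j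
      by_cases hj : j = i
      · subst hj; simp
      · simp [hj]
    rw [this]
    exact RowEquiv.refl _
  | insert a s ha ih =>
    rw [Finset.mem_insert, not_or] at hi
    have h1 := ih hi.2 (e a * N)
    set v : ι → R := fun j => if j = i then z i ^ N else if j ∈ s then z j ^ e j else z j with hv
    have hvu : Unimod v := unimod_of_forall_prime fun p hp => by
      obtain ⟨j, hj⟩ := hz.exists_notMem hp.ne_top
      refine ⟨j, fun h => hj ?_⟩
      simp only [hv] at h
      split_ifs at h with h3 h4
      · subst h3; exact hp.mem_of_pow_mem _ h
      · exact hp.mem_of_pow_mem _ h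
      · exact h
    have h3 := RowEquiv.shift_pow hι h2 hvu hi.1 (e a)
    rw [Finset.prod_insert ha, mul_comm (e a), mul_assoc]
    convert h1.trans ?_ using 1
    convert h3 using 1
    · ext j
      by_cases hj : j = i
      · subst hj; simp [hv, ← pow_mul, mul_comm]
      · simp [hv, hj]
    · ext j
      by_cases hj : j = a
      · subst hj; simp [hv, Ne.symm hi.1, ha]
      · simp [hv, hj]

variable {A : Type*} [CommRing A]

open Polynomial in
theorem exists_rowEquiv_monicLoc_pow [IsNoetherianRing A] [IsLocalRing A] {n : ℕ}
    (hn : IsUnit ((2 * (n + 1) : ℕ) : A)) (d : ℕ) (h : HeightLE A (d + 2)) {ι : Type} [Fintype ι]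
    [DecidableEq ι] (hι : Fintype.card ι = d + 3) {v : ι → A[X]} (hv : Unimod v) :
    ∃ w, RowEquiv (algebraMap A[X] (MonicLoc A) ∘ v) w ∧ ∃ i x, w i = x ^ (2 * (n + 1)) := by
  induction d generalizing A ι with
  | zero =>
    have e : Fin 3 ≃ ι := (Fintype.equivFinOfCardEq hι).symm
    obtain ⟨w, hw, x, hx⟩ := exists_rowEquiv_pow_three (algebraMap A[X] (MonicLoc A))
      (StableRange.of_heightLE h.monicLoc) hn (hv.comp_equiv e)
    refine ⟨w ∘ e.symm, RowEquiv.of_comp_equiv e ?_, e 2, x, by simpa using hx⟩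
    rw [Function.comp_assoc w, e.symm_comp_self]
    exact hw
  | succ d ih =>
    obtain ⟨w, hvw, i, c, hc, hmin⟩ := exists_rowEquiv_C h (by omega) (by omega) hv
    have hw := hv.of_rowEquiv hvw
    have hvw' := hvw.map (algebraMap A[X] (MonicLoc A))
    have : Nontrivial ι := Fintype.one_lt_card_iff_nontrivial.mp (by omega)
    by_cases hcu : IsUnit c
    · obtain ⟨j, hj⟩ := exists_ne i
      refine ⟨Pi.single j 1, hvw'.trans (RowEquiv.single_of_isUnit (i := i) ?_ hj.symm), j, 1, by simp⟩
      simp only [Function.comp, hc]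
      exact (hcu.map C).map _
    · have : Nontrivial (A ⧸ Ideal.span {c}) :=
        Ideal.Quotient.nontrivial_iff.mpr (by rwa [Ne, Ideal.span_singleton_eq_top])
      have : IsLocalRing (A ⧸ Ideal.span {c}) :=
        IsLocalRing.of_surjective' (Ideal.Quotient.mk _) Ideal.Quotient.mk_surjective
      have hn' : IsUnit ((2 * (n + 1) : ℕ) : A ⧸ Ideal.span {c}) := by
        have := hn.map (Ideal.Quotient.mk (Ideal.span {c}))
        rwa [map_natCast] at this
      set f := Ideal.Quotient.mk (Ideal.span {c}) with hf
      have hfs : Function.Surjective f := Ideal.Quotient.mk_surjective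
      have hfc : f c = 0 := Ideal.Quotient.eq_zero_iff_mem.mpr (Ideal.mem_span_singleton_self c)
      let ι' := {j // j ≠ i}
      have hι' : Fintype.card ι' = d + 3 := by
        rw [Fintype.card_subtype_compl, Fintype.card_subtype_eq]; omega
      have hw' : Unimod (mapRingHom f ∘ w ∘ (Subtype.val : ι' → ι)) :=
        unimod_of_forall_prime fun p hp => by
          obtain ⟨j, hj⟩ := (hw.map (mapRingHom f)).exists_notMem hp.ne_top
          by_cases hji : j = i
          · subst hji
            simp [hc, hfc] at hj
          · exact ⟨⟨j, hji⟩, hj⟩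
      obtain ⟨z, hz, j, x, hx⟩ := ih hn' (h.quotient hmin) hι' hw'
      have he : algebraMap _ (MonicLoc (A ⧸ Ideal.span {c})) ∘ mapRingHom f ∘ w ∘ (Subtype.val : ι' → ι) =
          MonicLoc.map f ∘ (algebraMap A[X] (MonicLoc A) ∘ w ∘ (Subtype.val : ι' → ι)) := by
        ext k
        simp [MonicLoc.map_algebraMap]
      rw [he] at hz
      obtain ⟨z', hz', rfl⟩ := hz.exists_lift (MonicLoc.map_surjective hfs)
      obtain ⟨x', rfl⟩ := MonicLoc.map_surjective hfs x
      have hker : RingHom.ker f = Ideal.span {c} := Ideal.mk_ker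
      obtain ⟨y, hy⟩ := MonicLoc.exists_of_map_eq_zero hfs hker
        (x := x' ^ (2 * (n + 1)) - z' j) (by rw [map_sub, map_pow, ← hx]; simp)
      have h1 := hz'.sumElim (fun _ : {k // ¬ k ≠ i} => algebraMap A[X] (MonicLoc A) (C c))
      let e : {k // k ≠ i} ⊕ {k // ¬ k ≠ i} ≃ ι := Equiv.sumCompl (· ≠ i)
      have h2 : RowEquiv (algebraMap A[X] (MonicLoc A) ∘ w)
          ((Sum.elim z' fun _ => algebraMap A[X] (MonicLoc A) (C c)) ∘ e.symm) := by
        refine RowEquiv.of_comp_equiv e ?_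
        convert h1 using 1
        · ext (k | k)
          · simp [e]
          · have : k.1 = i := not_not.mp k.2
            simp [e, this, hc]
        · ext; simp
      refine ⟨_, (hvw'.trans h2).trans (RowEquiv.update_add (i := i) (j := j.1) _ j.2.symm y), j.1, x', ?_⟩
      have e1 : e.symm i = Sum.inr ⟨i, by simp⟩ := by simp [e]
      have e2 : e.symm j.1 = Sum.inl j := by
        rw [Equiv.symm_apply_eq]; rfl
      simp only [Function.update_self, Function.comp, e1, e2, Sum.elim_inl, Sum.elim_inr]
      linear_combination -hy

open Polynomial in
theorem completable_monicLoc [IsNoetherianRing A] [IsLocalRing A] {d : ℕ} (h : HeightLE A d)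
    (hd : 2 ≤ d) (hf : IsUnit ((d.factorial : ℕ) : A)) {v : Fin (d + 1) → A[X]} (hv : Unimod v) :
    Completable (algebraMap A[X] (MonicLoc A) ∘ v) := by
  obtain ⟨d, rfl⟩ := Nat.exists_eq_add_of_le' hd
  obtain ⟨m, hm⟩ : 2 ∣ (d + 2).factorial := Nat.dvd_factorial (by norm_num) hd
  have hm0 : m ≠ 0 := fun h => by
    have := (d + 2).factorial_ne_zero
    simp [h] at hm; exact this hm
  obtain ⟨n, rfl⟩ := Nat.exists_eq_succ_of_ne_zero hm0
  rw [hm] at hf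
  obtain ⟨w, hw, i, x, hx⟩ := exists_rowEquiv_monicLoc_pow hf d h (by simp) hv
  have h2 : IsUnit (2 : MonicLoc A) := by
    have h2 : IsUnit (2 : A) := isUnit_of_dvd_unit ⟨((n + 1 : ℕ) : A), by push_cast; ring⟩ hf
    have := h2.map (((algebraMap A[X] (MonicLoc A))).comp C)
    rwa [map_ofNat] at this
  have hwu := (hv.map (algebraMap A[X] (MonicLoc A))).of_rowEquiv hw
  set z := Function.update w i x with hz
  have hzu : Unimod z := unimod_of_forall_prime fun p hp => by
    obtain ⟨j, hj⟩ := hwu.exists_notMem hp.ne_top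
    refine ⟨j, fun h => hj ?_⟩
    by_cases hji : j = i
    · subst hji
      rw [hx]
      simp [hz] at h
      exact Ideal.pow_mem_of_mem _ h _ (by omega)
    · simpa [hz, hji] using h
  have hwz : w = Function.update z i (z i ^ (2 * (n + 1))) := by
    ext j
    by_cases hji : j = i
    · subst hji; simp [hz, hx]
    · simp [hz, hji]
  have h0 : RowEquiv w (Function.update z 0 (z 0 ^ (2 * (n + 1)))) := by
    rw [hwz]
    by_cases hi : i = 0
    · subst hi; exact RowEquiv.refl _
    · exact RowEquiv.shift_pow (by simp) h2 hzu hi _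
  have hprod : (∏ j ∈ Finset.univ.erase (0 : Fin (d + 2 + 1)), max 1 (j : ℕ)) * 1 = 2 * (n + 1) := by
    have : ∏ j : Fin (d + 2 + 1), max 1 (j : ℕ) = (d + 2).factorial := by
      rw [Fin.prod_univ_succ]
      simp only [Fin.val_zero, Fin.val_succ]
      rw [← Finset.prod_range_add_one_eq_factorial, Finset.prod_range]
      simp
    rw [← Finset.mul_prod_erase _ _ (Finset.mem_univ 0), hm] at this
    simpa using this
  have h1 := RowEquiv.pow_prod (by simp) h2 hzu 0 (fun j => max 1 (j : ℕ)) (Finset.univ.erase 0) (by simp) 1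
  rw [hprod] at h1
  have h3 := Completable.pow_max hzu
  refine h3.of_rowEquiv (RowEquiv.symm ((hw.trans h0).trans ?_))
  convert h1 using 1
  ext j
  by_cases hj : j = 0
  · subst hj; simp
  · simp [hj]

end

section HorrocksPatching

open Polynomial

variable {D : Type*} [CommRing D]

/-- The fractions `a / f` with `f` monic and `deg a < deg f`. -/
def properPart (D : Type*) [CommRing D] [Nontrivial D] : Submodule D (MonicLoc D) where
  carrier := {x | ∃ f a : D[X], f.Monic ∧ a.degree < f.degree ∧
    algebraMap D[X] (MonicLoc D) f * x = algebraMap _ _ a}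
  zero_mem' := ⟨1, 0, monic_one, by simp, by simp⟩
  add_mem' := by
    rintro x y ⟨f, a, hf, ha, hx⟩ ⟨h, b, hh, hb, hy⟩
    refine ⟨f * h, a * h + b * f, hf.mul hh, ?_, ?_⟩
    · refine (degree_add_le _ _).trans_lt (max_lt ?_ ?_)
      · rw [hh.degree_mul, hh.degree_mul]
        exact WithBot.add_lt_add_right (by simpa using hh.ne_zero) ha
      · rw [hf.degree_mul, mul_comm f h, hf.degree_mul]
        exact WithBot.add_lt_add_right (by simpa using hf.ne_zero) hb
    · rw [map_mul, map_add, map_mul, map_mul, ← hx, ← hy]; ring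
  smul_mem' := by
    rintro c x ⟨f, a, hf, ha, hx⟩
    refine ⟨f, C c * a, hf, ?_, ?_⟩
    · rw [← smul_eq_C_mul]
      exact (degree_smul_le c a).trans_lt ha
    · rw [mul_smul_comm, hx, ← smul_eq_C_mul, Algebra.algebraMap_eq_smul_one,
        Algebra.algebraMap_eq_smul_one, smul_assoc]

variable [Nontrivial D]

theorem mul_mem_properPart {x y : MonicLoc D} (hx : x ∈ properPart D) (hy : y ∈ properPart D) :
    x * y ∈ properPart D := by
  obtain ⟨f, a, hf, ha, hx⟩ := hx
  obtain ⟨h, b, hh, hb, hy⟩ := hy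
  refine ⟨f * h, a * b, hf.mul hh, ?_, ?_⟩
  · rw [hh.degree_mul]
    refine (degree_mul_le _ _).trans_lt ?_
    exact (add_le_add le_rfl hb.le).trans_lt
      (WithBot.add_lt_add_right (by simpa using hh.ne_zero) ha)
  · rw [map_mul, map_mul, ← hx, ← hy]; ring

theorem monicLoc_injective : Function.Injective (algebraMap D[X] (MonicLoc D)) :=
  IsLocalization.injective (M := monics D) _ fun _ hf => Monic.mem_nonZeroDivisors hf

theorem eq_zero_of_mem_properPart {p : D[X]} (hp : algebraMap _ (MonicLoc D) p ∈ properPart D) :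
    p = 0 := by
  obtain ⟨f, a, hf, ha, hx⟩ := hp
  rw [← map_mul] at hx
  have := monicLoc_injective hx
  rw [← this, mul_comm, hf.degree_mul] at ha
  by_contra h0
  have h1 : (0 : WithBot ℕ) ≤ p.degree := zero_le_degree_iff.mpr h0
  exact absurd ha (not_lt.mpr (by simpa using add_le_add_left h1 f.degree))

theorem exists_add_properPart (x : MonicLoc D) :
    ∃ p : D[X], ∃ y ∈ properPart D, x = algebraMap _ _ p + y := by
  obtain ⟨⟨a, f, hf⟩, rfl⟩ := IsLocalization.mk'_surjective (monics D) x
  have hf' : f.Monic := hf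
  refine ⟨a /ₘ f, IsLocalization.mk' _ (a %ₘ f) (⟨f, hf⟩ : monics D),
    ⟨f, a %ₘ f, hf', degree_modByMonic_lt _ hf', IsLocalization.mk'_spec' _ _ (⟨f, hf⟩ : monics D)⟩, ?_⟩
  rw [IsLocalization.mk'_eq_iff_eq_mul, add_mul, IsLocalization.mk'_spec, ← map_mul, ← map_add]
  congr 1
  conv_lhs => rw [← modByMonic_add_div a f]
  simp only; ring

/-- The inverse of the variable. -/
noncomputable def invVar (D : Type*) [CommRing D] : MonicLoc D :=
  IsLocalization.mk' _ 1 (⟨X, monic_X⟩ : monics D)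

theorem X_mul_invVar : algebraMap D[X] (MonicLoc D) X * invVar D = 1 := by
  have := IsLocalization.mk'_spec' (MonicLoc D) (1 : D[X]) (⟨X, monic_X⟩ : monics D)
  rw [map_one] at this
  exact this

theorem exists_invVar_of_mem_properPart {x : MonicLoc D} (hx : x ∈ properPart D) :
    ∃ c : D, ∃ y ∈ properPart D, x = c • invVar D + invVar D * y := by
  obtain ⟨f, a, hf, ha, hx⟩ := hx
  have key : ∃ c : D, (X * a - C c * f).degree < f.degree := by
    rcases Nat.eq_zero_or_pos f.natDegree with h0 | h0
    · refine ⟨0, ?_⟩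
      have : a = 0 := by
        rw [hf.natDegree_eq_zero.mp h0] at ha
        simpa [degree_lt_iff_coeff_zero, Polynomial.ext_iff] using ha
      simp [this, hf.ne_zero, bot_lt_iff_ne_bot]
    · refine ⟨a.coeff (f.natDegree - 1), ?_⟩
      rw [degree_eq_natDegree hf.ne_zero, degree_lt_iff_coeff_zero] at ha ⊢
      intro m hm
      obtain ⟨k, rfl⟩ : ∃ k, m = k + 1 := ⟨m - 1, by omega⟩
      rw [coeff_sub, coeff_X_mul, coeff_C_mul]
      rcases hm.eq_or_lt with h1 | h1
      · have : k = f.natDegree - 1 := by omega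
        have h2 : f.coeff (k + 1) = 1 := by rw [← h1]; exact hf.coeff_natDegree
        rw [h2, this]; simp
      · rw [coeff_eq_zero_of_natDegree_lt h1, ha k (by omega)]; simp
  obtain ⟨c, hc⟩ := key
  refine ⟨c, algebraMap D[X] _ X * x - algebraMap D[X] _ (C c), ⟨f, _, hf, hc, ?_⟩, ?_⟩
  · rw [map_sub, map_mul, map_mul, ← hx]; ring
  · have h1 : c • invVar D = algebraMap D[X] _ (C c) * invVar D := by
      rw [Algebra.smul_def]; rfl
    rw [h1]
    linear_combination -x * X_mul_invVar (D := D)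

theorem exists_invVar_pow_of_mem_properPart (n : ℕ) {x : MonicLoc D} (hx : x ∈ properPart D) :
    ∃ s ∈ Submodule.span D (Set.range fun i : Fin n => invVar D ^ (i.1 + 1)),
      ∃ y ∈ properPart D, x = s + invVar D ^ n * y := by
  induction n with
  | zero => exact ⟨0, zero_mem _, x, hx, by simp⟩
  | succ n ih =>
    obtain ⟨s, hs, y, hy, h⟩ := ih
    obtain ⟨c, z, hz, h'⟩ := exists_invVar_of_mem_properPart hy
    refine ⟨s + c • invVar D ^ (n + 1), add_mem ?_ (Submodule.smul_mem _ _
      (Submodule.subset_span ⟨Fin.last n, by simp⟩)), z, hz, ?_⟩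
    · refine Submodule.span_mono ?_ hs
      rintro _ ⟨i, rfl⟩
      exact ⟨i.castSucc, by simp⟩
    · rw [h, h', mul_add, mul_smul_comm]; ring

theorem exists_invVar_pow_mul_mem (x : MonicLoc D) :
    ∃ n, ∀ m, n ≤ m → ∀ y ∈ properPart D, invVar D ^ m * x * y ∈ properPart D := by
  obtain ⟨⟨a, f, hf⟩, rfl⟩ := IsLocalization.mk'_surjective (monics D) x
  refine ⟨a.natDegree, ?_⟩
  rintro m hm y ⟨h, b, hh, hb, hy⟩
  have hf' : f.Monic := hf
  refine ⟨X ^ m * f * h, a * b, ((monic_X_pow m).mul hf').mul hh, ?_, ?_⟩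
  · rw [hh.degree_mul, hf'.degree_mul, degree_X_pow]
    refine (degree_mul_le _ _).trans_lt ((add_le_add ?_ le_rfl).trans_lt
      (WithBot.add_lt_add_left ?_ hb))
    · rw [degree_eq_natDegree hf'.ne_zero]
      refine degree_le_natDegree.trans ?_
      exact_mod_cast hm.trans (Nat.le_add_right _ _)
    · rw [degree_eq_natDegree hf'.ne_zero]
      exact_mod_cast WithBot.coe_ne_bot
  · have h1 := IsLocalization.mk'_spec' (MonicLoc D) a (⟨f, hf⟩ : monics D)
    have h2 : algebraMap D[X] (MonicLoc D) X ^ m * invVar D ^ m = 1 := by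
      rw [← mul_pow, X_mul_invVar, one_pow]
    simp only [map_mul, map_pow]
    rw [← h1, ← hy]
    simp only
    linear_combination (algebraMap D[X] (MonicLoc D) f * algebraMap D[X] (MonicLoc D) h *
      IsLocalization.mk' (MonicLoc D) a (⟨f, hf⟩ : monics D) * y) * h2

theorem det_one_sub_sub_one_mem_properPart {ι : Type*} [Fintype ι] [DecidableEq ι]
    {q : Matrix ι ι (MonicLoc D)} (hq : ∀ i j, q i j ∈ properPart D) :
    (1 - q).det - 1 ∈ properPart D := by
  let O : Subring (MonicLoc D) :=
    { carrier := {x | ∀ y ∈ properPart D, x * y ∈ properPart D}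
      zero_mem' := fun y _ => by simp
      one_mem' := fun y hy => by simpa using hy
      add_mem' := fun ha hb y hy => by rw [add_mul]; exact add_mem (ha y hy) (hb y hy)
      neg_mem' := fun {x} ha y hy => by
        have h := neg_mem (ha y hy)
        convert h using 1
        exact neg_mul x y
      mul_mem' := fun ha hb y hy => by rw [mul_assoc]; exact ha _ (hb y hy) }
  let I : Ideal O :=
    { carrier := {x | (x : MonicLoc D) ∈ properPart D}
      zero_mem' := zero_mem (properPart D)
      add_mem' := fun ha hb => (properPart D).add_mem ha hb
      smul_mem' := fun a x hx => a.2 _ hx }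
  let q' : Matrix ι ι O := fun i j => ⟨q i j, fun y hy => mul_mem_properPart (hq i j) hy⟩
  have h1 : (1 - q').det - 1 ∈ I := by
    rw [← Ideal.Quotient.eq_zero_iff_mem, map_sub, RingHom.map_det, map_one, map_sub, map_one]
    have : (Ideal.Quotient.mk I).mapMatrix q' = 0 := by
      ext i j
      exact Ideal.Quotient.eq_zero_iff_mem.mpr (hq i j)
    rw [this]; simp
  have h2 : (((1 - q').det - 1 : O) : MonicLoc D) = (1 - q).det - 1 := by
    have := RingHom.map_det O.subtype (1 - q')
    rw [map_sub, map_one] at this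
    exact congrArg (· - 1) this
  rw [← h2]
  exact h1

end HorrocksPatching

section HorrocksPatching

open Polynomial

variable {D ι : Type*} [CommRing D] [IsLocalRing D] [Fintype ι] [DecidableEq ι]

theorem Submodule.single_mul_mem_smul_top {K : Type*} [CommRing K] [Algebra D K] {I : Ideal D}
    {k : K} (hk : k ∈ I • (⊤ : Submodule D K)) (i : ι) (y : K) :
    (Pi.single i (k * y) : ι → K) ∈ I • (⊤ : Submodule D (ι → K)) := by
  let L : K →ₗ[D] (ι → K) := (LinearMap.single D (fun _ => K) i).comp (LinearMap.mulRight D y)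
  have : L k ∈ (I • (⊤ : Submodule D K)).map L := Submodule.mem_map_of_mem hk
  rw [Submodule.map_smul''] at this
  exact Submodule.smul_mono le_rfl le_top this

theorem Submodule.mulVec_mem_smul_top {K : Type*} [CommRing K] [Algebra D K] {I : Ideal D}
    {M : Matrix ι ι K} (hM : ∀ i j, M i j ∈ I • (⊤ : Submodule D K)) (y : ι → K) :
    M *ᵥ y ∈ I • (⊤ : Submodule D (ι → K)) := by
  have : M *ᵥ y = ∑ i, ∑ j, Pi.single i (M i j * y j) := by
    ext k
    simp [mulVec, dotProduct, Finset.sum_apply, Pi.single_apply]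
  rw [this]
  exact sum_mem fun i _ => sum_mem fun j _ => Submodule.single_mul_mem_smul_top (hM i j) i _

/-- Every vector over `MonicLoc D` is a polynomial vector plus `g` times a proper one. -/
theorem exists_polynomial_add_mulVec {g g' : Matrix ι ι (MonicLoc D)} (h : g * g' = 1)
    (hg : ∀ i j, (1 - g) i j ∈ IsLocalRing.maximalIdeal D • (⊤ : Submodule D (MonicLoc D)))
    (x : ι → MonicLoc D) :
    ∃ p : ι → D[X], ∃ y : ι → MonicLoc D, (∀ i, y i ∈ properPart D) ∧
      x = algebraMap _ _ ∘ p + g *ᵥ y := by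
  let N : Submodule D (ι → MonicLoc D) :=
    LinearMap.range ((Algebra.linearMap D[X] (MonicLoc D)).restrictScalars D |>.compLeft ι) ⊔
      (Submodule.pi Set.univ fun _ => properPart D).map
        ((mulVecLin g).restrictScalars D)
  suffices H : (⊤ : Submodule D (ι → MonicLoc D)) ≤ N by
    obtain ⟨a, ⟨p, rfl⟩, b, ⟨y, hy, rfl⟩, hab⟩ := Submodule.mem_sup.mp (H (Submodule.mem_top (x := x)))
    exact ⟨p, y, fun i => hy i trivial, hab.symm⟩
  have hN1 : ∀ p : ι → D[X], (algebraMap D[X] (MonicLoc D) ∘ p : ι → MonicLoc D) ∈ N := fun p =>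
    Submodule.mem_sup_left ⟨p, rfl⟩
  have hN2 : ∀ y : ι → MonicLoc D, (∀ i, y i ∈ properPart D) → g *ᵥ y ∈ N := fun y hy =>
    Submodule.mem_sup_right ⟨y, fun i _ => hy i, rfl⟩
  choose n hn using fun i j => exists_invVar_pow_mul_mem (g' i j)
  let m := ∑ i, ∑ j, n i j
  have hm : ∀ i j, n i j ≤ m := fun i j =>
    (Finset.single_le_sum (f := fun j => n i j) (fun _ _ => Nat.zero_le _) (Finset.mem_univ j)).trans
      (Finset.single_le_sum (f := fun i => ∑ j, n i j) (fun _ _ => Nat.zero_le _)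
        (Finset.mem_univ i))
  let G₀ := Submodule.span D (Set.range fun i : Fin m => invVar D ^ (i.1 + 1))
  let G : Submodule D (ι → MonicLoc D) := Submodule.pi Set.univ fun _ => G₀
  have hG : G.FG := Submodule.fg_pi fun _ => Submodule.fg_span (Set.finite_range _)
  have hT : ∀ y : ι → MonicLoc D, (∀ i, y i ∈ properPart D) → y ∈ N ⊔ G := by
    intro y hy
    choose s hs z hz hyz using fun i => exists_invVar_pow_of_mem_properPart m (hy i)
    have hy2 : y = g *ᵥ (invVar D ^ m • g' *ᵥ z) + s := by
      rw [mulVec_smul, mulVec_mulVec, h, one_mulVec]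
      ext i
      rw [hyz i]; simp [add_comm]
    rw [hy2]
    refine Submodule.add_mem_sup (hN2 _ fun i => ?_) (fun i _ => hs i)
    have : (invVar D ^ m • g' *ᵥ z) i = ∑ j, invVar D ^ m * g' i j * z j := by
      simp [mulVec, dotProduct, Finset.mul_sum, mul_assoc]
    rw [this]
    exact sum_mem fun j _ => hn i j m (hm i j) _ (hz j)
  have htop : (⊤ : Submodule D (ι → MonicLoc D)) ≤ N ⊔ G := by
    intro x _
    choose p y hy hpy using fun i => exists_add_properPart (x i)
    have : x = algebraMap D[X] (MonicLoc D) ∘ p + y := funext hpy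
    rw [this]
    exact add_mem (Submodule.mem_sup_left (hN1 p)) (hT y hy)
  have hGp : ∀ y ∈ G, ∀ i, y i ∈ properPart D := by
    intro y hy i
    have h0 : G₀ ≤ properPart D := by
      refine Submodule.span_le.mpr ?_
      rintro _ ⟨k, rfl⟩
      refine ⟨X ^ (k.1 + 1), 1, monic_X_pow _, ?_, ?_⟩
      · rw [degree_one, degree_X_pow]
        exact_mod_cast Nat.succ_pos _
      · rw [map_pow, ← mul_pow, X_mul_invVar, one_pow, map_one]
    exact h0 (hy i trivial)
  have hGN : G ≤ N := by
    refine Submodule.le_of_le_smul_of_le_jacobson_bot (I := IsLocalRing.maximalIdeal D) hG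
      (IsLocalRing.maximalIdeal_le_jacobson _) fun y hy => ?_
    have h1 : y = g *ᵥ y + (1 - g) *ᵥ y := by rw [sub_mulVec, one_mulVec]; abel
    rw [h1]
    refine add_mem (Submodule.mem_sup_left (hN2 y (hGp y hy))) ?_
    have h2 := Submodule.smul_mono le_rfl htop (Submodule.mulVec_mem_smul_top hg y)
    rw [Submodule.smul_sup] at h2
    exact (sup_le_sup_right Submodule.smul_le_right _ : _ ≤ N ⊔ IsLocalRing.maximalIdeal D • G) h2
  exact htop.trans (sup_le le_rfl hGN)

theorem completable_of_monicLoc_aux {v : ι → D[X]} {i₀ : ι} {g g' : Matrix ι ι (MonicLoc D)}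
    (h : g * g' = 1) (hdet : g.det = 1)
    (hg : ∀ i j, (1 - g) i j ∈ IsLocalRing.maximalIdeal D • (⊤ : Submodule D (MonicLoc D)))
    (hv : (algebraMap D[X] (MonicLoc D) ∘ v) ᵥ* g = Pi.single i₀ 1) : Completable v := by
  choose p q hq hpq using fun j => exists_polynomial_add_mulVec h hg (g.col j)
  let φ := algebraMap D[X] (MonicLoc D)
  let P : Matrix ι ι D[X] := of fun i j => p j i
  let Q : Matrix ι ι (MonicLoc D) := of fun i j => q j i
  have hQ : ∀ i j, Q i j ∈ properPart D := fun i j => hq j i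
  have hP : P.map φ = g * (1 - Q) := by
    rw [mul_sub, mul_one, eq_sub_iff_add_eq]
    ext i j
    exact (congrFun (hpq j) i).symm
  have hd : φ P.det - 1 ∈ properPart D := by
    have : φ P.det = (1 - Q).det := by
      rw [RingHom.map_det]
      show (P.map φ).det = _
      rw [hP, det_mul, hdet, one_mul]
    rw [this]
    exact det_one_sub_sub_one_mem_properPart hQ
  have hd1 : P.det = 1 := by
    rw [← map_one φ, ← map_sub] at hd
    exact sub_eq_zero.mp (eq_zero_of_mem_properPart hd)
  have hvP : φ ∘ (v ᵥ* P) = Pi.single i₀ 1 ᵥ* (1 - Q) := by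
    rw [← hv, vecMul_vecMul, ← hP]
    ext j
    simp [vecMul, dotProduct, φ]
  have hvP1 : v ᵥ* P = Pi.single i₀ 1 := by
    rw [← sub_eq_zero]
    ext1 j
    apply eq_zero_of_mem_properPart
    have h1 := congrFun hvP j
    simp only [Function.comp_apply, vecMul_sub, vecMul_one, Pi.sub_apply, single_one_vecMul] at h1
    have h2 : φ ((v ᵥ* P - Pi.single i₀ 1 : ι → D[X]) j) = - Q i₀ j := by
      rw [Pi.sub_apply, map_sub, h1]
      by_cases hj : j = i₀
      · subst hj; simp
      · simp [Pi.single_eq_of_ne hj]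
    show φ _ ∈ _
    rw [h2]
    exact neg_mem (hQ _ _)
  have hPi : P⁻¹ * P = 1 := nonsing_inv_mul _ (by rw [hd1]; exact isUnit_one)
  have hPi' : P * P⁻¹ = 1 := mul_nonsing_inv _ (by rw [hd1]; exact isUnit_one)
  refine ⟨P⁻¹, P, hPi, i₀, ?_⟩
  calc P⁻¹ i₀ = Pi.single i₀ 1 ᵥ* P⁻¹ := (single_one_vecMul _ _).symm
    _ = v := by rw [← hvP1, vecMul_vecMul, hPi', vecMul_one]

end HorrocksPatching

section ElementaryField

variable {ι : Type*} [Fintype ι] [DecidableEq ι]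

theorem ElemMat.of_det_eq_one_of_field {F : Type*} [Field F] {M : Matrix ι ι F}
    (hM : M.det = 1) : M ∈ ElemMat ι F := by
  cases subsingleton_or_nontrivial ι with
  | inl h =>
    convert one_mem (ElemMat ι F)
    ext i j
    have := Matrix.det_eq_elem_of_subsingleton M i
    rw [hM] at this
    rw [Subsingleton.elim j i, ← this, Matrix.one_apply_eq]
  | inr h =>
    refine SpecialLinearGroup.diagonal_transvection_induction' (fun M => M.1 ∈ ElemMat ι F)
      ⟨M, hM⟩ (fun i j hij c hc => ?_) (fun i j hij a => ?_) fun A B hA hB => ?_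
    · have := ElemMat.diagonal_pair_mem hij (mul_inv_cancel₀ hc)
      refine (congrArg (· ∈ ElemMat ι F) ?_).mp this
      rw [SpecialLinearGroup.diag2n_coe]
      refine congrArg diagonal (funext fun k => ?_)
      by_cases hk : k = j
      · subst hk; simp [hij.symm]
      · simp [hk, Function.update_apply]
    · exact transvection_mem hij a
    · exact mul_mem hA hB

theorem ElemMat.of_det_eq_one_of_isField {F : Type*} [CommRing F] (hF : IsField F)
    {M : Matrix ι ι F} (hM : M.det = 1) : M ∈ ElemMat ι F := by
  letI := hF.toField
  exact of_det_eq_one_of_field hM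

end ElementaryField

section Horrocks

open Polynomial

theorem isField_monicLoc {k : Type*} [Field k] : IsField (MonicLoc k) := by
  refine ⟨⟨0, 1, ?_⟩, mul_comm, fun {x} hx => ?_⟩
  · rw [← map_zero (algebraMap k[X] (MonicLoc k)), ← map_one (algebraMap k[X] (MonicLoc k))]
    exact fun h => zero_ne_one (monicLoc_injective h)
  · obtain ⟨⟨p, g, hg⟩, rfl⟩ := IsLocalization.mk'_surjective (monics k) x
    have hp : p ≠ 0 := by
      rintro rfl
      exact hx (IsLocalization.mk'_zero _)
    have h1 : p * C p.leadingCoeff⁻¹ ∈ monics k := monic_mul_leadingCoeff_inv hp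
    refine ⟨IsLocalization.mk' _ (g * C p.leadingCoeff⁻¹) (⟨_, h1⟩ : monics k), ?_⟩
    rw [← IsLocalization.mk'_mul, IsLocalization.mk'_eq_iff_eq_mul, one_mul]
    congr 1
    simp only [Submonoid.coe_mul]; ring

variable {D : Type*} [CommRing D]

theorem MonicLoc.mem_smul_top_of_map_eq_zero {I : Ideal D} {x : MonicLoc D}
    (hx : MonicLoc.map (Ideal.Quotient.mk I) x = 0) : x ∈ I • (⊤ : Submodule D (MonicLoc D)) := by
  rw [Ideal.smul_top_eq_map]
  show x ∈ I.map (algebraMap D (MonicLoc D))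
  obtain ⟨⟨p, g, hg⟩, rfl⟩ := IsLocalization.mk'_surjective (monics D) x
  simp only [MonicLoc.map, IsLocalization.map_mk', coe_mapRingHom] at hx
  obtain ⟨⟨q, hq⟩, h0⟩ := (IsLocalization.mk'_eq_zero_iff _ _).mp hx
  obtain ⟨q, rfl, hq'⟩ := exists_monic_map_eq Ideal.Quotient.mk_surjective hq
  simp only [← Polynomial.map_mul] at h0
  have hmem : q * p ∈ I.map C := by
    rw [Ideal.mem_map_C_iff]
    intro n
    rw [← Ideal.Quotient.eq_zero_iff_mem, ← coeff_map, h0, coeff_zero]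
  have h1 := Ideal.mem_map_of_mem (algebraMap D[X] (MonicLoc D)) hmem
  rw [Ideal.map_map] at h1
  have hq2 : q ∈ monics D := hq'
  have h2 : IsLocalization.mk' (MonicLoc D) p (⟨g, hg⟩ : monics D) =
      IsLocalization.mk' _ 1 (⟨q, hq2⟩ * ⟨g, hg⟩ : monics D) * algebraMap _ _ (q * p) := by
    rw [mul_comm, IsLocalization.mul_mk'_eq_mk'_of_mul, IsLocalization.mk'_eq_iff_eq]
    congr 1
    show q * g * p = g * (q * p * 1)
    ring
  show IsLocalization.mk' (MonicLoc D) p (⟨g, hg⟩ : monics D) ∈ _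
  rw [h2]
  exact Ideal.mul_mem_left _ _ h1

variable [IsLocalRing D]

theorem completable_of_monicLoc_sum {κ : Type*} [Fintype κ] [DecidableEq κ] [Nonempty κ]
    {v : Unit ⊕ κ → D[X]}
    (h1 : mapRingHom (IsLocalRing.residue D) ∘ v = Pi.single (Sum.inl ()) 1)
    (h : Completable (algebraMap D[X] (MonicLoc D) ∘ v)) : Completable v := by
  let K := MonicLoc D
  let L := MonicLoc (IsLocalRing.ResidueField D)
  let ρ : K →+* L := MonicLoc.map (IsLocalRing.residue D)
  have hρ : Function.Surjective ρ := MonicLoc.map_surjective IsLocalRing.residue_surjective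
  -- a completing matrix of determinant one
  obtain ⟨g, g', hgg, hg, hdet⟩ : ∃ g g' : Matrix (Unit ⊕ κ) (Unit ⊕ κ) K, g * g' = 1 ∧
      (algebraMap D[X] K ∘ v) ᵥ* g = Pi.single (Sum.inl ()) 1 ∧ g.det = 1 := by
    obtain ⟨M, N, hMN, i, hM⟩ := h.exists_vecMul
    obtain ⟨E, hE, hE'⟩ := RowEquiv.single_single (R := K) i (Sum.inl ())
    obtain ⟨E', -, hEE, -⟩ := ElemMat.exists_inv hE
    obtain ⟨k⟩ := ‹Nonempty κ›
    have hd : (M * E).det * N.det = 1 := by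
      rw [det_mul, ElemMat.det_eq_one hE, mul_one, ← det_mul, hMN, det_one]
    let Δ (c : K) : Matrix (Unit ⊕ κ) (Unit ⊕ κ) K :=
      diagonal (Function.update 1 (Sum.inr k) c)
    have hΔ : Δ N.det * Δ (M * E).det = 1 := by
      rw [diagonal_mul_diagonal, ← diagonal_one]
      refine congrArg diagonal (funext fun j => ?_)
      by_cases hj : j = Sum.inr k
      · subst hj; rw [mul_comm] at hd; simpa using hd
      · simp [hj]
    refine ⟨M * E * Δ N.det, Δ (M * E).det * (E' * N), ?_, ?_, ?_⟩
    · calc M * E * Δ N.det * (Δ (M * E).det * (E' * N)) =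
          M * (E * ((Δ N.det * Δ (M * E).det) * (E' * N))) := by simp only [Matrix.mul_assoc]
        _ = M * ((E * E') * N) := by rw [hΔ, Matrix.one_mul, Matrix.mul_assoc]
        _ = 1 := by rw [hEE, Matrix.one_mul, hMN]
    · rw [← vecMul_vecMul, ← vecMul_vecMul, hM, hE']
      funext j
      rw [vecMul_diagonal]
      by_cases hj : j = Sum.inr k
      · subst hj; simp
      · simp [hj]
    · rw [det_mul, det_diagonal, Finset.prod_update_of_mem (Finset.mem_univ _)]
      simpa using hd
  -- adjust it to be trivial modulo the maximal ideal
  have hrow : (g.map ρ) (Sum.inl ()) = Pi.single (Sum.inl ()) 1 := by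
    have h2 := congrArg (fun u => ρ ∘ u) hg
    have h3 : ρ ∘ ((algebraMap D[X] K ∘ v) ᵥ* g) = (ρ ∘ (algebraMap D[X] K ∘ v)) ᵥ* g.map ρ := by
      funext j; exact RingHom.map_vecMul ρ _ _ j
    have h4 : ρ ∘ (algebraMap D[X] K ∘ v) = Pi.single (Sum.inl ()) 1 := by
      have : ρ ∘ (algebraMap D[X] K ∘ v) =
          algebraMap _ L ∘ (mapRingHom (IsLocalRing.residue D) ∘ v) := by
        funext j
        exact MonicLoc.map_algebraMap _ _
      rw [this, h1]
      funext j
      simp only [Function.comp_apply, Pi.single_apply]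
      split_ifs <;> simp
    simp only [h3, h4, single_one_vecMul] at h2
    rw [show (g.map ρ) (Sum.inl ()) = (g.map ρ).row (Sum.inl ()) from rfl, h2]
    funext j
    simp only [Function.comp_apply, Pi.single_apply]
    split_ifs <;> simp
  obtain ⟨ε, ε', hε, hε2, hε3, hε4⟩ : ∃ ε ε' : Matrix (Unit ⊕ κ) (Unit ⊕ κ) K, ε * ε' = 1 ∧
      ε.det = 1 ∧ ε (Sum.inl ()) = Pi.single (Sum.inl ()) 1 ∧ ε.map ρ = g.map ρ := by
    let c := (g.map ρ).toBlocks₂₁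
    let γ := (g.map ρ).toBlocks₂₂
    have hbl : g.map ρ = fromBlocks 1 0 c γ := by
      rw [← fromBlocks_toBlocks (g.map ρ)]
      congr 1
      · ext i j
        exact (congrFun hrow (Sum.inl j)).trans (by simp)
      · ext i j
        exact (congrFun hrow (Sum.inr j)).trans (by simp)
    have hγ : γ.det = 1 := by
      have : (g.map ρ).det = 1 := by
        rw [← RingHom.mapMatrix_apply, ← RingHom.map_det, hdet, map_one]
      rw [hbl, det_fromBlocks_zero₁₂] at this
      simpa using this
    have hγE := ElemMat.of_det_eq_one_of_isField isField_monicLoc hγ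
    obtain ⟨γ₁, hγ₁, hγ₁'⟩ := ElemMat.exists_lift hρ hγE
    obtain ⟨γ₂, -, hγ₂, -⟩ := ElemMat.exists_inv hγ₁
    choose c₁ hc₁ using fun i j => hρ (c i j)
    let c₁' : Matrix κ Unit K := of c₁
    refine ⟨fromBlocks 1 0 c₁' γ₁, fromBlocks 1 0 (-(γ₂ * c₁')) γ₂, ?_, ?_, ?_, ?_⟩
    · rw [fromBlocks_multiply]
      simp only [Matrix.mul_neg, ← Matrix.mul_assoc, hγ₂, Matrix.one_mul, Matrix.mul_zero, Matrix.mul_one, neg_zero,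
        Matrix.zero_mul, add_zero, zero_add]
      rw [show c₁' + -c₁' = 0 from add_neg_cancel _, fromBlocks_one]
    · rw [det_fromBlocks_zero₁₂, ElemMat.det_eq_one hγ₁, det_one, mul_one]
    · funext j
      rcases j with j | j <;> simp
    · rw [hbl, fromBlocks_map, hγ₁']
      congr 1
      · simp
      · ext; simp
      · ext i j; exact hc₁ i j
  have hε' : ε' * ε = 1 := mul_eq_one_comm.mp hε
  refine completable_of_monicLoc_aux (g := g * ε') (g' := ε * g') (i₀ := Sum.inl ()) ?_ ?_ ?_ ?_
  · rw [Matrix.mul_assoc, ← Matrix.mul_assoc ε', hε', Matrix.one_mul, hgg]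
  · have := congrArg det hε
    rw [det_mul, hε2, one_mul, det_one] at this
    rw [det_mul, hdet, this, one_mul]
  · intro i j
    refine MonicLoc.mem_smul_top_of_map_eq_zero ?_
    have : (1 - g * ε').map ρ = 0 := by
      rw [Matrix.map_sub _ (map_sub ρ), Matrix.map_mul, ← hε4, ← Matrix.map_mul, hε,
        sub_self]
    exact congrFun (congrFun this i) j
  · rw [← vecMul_vecMul, hg]
    calc Pi.single (Sum.inl ()) 1 ᵥ* ε' = (Pi.single (Sum.inl ()) 1 ᵥ* ε) ᵥ* ε' := by
          congr 1
          rw [single_one_vecMul]; exact hε3.symm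
      _ = _ := by rw [vecMul_vecMul, hε, vecMul_one]

/-- Horrocks' theorem for unimodular rows. -/
theorem completable_of_monicLoc {ι : Type*} [Fintype ι] [DecidableEq ι]
    (hι : 3 ≤ Fintype.card ι) {v : ι → D[X]} (hv : Unimod v)
    (h : Completable (algebraMap D[X] (MonicLoc D) ∘ v)) : Completable v := by
  obtain ⟨i₀⟩ : Nonempty ι := Fintype.card_pos_iff.mp (by omega)
  let κ := {i : ι // i ≠ i₀}
  let e : Unit ⊕ κ ≃ ι := (Equiv.sumCongr (Equiv.ofUnique Unit {i : ι // i = i₀}) (Equiv.refl _)).trans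
    (Equiv.sumCompl (· = i₀))
  have hcard : Fintype.card (Unit ⊕ κ) = Fintype.card ι := Fintype.card_congr e
  have : Nonempty κ := by
    rw [← Fintype.card_pos_iff]
    rw [Fintype.card_sum, Fintype.card_unit] at hcard
    omega
  let k := IsLocalRing.ResidueField D
  have hk : HeightLE k 0 := fun p hp => by
    rw [Ideal.eq_bot_of_prime p]; simp
  have hv' := hv.comp_equiv e
  obtain ⟨w, hw, hw'⟩ := RowEquiv.exists_lift
    (Polynomial.map_surjective _ (IsLocalRing.residue_surjective (R := D)))
    (rowEquiv_single_polynomial hk (hcard ▸ hι) (by omega)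
      (hv'.map (mapRingHom (IsLocalRing.residue D))) (Sum.inl ()))
  have hc : Completable (algebraMap D[X] (MonicLoc D) ∘ w) :=
    (h.comp_equiv e).of_rowEquiv (hw.map _)
  have hfin := ((completable_of_monicLoc_sum hw' hc).of_rowEquiv hw.symm).comp_equiv e.symm
  convert hfin
  funext j; simp

end Horrocks

open Polynomial in
theorem completable_polynomial {A : Type*} [CommRing A] [IsNoetherianRing A] [IsLocalRing A]
    {d : ℕ} (h : HeightLE A d) (hd : 2 ≤ d) (hf : IsUnit ((d.factorial : ℕ) : A))
    {v : Fin (d + 1) → A[X]} (hv : Unimod v) : Completable v :=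
  completable_of_monicLoc (by simp; omega) hv (completable_monicLoc h hd hf hv)

section LocalGlobal

open Polynomial

variable {ι R S : Type*} [Fintype ι] [DecidableEq ι] [CommRing R] [CommRing S]

/-- Two rows differ by an invertible matrix that commutes with `e`. -/
def CommEquiv (e : Matrix ι ι R) (v w : ι → R) : Prop :=
  ∃ g g' : Matrix ι ι R, g * g' = 1 ∧ e * g = g * e ∧ v ᵥ* g = w

namespace CommEquiv

theorem refl (e : Matrix ι ι R) (v : ι → R) : CommEquiv e v v :=
  ⟨1, 1, by simp, by simp, by simp⟩

theorem symm {e : Matrix ι ι R} {v w : ι → R} (h : CommEquiv e v w) : CommEquiv e w v := by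
  obtain ⟨g, g', h, he, rfl⟩ := h
  have h' := mul_eq_one_comm.mp h
  refine ⟨g', g, h', ?_, ?_⟩
  · calc e * g' = g' * (g * e) * g' := by rw [← Matrix.mul_assoc, h', Matrix.one_mul]
      _ = g' * e * (g * g') := by rw [← he]; simp only [Matrix.mul_assoc]
      _ = g' * e := by rw [h, Matrix.mul_one]
  · rw [vecMul_vecMul, h, vecMul_one]

theorem trans {e : Matrix ι ι R} {u v w : ι → R} (h : CommEquiv e u v) (h' : CommEquiv e v w) :
    CommEquiv e u w := by
  obtain ⟨g, g', h, he, rfl⟩ := h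
  obtain ⟨k, k', h', he', rfl⟩ := h'
  refine ⟨g * k, k' * g', ?_, ?_, ?_⟩
  · rw [Matrix.mul_assoc, ← Matrix.mul_assoc k, h', Matrix.one_mul, h]
  · rw [← Matrix.mul_assoc, he, Matrix.mul_assoc, he', Matrix.mul_assoc]
  · rw [vecMul_vecMul]

theorem map {e : Matrix ι ι R} {v w : ι → R} (h : CommEquiv e v w) (f : R →+* S) :
    CommEquiv (e.map f) (f ∘ v) (f ∘ w) := by
  obtain ⟨g, g', h, he, rfl⟩ := h
  refine ⟨g.map f, g'.map f, ?_, ?_, ?_⟩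
  · rw [← Matrix.map_mul, h, Matrix.map_one _ (map_zero f) (map_one f)]
  · rw [← Matrix.map_mul, he, Matrix.map_mul]
  · funext j; exact (RingHom.map_vecMul f _ _ j).symm

end CommEquiv

variable [Algebra R S] (N : Submonoid R) [IsLocalization N S]

theorem exists_map_eq_comp_mul_X {p : S[X]} {c : R} (hc : p.coeff 0 = algebraMap R S c) :
    ∃ s ∈ N, ∀ r : R, ∃ t : R[X], t.coeff 0 = c ∧
      t.map (algebraMap R S) = p.comp (C (algebraMap R S (r * s)) * X) := by
  obtain ⟨s, hs, hs'⟩ := IsLocalization.integerNormalization_spec N p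
  set u := IsLocalization.integerNormalization N p
  refine ⟨s, hs, fun r => ⟨u.divX.comp (C (r * s) * X) * (C r * X) + C c, ?_, ?_⟩⟩
  · simp
  · have h1 : u.divX.map (algebraMap R S) = C (algebraMap R S s) * p.divX := by
      ext n
      have := congrArg (fun q => q.coeff (n + 1)) hs'
      simp only [coeff_map, Algebra.smul_def] at this
      simp [coeff_divX, this]
    rw [Polynomial.map_add, Polynomial.map_mul, Polynomial.map_comp, h1]
    conv_rhs => rw [← divX_mul_X_add p]
    rw [hc]
    simp only [mul_comp, add_comp, C_comp, X_comp, Polynomial.map_mul, map_X, map_C, map_mul]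
    ring

theorem exists_comp_mul_X_eq_zero {p : R[X]} (h0 : p.coeff 0 = 0)
    (hp : p.map (algebraMap R S) = 0) :
    ∃ s ∈ N, ∀ r : R, p.comp (C (r * s) * X) = 0 := by
  have key : ∃ s ∈ N, ∀ n, s * p.coeff n = 0 := by
    have h1 : ∀ n, ∃ s : N, s.1 * p.coeff n = 0 := fun n => by
      have := congrArg (fun q => q.coeff n) hp
      simp only [coeff_map, coeff_zero] at this
      exact (IsLocalization.map_eq_zero_iff N S _).mp this
    choose s hs using h1
    refine ⟨∏ n ∈ p.support, (s n).1, prod_mem fun n _ => (s n).2, fun n => ?_⟩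
    by_cases hn : n ∈ p.support
    · rw [← Finset.prod_erase_mul _ _ hn, mul_assoc, hs, mul_zero]
    · rw [notMem_support_iff.mp hn, mul_zero]
  obtain ⟨s, hs, h⟩ := key
  refine ⟨s, hs, fun r => ?_⟩
  ext n
  rw [comp_C_mul_X_coeff, coeff_zero]
  cases n with
  | zero => simp [h0]
  | succ n =>
    have := h (n + 1)
    rw [pow_succ, show p.coeff (n + 1) * ((r * s) ^ n * (r * s)) =
      s * p.coeff (n + 1) * ((r * s) ^ n * r) by ring, this, zero_mul]

theorem exists_forall_mem_submonoid {α : Type*} [Finite α] {P : α → R → Prop}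
    (h : ∀ a, ∃ s ∈ N, ∀ r, P a (r * s)) : ∃ s ∈ N, ∀ a, ∀ r, P a (r * s) := by
  have := Fintype.ofFinite α
  classical
  choose s hs hP using h
  refine ⟨∏ a, s a, prod_mem fun a _ => hs a, fun a r => ?_⟩
  rw [← Finset.prod_erase_mul _ _ (Finset.mem_univ a), ← mul_assoc]
  exact hP a _

theorem exists_commEquiv_comp {e : Matrix ι ι R} {v : ι → R[X]} {W W' : Matrix ι ι S[X]}
    (hW : W * W' = 1) (hW0 : W.map constantCoeff = 1)
    (he : e.map (C.comp (algebraMap R S)) * W = W * e.map (C.comp (algebraMap R S)))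
    (hv : (fun i => (v i).map (algebraMap R S)) ᵥ* W =
      fun i => C (algebraMap R S ((v i).coeff 0))) :
    ∃ s ∈ N, CommEquiv (e.map C) (fun i => (v i).comp (C s * X)) (fun i => C ((v i).coeff 0)) := by
  have hW0' : W'.map constantCoeff = 1 := by
    have := congrArg (fun M => M.map (constantCoeff (R := S))) hW
    simpa [Matrix.map_mul, hW0, Matrix.map_one] using this
  have hc : ∀ (V : Matrix ι ι S[X]), V.map constantCoeff = 1 → ∀ i j, (V i j).coeff 0 =
      algebraMap R S ((1 : Matrix ι ι R) i j) := fun V hV i j => by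
    have := congrFun (congrFun hV i) j
    rw [Matrix.map_apply, constantCoeff_apply] at this
    rw [this, Matrix.one_apply, Matrix.one_apply]
    split_ifs <;> simp
  obtain ⟨s, hs, hT⟩ := exists_forall_mem_submonoid N (α := ι × ι)
    (P := fun a r => ∃ t : R[X], t.coeff 0 = (1 : Matrix ι ι R) a.1 a.2 ∧
      t.map (algebraMap R S) = (W a.1 a.2).comp (C (algebraMap R S r) * X))
    fun a => exists_map_eq_comp_mul_X N (hc W hW0 a.1 a.2)
  obtain ⟨s', hs', hT'⟩ := exists_forall_mem_submonoid N (α := ι × ι)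
    (P := fun a r => ∃ t : R[X], t.coeff 0 = (1 : Matrix ι ι R) a.1 a.2 ∧
      t.map (algebraMap R S) = (W' a.1 a.2).comp (C (algebraMap R S r) * X))
    fun a => exists_map_eq_comp_mul_X N (hc W' hW0' a.1 a.2)
  choose T hT0 hT1 using fun i j => hT (i, j) s'
  choose T' hT0' hT1' using fun i j => hT' (i, j) s
  let c := s' * s
  let κ : S[X] →+* S[X] := compRingHom (C (algebraMap R S c) * X)
  have hTm : (of T).map (mapRingHom (algebraMap R S)) = W.map κ := by
    ext1 i j; exact hT1 i j
  have hTm' : (of T').map (mapRingHom (algebraMap R S)) = W'.map κ := by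
    ext1 i j
    refine (hT1' i j).trans ?_
    rw [mul_comm s s']; rfl
  have hTc : (of T).map constantCoeff = 1 := by
    ext1 i j; exact hT0 i j
  have hTc' : (of T').map constantCoeff = 1 := by
    ext1 i j; exact hT0' i j
  have hκC : ∀ a : S, κ (C a) = C a := fun a => by simp [κ, compRingHom]
  have heκ : (e.map (C.comp (algebraMap R S))).map κ = e.map (C.comp (algebraMap R S)) := by
    ext1 i j; exact hκC _
  have heC : (e.map C).map (mapRingHom (algebraMap R S)) = e.map (C.comp (algebraMap R S)) := by
    ext1 i j; simp
  have heC0 : (e.map C).map constantCoeff = e := by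
    ext1 i j; simp
  -- the three identities hold after localization
  obtain ⟨s₁, hs₁, h₁⟩ := exists_forall_mem_submonoid N (α := ι × ι)
    (P := fun a r => ((of T * of T' - 1) a.1 a.2).comp (C r * X) = 0)
    fun a => exists_comp_mul_X_eq_zero (S := S) N
      (by
        have : (of T * of T' - 1).map constantCoeff = 0 := by
          rw [Matrix.map_sub _ (map_sub _), Matrix.map_mul, hTc, hTc',
            Matrix.map_one _ (map_zero _) (map_one _), Matrix.one_mul, sub_self]
        exact congrFun (congrFun this a.1) a.2)
      (by
        have : (of T * of T' - 1).map (mapRingHom (algebraMap R S)) = 0 := by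
          rw [Matrix.map_sub _ (map_sub _), Matrix.map_mul, hTm, hTm', ← Matrix.map_mul, hW,
            Matrix.map_one _ (map_zero _) (map_one _), Matrix.map_one _ (map_zero _) (map_one _),
            sub_self]
        exact congrFun (congrFun this a.1) a.2)
  obtain ⟨s₂, hs₂, h₂⟩ := exists_forall_mem_submonoid N (α := ι × ι)
    (P := fun a r => ((e.map C * of T - of T * e.map C) a.1 a.2).comp (C r * X) = 0)
    fun a => exists_comp_mul_X_eq_zero (S := S) N
      (by
        have : (e.map C * of T - of T * e.map C).map constantCoeff = 0 := by
          rw [Matrix.map_sub _ (map_sub _), Matrix.map_mul, Matrix.map_mul, hTc,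
            Matrix.one_mul, Matrix.mul_one, sub_self]
        exact congrFun (congrFun this a.1) a.2)
      (by
        have : (e.map C * of T - of T * e.map C).map (mapRingHom (algebraMap R S)) = 0 := by
          rw [Matrix.map_sub _ (map_sub _), Matrix.map_mul, Matrix.map_mul, hTm, heC, ← heκ,
            ← Matrix.map_mul, he, Matrix.map_mul, sub_self]
        exact congrFun (congrFun this a.1) a.2)
  let vc : ι → R[X] := fun i => (v i).comp (C c * X)
  let v0 : ι → R[X] := fun i => C ((v i).coeff 0)
  have hvc : mapRingHom (algebraMap R S) ∘ vc = κ ∘ fun i => (v i).map (algebraMap R S) := by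
    funext i
    show ((v i).comp (C c * X)).map _ = ((v i).map _).comp _
    rw [Polynomial.map_comp]
    simp
  obtain ⟨s₃, hs₃, h₃⟩ := exists_forall_mem_submonoid N (α := ι)
    (P := fun a r => ((vc ᵥ* of T - v0) a).comp (C r * X) = 0)
    fun a => exists_comp_mul_X_eq_zero (S := S) N
      (by
        have h1 : constantCoeff ((vc ᵥ* of T) a) = (v a).coeff 0 := by
          rw [RingHom.map_vecMul, hTc, vecMul_one]
          simp [vc]
        rw [Pi.sub_apply, coeff_sub, ← constantCoeff_apply, h1]
        simp [v0])
      (by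
        have h1 : mapRingHom (algebraMap R S) ((vc ᵥ* of T) a) =
            C (algebraMap R S ((v a).coeff 0)) := by
          rw [RingHom.map_vecMul, hTm, hvc, ← RingHom.map_vecMul, hv, hκC]
        rw [Pi.sub_apply, Polynomial.map_sub, ← coe_mapRingHom, h1]
        simp [v0])
  let b := s₁ * s₂ * s₃
  let η : R[X] →+* R[X] := compRingHom (C b * X)
  have hη : ∀ p : R[X], η p = p.comp (C b * X) := fun p => rfl
  have hηC : ∀ a : R, η (C a) = C a := fun a => by simp [hη]
  refine ⟨c * b, mul_mem (mul_mem hs' hs) (mul_mem (mul_mem hs₁ hs₂) hs₃),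
    (of T).map η, (of T').map η, ?_, ?_, ?_⟩
  · rw [← sub_eq_zero, ← Matrix.map_mul,
      ← Matrix.map_one η (map_zero _) (map_one _), ← Matrix.map_sub _ (map_sub _)]
    ext1 i j
    have := h₁ (i, j) (s₂ * s₃)
    rw [show s₂ * s₃ * s₁ = b by simp only [b]; ring] at this
    exact this
  · have heη : (e.map C).map η = e.map C := by
      ext1 i j; exact hηC _
    rw [← heη, ← Matrix.map_mul, ← Matrix.map_mul, ← sub_eq_zero, ← Matrix.map_sub _ (map_sub _)]
    ext1 i j
    have := h₂ (i, j) (s₁ * s₃)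
    rw [show s₁ * s₃ * s₂ = b by simp only [b]; ring] at this
    exact this
  · have h4 : (fun i => (v i).comp (C (c * b) * X)) = η ∘ vc := by
      funext i
      rw [Function.comp_apply, hη]
      simp only [vc]
      rw [comp_assoc]
      simp only [mul_comp, C_comp, X_comp, C_mul]
      rw [mul_assoc]
    rw [h4, ← sub_eq_zero]
    funext i
    have := h₃ i (s₁ * s₂)
    rw [Pi.sub_apply, ← RingHom.map_vecMul, ← hηC, ← map_sub]
    exact this

end LocalGlobal

section LocalGlobal

open Polynomial

variable {ι B : Type*} [Fintype ι] [DecidableEq ι] [CommRing B]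

/-- Substitution of the generic sum of two variables. -/
noncomputable def addVar (R : Type*) [CommRing R] : R[X] →+* R[X][X] :=
  eval₂RingHom (C.comp C) (C X + X)

theorem constantCoeff_addVar (p : B[X]) : constantCoeff (addVar B p) = p := by
  have : (constantCoeff (R := B[X])).comp (addVar B) = RingHom.id _ := by
    ext <;> simp [addVar]
  exact congrFun (congrArg DFunLike.coe this) p

theorem addVar_C (a : B) : addVar B (C a) = C (C a) := by simp [addVar]

/-- Quillen's ideal of a row. -/
def quillenIdeal (e : Matrix ι ι B) (v : ι → B[X]) : Ideal B where
  carrier := {a | ∀ x y : B[X], CommEquiv (e.map C) (fun i => (v i).comp (x + C a * y))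
    (fun i => (v i).comp x)}
  zero_mem' := fun x y => by simpa using CommEquiv.refl _ _
  add_mem' := fun {a b} ha hb x y => by
    have := (hb (x + C a * y) y).trans (ha x y)
    simpa [add_mul, add_assoc] using this
  smul_mem' := fun c a ha x y => by
    have := ha x (C c * y)
    simpa [mul_assoc, mul_left_comm] using this

attribute [local instance] Polynomial.algebra Polynomial.isLocalization in
theorem exists_mem_quillenIdeal (e : Matrix ι ι B) (v : ι → B[X]) (N : Submonoid B) (S : Type*)
    [CommRing S] [Algebra B S] [IsLocalization N S]
    (h : CommEquiv (e.map (C.comp (algebraMap B S))) (fun i => (v i).map (algebraMap B S))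
      (fun i => C (algebraMap B S ((v i).coeff 0)))) : ∃ s ∈ N, s ∈ quillenIdeal e v := by
  obtain ⟨G, G', hG, he, hv⟩ := h
  have hG' := mul_eq_one_comm.mp hG
  have heσ : (e.map (C.comp (algebraMap B S))).map (addVar S) =
      (e.map (C.comp (algebraMap B S))).map C := by
    ext1 i j; exact addVar_C _
  have hone : ∀ {T : Type _} [CommRing T] (f : S[X] →+* T),
      (1 : Matrix ι ι S[X]).map f = 1 := fun f => Matrix.map_one f (map_zero f) (map_one f)
  have hcc : ∀ M : Matrix ι ι S[X], (M.map C).map (constantCoeff (R := S[X])) = M := fun M => by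
    ext1 i j; simp
  have hca : ∀ M : Matrix ι ι S[X], (M.map (addVar S)).map (constantCoeff (R := S[X])) = M :=
    fun M => by
      ext1 i j; exact constantCoeff_addVar _
  have hmap : ∀ p : B[X], (addVar B p).map (mapRingHom (algebraMap B S)) =
      addVar S (p.map (algebraMap B S)) := fun p => by
    have : (mapRingHom (mapRingHom (algebraMap B S))).comp (addVar B) =
        (addVar S).comp (mapRingHom (algebraMap B S)) := by
      ext <;> simp [addVar]
    exact congrFun (congrArg DFunLike.coe this) p
  obtain ⟨_, ⟨s, hs, rfl⟩, hcomm⟩ := exists_commEquiv_comp (R := B[X]) (S := S[X]) (N.map C)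
    (e := e.map C) (v := fun i => addVar B (v i))
    (W := G.map (addVar S) * G'.map C) (W' := G.map C * G'.map (addVar S)) (by
      calc G.map (addVar S) * G'.map C * (G.map C * G'.map (addVar S)) =
            G.map (addVar S) * (G' * G).map C * G'.map (addVar S) := by
              rw [Matrix.map_mul]; simp only [Matrix.mul_assoc]
        _ = 1 := by
              rw [hG', hone, Matrix.mul_one, ← Matrix.map_mul, hG, hone])
    (by rw [Matrix.map_mul, hcc, hca, hG])
    (by
      have h1 : (e.map C).map (C.comp (algebraMap B[X] S[X])) =
          (e.map (C.comp (algebraMap B S))).map C := by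
        ext1 i j
        show C ((C (e i j)).map (algebraMap B S)) = C (C (algebraMap B S (e i j)))
        rw [map_C]
      have he' : e.map (C.comp (algebraMap B S)) * G' = G' * e.map (C.comp (algebraMap B S)) := by
        have := CommEquiv.symm ⟨G, G', hG, he, hv⟩
        calc e.map (C.comp (algebraMap B S)) * G' =
              (G' * G) * (e.map (C.comp (algebraMap B S)) * G') := by rw [hG', Matrix.one_mul]
          _ = G' * (G * e.map (C.comp (algebraMap B S))) * G' := by
              simp only [Matrix.mul_assoc]
          _ = G' * e.map (C.comp (algebraMap B S)) * (G * G') := by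
              rw [← he]; simp only [Matrix.mul_assoc]
          _ = _ := by rw [hG, Matrix.mul_one]
      rw [h1, ← Matrix.mul_assoc, ← heσ, ← Matrix.map_mul, he, Matrix.map_mul, heσ,
        Matrix.mul_assoc, ← Matrix.map_mul, he', Matrix.map_mul, Matrix.mul_assoc])
    (by
      have h1 : (fun i => (addVar B (v i)).map (algebraMap B[X] S[X])) =
          addVar S ∘ fun i => (v i).map (algebraMap B S) := by
        funext i; exact hmap _
      have h2 : ∀ M : Matrix ι ι S[X], ∀ w : ι → S[X], (addVar S ∘ w) ᵥ* M.map (addVar S) =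
          addVar S ∘ (w ᵥ* M) := fun M w => by
        funext i; exact (RingHom.map_vecMul _ _ _ _).symm
      have h3 : ∀ M : Matrix ι ι S[X], ∀ w : ι → S[X], (C ∘ w) ᵥ* M.map C =
          C ∘ (w ᵥ* M) := fun M w => by
        funext i; exact (RingHom.map_vecMul _ _ _ _).symm
      have h4 : (addVar S ∘ fun i => C (algebraMap B S ((v i).coeff 0))) =
          C ∘ fun i => C (algebraMap B S ((v i).coeff 0)) := by
        funext i; exact addVar_C _
      rw [h1, ← vecMul_vecMul, h2, hv, h4, h3, ← hv, vecMul_vecMul, hG, vecMul_one]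
      funext i
      have := constantCoeff_addVar (v i)
      rw [constantCoeff_apply] at this
      rw [this]
      rfl)
  refine ⟨s, hs, fun x y => ?_⟩
  let η : B[X][X] →+* B[X] := eval₂RingHom (compRingHom x) y
  have h1 : ∀ p : B[X], η ((addVar B p).comp (C (C s) * X)) = p.comp (x + C s * y) := fun p => by
    have : (η.comp (compRingHom (C (C s) * X))).comp (addVar B) = compRingHom (x + C s * y) := by
      ext <;> simp [η, addVar, compRingHom]
    exact congrFun (congrArg DFunLike.coe this) p
  have h2 : ∀ p : B[X], η (C ((addVar B p).coeff 0)) = p.comp x := fun p => by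
    have := constantCoeff_addVar p
    rw [constantCoeff_apply] at this
    rw [this]
    simp [η, compRingHom, Polynomial.comp]
  have h3 : ((e.map C).map C).map η = e.map C := by
    ext1 i j
    simp [η, compRingHom]
  have := hcomm.map η
  rw [h3] at this
  convert this using 1
  · funext i; exact (h1 _).symm
  · funext i; exact (h2 _).symm

/-- The local-global principle for rows over a polynomial ring in one variable. -/
theorem CommEquiv.of_forall_isMaximal (e : Matrix ι ι B) (v : ι → B[X])
    (h : ∀ m : Ideal B, ∀ _ : m.IsMaximal,
      CommEquiv (e.map (C.comp (algebraMap B (Localization.AtPrime m))))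
        (fun i => (v i).map (algebraMap B (Localization.AtPrime m)))
        (fun i => C (algebraMap B (Localization.AtPrime m) ((v i).coeff 0)))) :
    CommEquiv (e.map C) v (fun i => C ((v i).coeff 0)) := by
  have h1 : quillenIdeal e v = ⊤ := by
    by_contra hne
    obtain ⟨m, hm, hle⟩ := Ideal.exists_le_maximal _ hne
    obtain ⟨s, hs, hsq⟩ := exists_mem_quillenIdeal e v m.primeCompl (Localization.AtPrime m)
      (h m hm)
    exact hs (hle hsq)
  have h2 : (1 : B) ∈ quillenIdeal e v := h1 ▸ Submodule.mem_top
  have h3 := h2 0 X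
  simpa [comp_zero, ← coeff_zero_eq_eval_zero] using h3

end LocalGlobal

section MvLocalGlobal

variable {ι σ B : Type*} [Fintype ι] [DecidableEq ι] [CommRing B]

/-- The homomorphism `p ↦ p(TX)` introducing a homogenizing variable `T`. -/
noncomputable def scaleVars (σ B : Type*) [CommRing B] :
    MvPolynomial σ B →+* Polynomial (MvPolynomial σ B) :=
  MvPolynomial.eval₂Hom (Polynomial.C.comp MvPolynomial.C)
    fun i => Polynomial.X * Polynomial.C (MvPolynomial.X i)

theorem scaleVars_C (b : B) : scaleVars σ B (MvPolynomial.C b) =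
    Polynomial.C (MvPolynomial.C b) := by simp [scaleVars]

theorem coeff_zero_scaleVars (p : MvPolynomial σ B) :
    (scaleVars σ B p).coeff 0 = MvPolynomial.C (MvPolynomial.constantCoeff p) := by
  have : (Polynomial.constantCoeff).comp (scaleVars σ B) =
      MvPolynomial.C.comp MvPolynomial.constantCoeff := by
    ext <;> simp [scaleVars]
  exact congrFun (congrArg DFunLike.coe this) p

theorem eval_one_scaleVars (p : MvPolynomial σ B) : (scaleVars σ B p).eval 1 = p := by
  have : (Polynomial.evalRingHom 1).comp (scaleVars σ B) = RingHom.id _ := by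
    ext <;> simp [scaleVars]
  exact congrFun (congrArg DFunLike.coe this) p

/-- The local-global principle for rows over a polynomial ring in several variables. -/
theorem CommEquiv.of_forall_isPrime (e : Matrix ι ι B) (v : ι → MvPolynomial σ B)
    (h : ∀ p : Ideal B, ∀ _ : p.IsPrime,
      CommEquiv (e.map (MvPolynomial.C.comp (algebraMap B (Localization.AtPrime p))))
        (fun i => MvPolynomial.map (algebraMap B (Localization.AtPrime p)) (v i))
        (fun i => MvPolynomial.C (algebraMap B (Localization.AtPrime p)
          (MvPolynomial.constantCoeff (v i))))) :
    CommEquiv (e.map MvPolynomial.C) v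
      (fun i => MvPolynomial.C (MvPolynomial.constantCoeff (v i))) := by
  have key := CommEquiv.of_forall_isMaximal (e.map MvPolynomial.C)
    (fun i => scaleVars σ B (v i)) fun m hm => by
      let p : Ideal B := m.comap MvPolynomial.C
      have hp : p.IsPrime := inferInstance
      let S := Localization.AtPrime m
      let g : Localization.AtPrime p →+* S := Localization.localRingHom p m MvPolynomial.C rfl
      have hg : ∀ b : B, g (algebraMap B (Localization.AtPrime p) b) =
          algebraMap (MvPolynomial σ B) S (MvPolynomial.C b) := fun b =>
        Localization.localRingHom_to_map p m MvPolynomial.C rfl b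
      let f : MvPolynomial σ (Localization.AtPrime p) →+* Polynomial S :=
        MvPolynomial.eval₂Hom (Polynomial.C.comp g)
          fun i => Polynomial.X * Polynomial.C (algebraMap (MvPolynomial σ B) S (MvPolynomial.X i))
      have hfC : ∀ b : B, f (MvPolynomial.C (algebraMap B (Localization.AtPrime p) b)) =
          Polynomial.C (algebraMap (MvPolynomial σ B) S (MvPolynomial.C b)) := fun b => by
        rw [← hg]; simp only [f, MvPolynomial.coe_eval₂Hom, MvPolynomial.eval₂_C]; rfl
      have hf : ∀ q : MvPolynomial σ B,
          f (MvPolynomial.map (algebraMap B (Localization.AtPrime p)) q) =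
            (scaleVars σ B q).map (algebraMap (MvPolynomial σ B) S) := fun q => by
        have : f.comp (MvPolynomial.map (algebraMap B (Localization.AtPrime p))) =
            (Polynomial.mapRingHom (algebraMap (MvPolynomial σ B) S)).comp (scaleVars σ B) := by
          apply MvPolynomial.ringHom_ext
          · intro b
            rw [RingHom.comp_apply, MvPolynomial.map_C, hfC, RingHom.comp_apply, scaleVars_C,
              Polynomial.coe_mapRingHom, Polynomial.map_C]
          · intro i
            simp [f, scaleVars]
        exact congrFun (congrArg DFunLike.coe this) q
      have := CommEquiv.map (S := Polynomial S) (h p hp) f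
      have e1 : (e.map (MvPolynomial.C.comp (algebraMap B (Localization.AtPrime p)))).map f =
          (e.map MvPolynomial.C).map (Polynomial.C.comp (algebraMap (MvPolynomial σ B) S)) := by
        ext1 i j; exact hfC _
      rw [e1] at this
      convert this using 1
      · funext i; exact (hf _).symm
      · funext i
        rw [coeff_zero_scaleVars]
        exact (hfC _).symm
  have := key.map (Polynomial.evalRingHom 1)
  have e1 : ((e.map MvPolynomial.C).map Polynomial.C).map (Polynomial.evalRingHom 1) =
      e.map (MvPolynomial.C (σ := σ)) := by
    ext1 i j; simp
  rw [e1] at this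
  convert this using 1
  · funext i; exact (eval_one_scaleVars _).symm
  · funext i
    simp only [coeff_zero_scaleVars, Function.comp_apply, Polynomial.coe_evalRingHom,
      Polynomial.eval_C]

end MvLocalGlobal

section MvPolynomialRows


theorem HeightLE.of_isLocalization {R : Type*} [CommRing R] {e : ℕ} (h : HeightLE R e)
    (M : Submonoid R) (S : Type*) [CommRing S] [Algebra R S] [IsLocalization M S] :
    HeightLE S e := by
  intro P hP
  rw [← IsLocalization.height_under M]
  exact h _ inferInstance

section

variable {ι R : Type*} [Fintype ι] [DecidableEq ι] [CommRing R]

theorem CommEquiv.completable {e : Matrix ι ι R} {v w : ι → R} (h : CommEquiv e v w)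
    (hw : Completable w) : Completable v := by
  obtain ⟨g, g', hg, _, rfl⟩ := h
  obtain ⟨M, N, hMN, i, hi⟩ := hw
  refine ⟨M * g', g * N, ?_, i, ?_⟩
  · rw [Matrix.mul_assoc, ← Matrix.mul_assoc g', mul_eq_one_comm.mp hg, Matrix.one_mul, hMN]
  · have : (M * g') i = M i ᵥ* g' := by funext j; rfl
    rw [this, hi, vecMul_vecMul, hg, vecMul_one]

theorem Completable.of_ringEquiv {S : Type*} [CommRing S] (e : R ≃+* S) {v : ι → R}
    (h : Completable (e.toRingHom ∘ v)) : Completable v := by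
  have := h.map e.symm.toRingHom
  convert this using 1
  funext i
  exact (e.symm_apply_apply _).symm

theorem commEquiv_one_single (i j : ι) :
    CommEquiv (1 : Matrix ι ι R) (Pi.single i 1) (Pi.single j 1) := by
  refine ⟨(Equiv.swap i j).permMatrix R, (Equiv.swap i j).permMatrix R, ?_, by simp, ?_⟩
  · rw [← permMatrix_mul, Equiv.swap_mul_self]; simp
  · funext k
    simp [Matrix.single_vecMul, Equiv.Perm.permMatrix, PEquiv.toMatrix_apply, Pi.single_apply,
      eq_comm]

theorem Completable.commEquiv_one {v w : ι → R} (hv : Completable v) (hw : Completable w) :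
    CommEquiv 1 v w := by
  have key : ∀ {u : ι → R}, Completable u → ∃ i, CommEquiv 1 u (Pi.single i 1) := fun hu => by
    obtain ⟨M, N, h, i, hi⟩ := hu.exists_vecMul
    exact ⟨i, M, N, h, by simp, hi⟩
  obtain ⟨i, hi⟩ := key hv
  obtain ⟨j, hj⟩ := key hw
  exact hi.trans ((commEquiv_one_single i j).trans hj.symm)

theorem completable_of_le_one {d : ℕ} (hd : d ≤ 1) {v : Fin (d + 1) → R} (hv : Unimod v) :
    Completable v := by
  obtain ⟨w, hw⟩ := hv
  interval_cases d
  · refine ⟨of ![v], of ![w], ?_, 0, ?_⟩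
    · ext1 i j
      fin_cases i; fin_cases j
      simpa [Matrix.mul_apply, dotProduct] using hw
    · rfl
  · simp only [dotProduct, Fin.sum_univ_succ, Fin.isValue, Fin.succ_zero_eq_one] at hw
    simp at hw
    refine ⟨!![v 0, v 1; -w 1, w 0], !![w 0, -v 1; w 1, v 0], ?_, 0, ?_⟩
    · ext1 i j
      fin_cases i <;> fin_cases j <;> simp [Matrix.mul_apply, Fin.sum_univ_two]
      · exact hw
      · ring
      · ring
      · linear_combination hw
    · funext j
      fin_cases j <;> rfl

theorem commEquiv_constantCoeff_of_completable {σ : Type*} {v : ι → MvPolynomial σ R}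
    (h : ∀ p : Ideal R, ∀ _ : p.IsPrime,
      Completable fun i => MvPolynomial.map (algebraMap R (Localization.AtPrime p)) (v i)) :
    CommEquiv 1 v (fun i => MvPolynomial.C (MvPolynomial.constantCoeff (v i))) := by
  have := CommEquiv.of_forall_isPrime (1 : Matrix ι ι R) v fun p hp => by
    have h1 := h p hp
    have h2 := h1.map ((MvPolynomial.C (σ := σ)).comp
      (MvPolynomial.constantCoeff (σ := σ) (R := Localization.AtPrime p)))
    rw [Matrix.map_one _ (map_zero _) (map_one _)]
    refine h1.commEquiv_one ?_
    convert h2 using 1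
    funext i
    simp [MvPolynomial.constantCoeff_map]
  rwa [Matrix.map_one _ (map_zero _) (map_one _)] at this

theorem completable_of_localization {v : ι → Polynomial R}
    (h : ∀ p : Ideal R, ∀ _ : p.IsMaximal,
      Completable fun i => (v i).map (algebraMap R (Localization.AtPrime p)))
    (h0 : Completable fun i => (v i).coeff 0) : Completable v := by
  have := CommEquiv.of_forall_isMaximal (1 : Matrix ι ι R) v fun p hp => by
    have h1 := h p hp
    have h2 := h0.map (Polynomial.C.comp (algebraMap R (Localization.AtPrime p)))
    rw [Matrix.map_one _ (map_zero _) (map_one _)]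
    exact h1.commEquiv_one h2
  exact this.completable (h0.map Polynomial.C)

end

section

open Polynomial

variable {σ A : Type*} [CommRing A]

/-- Moving the last variable of a polynomial into the coefficients. -/
noncomputable def toMvMonicLoc (σ A : Type*) [CommRing A] :
    (MvPolynomial σ A)[X] →+* MvPolynomial σ (MonicLoc A) :=
  eval₂RingHom (MvPolynomial.map ((algebraMap A[X] (MonicLoc A)).comp C))
    (MvPolynomial.C (algebraMap A[X] (MonicLoc A) X))

/-- The comparison map to the localization at polynomials monic in the last variable. -/
noncomputable def ofMvMonicLoc (σ A : Type*) [CommRing A] :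
    MvPolynomial σ (MonicLoc A) →+* MonicLoc (MvPolynomial σ A) :=
  MvPolynomial.eval₂Hom (MonicLoc.map MvPolynomial.C)
    fun i => algebraMap (MvPolynomial σ A)[X] _ (C (MvPolynomial.X i))

theorem ofMvMonicLoc_toMvMonicLoc (p : (MvPolynomial σ A)[X]) :
    ofMvMonicLoc σ A (toMvMonicLoc σ A p) = algebraMap _ _ p := by
  have : (ofMvMonicLoc σ A).comp (toMvMonicLoc σ A) =
      algebraMap (MvPolynomial σ A)[X] (MonicLoc (MvPolynomial σ A)) := by
    apply Polynomial.ringHom_ext'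
    · apply MvPolynomial.ringHom_ext
      · intro a
        simp [ofMvMonicLoc, toMvMonicLoc, MonicLoc.map_algebraMap]
      · intro i
        simp [ofMvMonicLoc, toMvMonicLoc]
    · simp [ofMvMonicLoc, toMvMonicLoc, MonicLoc.map_algebraMap]
  exact congrFun (congrArg DFunLike.coe this) p

theorem constantCoeff_toMvMonicLoc (p : (MvPolynomial σ A)[X]) :
    MvPolynomial.constantCoeff (toMvMonicLoc σ A p) =
      algebraMap A[X] (MonicLoc A) (p.map MvPolynomial.constantCoeff) := by
  have : MvPolynomial.constantCoeff.comp (toMvMonicLoc σ A) =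
      (algebraMap A[X] (MonicLoc A)).comp (mapRingHom MvPolynomial.constantCoeff) := by
    apply Polynomial.ringHom_ext'
    · apply MvPolynomial.ringHom_ext
      · intro a
        simp [toMvMonicLoc]
      · intro i
        simp [toMvMonicLoc]
    · simp [toMvMonicLoc]
  exact congrFun (congrArg DFunLike.coe this) p

set_option maxSynthPendingDepth 6 in
theorem completable_monicLoc_mvPolynomial {ι : Type*} [Fintype ι] [DecidableEq ι]
    {v : ι → (MvPolynomial σ A)[X]}
    (h0 : Completable fun i => (v i).map MvPolynomial.constantCoeff)
    (h : ∀ p : Ideal (MonicLoc A), ∀ _ : p.IsPrime, Completable fun i =>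
      MvPolynomial.map (algebraMap (MonicLoc A) (Localization.AtPrime p))
        (toMvMonicLoc σ A (v i))) :
    Completable (algebraMap (MvPolynomial σ A)[X] (MonicLoc (MvPolynomial σ A)) ∘ v) := by
  have hα := commEquiv_constantCoeff_of_completable h
  simp only [constantCoeff_toMvMonicLoc] at hα
  have h1 := (hα.completable
    (h0.map (MvPolynomial.C.comp (algebraMap A[X] (MonicLoc A))))).map (ofMvMonicLoc σ A)
  convert h1 using 1
  funext i
  exact (ofMvMonicLoc_toMvMonicLoc _).symm

end

theorem isUnit_natCast_map {R S : Type*} [CommRing R] [CommRing S] (f : R →+* S) {n : ℕ}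
    (h : IsUnit (n : R)) : IsUnit (n : S) := by
  have := h.map f
  rwa [map_natCast] at this

set_option maxSynthPendingDepth 6 in
/-- Unimodular rows of length `d + 1` over polynomial rings over a local ring of dimension at
most `d` are completable when `d!` is invertible. -/
theorem completable_mvPolynomial {d : ℕ} (n : ℕ) : ∀ (A : Type u) [CommRing A]
    [IsNoetherianRing A] [IsLocalRing A], HeightLE A d → IsUnit ((d.factorial : ℕ) : A) →
    ∀ v : Fin (d + 1) → MvPolynomial (Fin n) A, Unimod v → Completable v := by
  rcases le_or_gt d 1 with hd | hd
  · exact fun A _ _ _ _ _ v hv => completable_of_le_one hd hv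
  have hnt : Nontrivial (Fin (d + 1)) := Fin.nontrivial_iff_two_le.mpr (by omega)
  induction n with
  | zero =>
    intro A _ _ _ _ _ v hv
    have e := (MvPolynomial.isEmptyAlgEquiv A (Fin 0)).toRingEquiv
    refine Completable.of_ringEquiv e ?_
    have := (hv.map e.toRingHom).rowEquiv_single_of_isLocalRing 0
    refine Completable.of_rowEquiv ⟨1, 1, by simp, 0, ?_⟩ this.symm
    funext j
    simp [Matrix.one_apply, Pi.single_apply, eq_comm]
  | succ n ih =>
    intro A _ _ _ hA hf v hv
    let D := MvPolynomial (Fin n) A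
    let e := (MvPolynomial.finSuccEquiv A n).toRingEquiv
    suffices h : ∀ v : Fin (d + 1) → Polynomial D, Unimod v → Completable v from
      Completable.of_ringEquiv e (h _ (hv.map e.toRingHom))
    clear hv v
    intro v hv
    have h0 : Completable (fun i => (v i).map (MvPolynomial.constantCoeff)) :=
      completable_polynomial hA hd hf
        (hv.map (Polynomial.mapRingHom (MvPolynomial.constantCoeff (σ := Fin n) (R := A))))
    have h2 : Completable (algebraMap (Polynomial D) (MonicLoc D) ∘ v) :=
      completable_monicLoc_mvPolynomial h0 fun p hp =>
        ih (Localization.AtPrime p) (hA.monicLoc.of_isLocalization p.primeCompl _)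
          (isUnit_natCast_map (algebraMap (MonicLoc A) _)
            (isUnit_natCast_map ((algebraMap (Polynomial A) (MonicLoc A)).comp Polynomial.C) hf))
          _ ((hv.map (toMvMonicLoc (Fin n) A)).map
            (MvPolynomial.map (algebraMap (MonicLoc A) (Localization.AtPrime p))))
    refine completable_of_localization (fun p hp => ?_)
      (ih A hA hf _ (hv.map (Polynomial.constantCoeff (R := D))))
    refine completable_of_monicLoc (by simp; omega)
      (hv.map (Polynomial.mapRingHom (algebraMap D (Localization.AtPrime p)))) ?_
    convert h2.map (MonicLoc.map (algebraMap D (Localization.AtPrime p))) using 1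
    funext i
    exact (MonicLoc.map_algebraMap _ _).symm

end MvPolynomialRows

section DualBasis

open TensorProduct


theorem Module.exists_dual_system (R M : Type*) [CommRing R] [AddCommGroup M] [Module R M]
    [Module.Finite R M] [Module.Projective R M] :
    ∃ (m : ℕ) (x : Fin m → M) (ξ : Fin m → M →ₗ[R] R), ∀ q, ∑ i, ξ i q • x i = q := by
  obtain ⟨m, f, g, -, -, h⟩ := Module.Finite.exists_comp_eq_id_of_projective R M
  refine ⟨m, fun i => f (Pi.single i 1), fun i => LinearMap.proj i ∘ₗ g, fun q => ?_⟩
  conv_rhs => rw [show q = f (g q) from (LinearMap.congr_fun h q).symm, pi_eq_sum_univ' (g q)]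
  simp [map_sum]

section

variable {ι κ R M : Type*} [Fintype ι] [DecidableEq ι] [Fintype κ] [DecidableEq κ]
  [CommRing R] [AddCommGroup M] [Module R M]

theorem CommEquiv.of_splitting {e : Matrix ι ι R} {α : Matrix κ ι R} {β : Matrix ι κ R}
    (h : β * α = e) (h1 : α * β = 1) {v w : ι → R} (hv : v ᵥ* e = v) (hw : w ᵥ* e = w)
    (H : CommEquiv 1 (v ᵥ* β) (w ᵥ* β)) : CommEquiv e v w := by
  obtain ⟨g, g', hg, -, hgw⟩ := H
  have hαe : α * e = α := by rw [← h, ← Matrix.mul_assoc, h1, Matrix.one_mul]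
  have heβ : e * β = β := by rw [← h, Matrix.mul_assoc, h1, Matrix.mul_one]
  have he : e * e = e := by
    nth_rw 2 [← h]; rw [← Matrix.mul_assoc, heβ, h]
  have el : ∀ k : Matrix κ κ R, e * (β * k * α + (1 - e)) = β * k * α := fun k => by
    rw [Matrix.mul_add, Matrix.mul_sub, he, Matrix.mul_one, sub_self, add_zero,
      ← Matrix.mul_assoc, ← Matrix.mul_assoc, heβ]
  have er : ∀ k : Matrix κ κ R, (β * k * α + (1 - e)) * e = β * k * α := fun k => by
    rw [Matrix.add_mul, Matrix.sub_mul, he, Matrix.one_mul, sub_self, add_zero,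
      Matrix.mul_assoc, hαe]
  refine ⟨β * g * α + (1 - e), β * g' * α + (1 - e), ?_, ?_, ?_⟩
  · have h2 : (β * g * α) * (β * g' * α) = e := by
      calc (β * g * α) * (β * g' * α) = β * (g * (α * β) * g') * α := by
            simp only [Matrix.mul_assoc]
        _ = e := by rw [h1, Matrix.mul_one, hg, Matrix.mul_one, h]
    have h3 : β * g * α * e = β * g * α := by rw [Matrix.mul_assoc, hαe]
    rw [Matrix.mul_add, Matrix.mul_sub, er, Matrix.mul_one, Matrix.add_mul, h2, Matrix.sub_mul,
      Matrix.one_mul, ← Matrix.mul_assoc e, ← Matrix.mul_assoc e, heβ]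
    abel
  · rw [el, er]
  · rw [vecMul_add, vecMul_sub, vecMul_one, hv, sub_self, add_zero, ← vecMul_vecMul,
      ← vecMul_vecMul, hgw, vecMul_vecMul, h, hw]

/-- The Gram matrix of a dual system. -/
def gramMatrix (x : ι → M) (ξ : ι → M →ₗ[R] R) : Matrix ι ι R := of fun i j => ξ i (x j)

theorem vecMul_gramMatrix {x : ι → M} {ξ : ι → M →ₗ[R] R} (hx : ∀ q, ∑ i, ξ i q • x i = q)
    (φ : M →ₗ[R] R) : (fun i => φ (x i)) ᵥ* gramMatrix x ξ = fun i => φ (x i) := by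
  funext j
  conv_rhs => rw [← hx (x j), map_sum]
  simp [vecMul, dotProduct, gramMatrix, mul_comm]

/-- The endomorphism attached to a matrix by a dual system. -/
def endOfMatrix (x : ι → M) (ξ : ι → M →ₗ[R] R) (g : Matrix ι ι R) : M →ₗ[R] M :=
  ∑ i, ∑ j, (g i j • ξ j).smulRight (x i)

theorem endOfMatrix_apply (x : ι → M) (ξ : ι → M →ₗ[R] R) (g : Matrix ι ι R) (q : M) :
    endOfMatrix x ξ g q = ∑ i, (g *ᵥ fun j => ξ j q) i • x i := by
  simp [endOfMatrix, mulVec, dotProduct, Finset.sum_smul]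

theorem coord_endOfMatrix (x : ι → M) (ξ : ι → M →ₗ[R] R) (g : Matrix ι ι R) (q : M) :
    (fun i => ξ i (endOfMatrix x ξ g q)) = (gramMatrix x ξ * g) *ᵥ fun j => ξ j q := by
  funext i
  rw [endOfMatrix_apply, map_sum, ← mulVec_mulVec]
  simp [mulVec, dotProduct, gramMatrix, mul_comm]

theorem endOfMatrix_endOfMatrix {x : ι → M} {ξ : ι → M →ₗ[R] R}
    (hx : ∀ q, ∑ i, ξ i q • x i = q) {g h : Matrix ι ι R} (hgh : g * h = 1)
    (hg : gramMatrix x ξ * g = g * gramMatrix x ξ) (q : M) :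
    endOfMatrix x ξ g (endOfMatrix x ξ h q) = q := by
  rw [endOfMatrix_apply, coord_endOfMatrix, mulVec_mulVec, ← Matrix.mul_assoc, ← hg,
    Matrix.mul_assoc, hgh, Matrix.mul_one]
  have : gramMatrix x ξ *ᵥ (fun j => ξ j q) = fun j => ξ j q := by
    funext i
    conv_rhs => rw [← hx q, map_sum]
    simp [mulVec, dotProduct, gramMatrix, mul_comm]
  rw [this, hx]

theorem CommEquiv.exists_linearEquiv {x : ι → M} {ξ : ι → M →ₗ[R] R}
    (hx : ∀ q, ∑ i, ξ i q • x i = q) {φ ψ : M →ₗ[R] R}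
    (h : CommEquiv (gramMatrix x ξ) (fun i => φ (x i)) (fun i => ψ (x i))) :
    ∃ Γ : M ≃ₗ[R] M, φ ∘ₗ Γ = ψ := by
  obtain ⟨g, g', h1, he, hφ⟩ := h
  have h2 := mul_eq_one_comm.mp h1
  have he' : gramMatrix x ξ * g' = g' * gramMatrix x ξ :=
    (show Commute (gramMatrix x ξ) ((⟨g, g', h1, h2⟩ : (Matrix ι ι R)ˣ) : Matrix ι ι R)
      from he).units_inv_right
  refine ⟨LinearEquiv.ofLinearMap (endOfMatrix x ξ g) (endOfMatrix x ξ g')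
    (LinearMap.ext fun q => endOfMatrix_endOfMatrix hx h1 he q)
    (LinearMap.ext fun q => endOfMatrix_endOfMatrix hx h2 he' q), LinearMap.ext fun q => ?_⟩
  show φ (endOfMatrix x ξ g q) = ψ q
  conv_rhs => rw [← hx q, map_sum]
  rw [endOfMatrix_apply, map_sum]
  have h3 : ∑ i, φ ((g *ᵥ fun j => ξ j q) i • x i) =
      ((fun i => φ (x i)) ᵥ* g) ⬝ᵥ fun j => ξ j q := by
    rw [← dotProduct_mulVec]
    simp [dotProduct, mul_comm]
  rw [h3, hφ]
  simp [dotProduct, mul_comm]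

/-- A basis of a scalar extension splits the Gram matrix of a dual system. -/
theorem exists_splitting_of_basis {x : ι → M} {ξ : ι → M →ₗ[R] R}
    (hx : ∀ q, ∑ i, ξ i q • x i = q) {S : Type*} [CommRing S] [Algebra R S]
    (b : Module.Basis κ S (S ⊗[R] M)) :
    ∃ (α : Matrix κ ι S) (β : Matrix ι κ S),
      β * α = (gramMatrix x ξ).map (algebraMap R S) ∧ α * β = 1 := by
  let η : ι → S ⊗[R] M →ₗ[S] S := fun i =>
    ((Algebra.linearMap R S).comp (ξ i)).liftBaseChange S
  have hη : ∀ y : S ⊗[R] M, ∑ i, η i y • (1 : S) ⊗ₜ[R] x i = y := fun y => by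
    induction y with
    | zero => simp
    | add a b ha hb => simp only [map_add, add_smul, Finset.sum_add_distrib, ha, hb]
    | tmul s q =>
      conv_rhs => rw [← hx q, tmul_sum]
      refine Finset.sum_congr rfl fun i _ => ?_
      simp only [η, LinearMap.liftBaseChange_tmul, tmul_smul, smul_tmul']
      simp [Algebra.smul_def, mul_comm]
  refine ⟨of fun k i => b.repr ((1 : S) ⊗ₜ[R] x i) k, of fun i k => η i (b k), ?_, ?_⟩
  · ext1 i j
    have := congrArg (η i) (b.sum_repr ((1 : S) ⊗ₜ[R] x j))
    rw [map_sum] at this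
    simp only [map_smul, smul_eq_mul] at this
    simp only [Matrix.mul_apply, of_apply, mul_comm (η i _)]
    rw [this]
    simp [η, gramMatrix]
  · ext1 k l
    have := congrArg (fun y => b.repr y k) (hη (b l))
    simp only [map_sum, map_smul, Finsupp.coe_finsetSum, Finset.sum_apply, Finsupp.smul_apply,
      smul_eq_mul, Module.Basis.repr_self] at this
    simp only [Matrix.mul_apply, of_apply, mul_comm _ (η _ _)]
    rw [this, Finsupp.single_apply, Matrix.one_apply]
    simp [eq_comm]

end

end DualBasis

section FinalStep

open TensorProduct


theorem commEquiv_constantCoeff_of_rankAtStalk {A Q : Type u} [CommRing A] [IsNoetherianRing A]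
    {d n : ℕ} (hA : HeightLE A d) (hf : IsUnit ((d.factorial : ℕ) : A))
    [AddCommGroup Q] [Module A Q] [Module.Finite A Q] [Module.Projective A Q]
    (hQ : ∀ p, Module.rankAtStalk (R := A) Q p = d + 1) {ι : Type*} [Fintype ι] [DecidableEq ι]
    {x : ι → Q} {ξ : ι → Q →ₗ[A] A} (hx : ∀ q, ∑ i, ξ i q • x i = q)
    {v : ι → MvPolynomial (Fin n) A} (hv : Unimod v)
    (hve : v ᵥ* (gramMatrix x ξ).map MvPolynomial.C = v) :
    CommEquiv ((gramMatrix x ξ).map MvPolynomial.C) v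
      (fun i => MvPolynomial.C (MvPolynomial.constantCoeff (v i))) := by
  refine CommEquiv.of_forall_isPrime _ _ fun p hp => ?_
  let S := Localization.AtPrime p
  let R := MvPolynomial (Fin n) S
  have hb : Module.finrank S (S ⊗[A] Q) = d + 1 := by
    have := hQ ⟨p, hp⟩
    rwa [Module.rankAtStalk_eq_finrank_tensorProduct] at this
  have : Module.Free S (S ⊗[A] Q) := Module.free_of_flat_of_isLocalRing
  obtain ⟨α, β, h1, h2⟩ := exists_splitting_of_basis hx (Module.finBasisOfFinrankEq S _ hb)
  let f : MvPolynomial (Fin n) A →+* R := MvPolynomial.map (algebraMap A S)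
  let cc : R →+* R := MvPolynomial.C.comp MvPolynomial.constantCoeff
  let C' : S →+* R := MvPolynomial.C
  have hcc : ∀ s, cc (C' s) = C' s := fun s =>
    congrArg MvPolynomial.C (MvPolynomial.constantCoeff_C (Fin n) s)
  have he : ((gramMatrix x ξ).map MvPolynomial.C).map f =
      (gramMatrix x ξ).map (C'.comp (algebraMap A S)) := by
    ext1 i j
    exact MvPolynomial.map_C _ _
  have hw : (f ∘ v) ᵥ* (gramMatrix x ξ).map (C'.comp (algebraMap A S)) = f ∘ v := by
    rw [← he]
    funext j
    rw [← RingHom.map_vecMul, hve]; rfl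
  have hec : ((gramMatrix x ξ).map (C'.comp (algebraMap A S))).map cc =
      (gramMatrix x ξ).map (C'.comp (algebraMap A S)) := by
    ext1 i j; exact hcc _
  have hβc : (β.map C').map cc = β.map C' := by
    ext1 i j; exact hcc _
  have hw0 : (cc ∘ f ∘ v) ᵥ* (gramMatrix x ξ).map (C'.comp (algebraMap A S)) = cc ∘ f ∘ v := by
    rw [← hec]
    funext j
    rw [← RingHom.map_vecMul, hw]; rfl
  have hu : Unimod ((f ∘ v) ᵥ* β.map C') := by
    obtain ⟨w, hw'⟩ := hv.map f
    refine ⟨α.map C' *ᵥ w, ?_⟩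
    rw [dotProduct_mulVec, vecMul_vecMul, ← Matrix.map_mul, h1, ← hw']
    congr 1
  have hc : Completable ((f ∘ v) ᵥ* β.map C') :=
    completable_mvPolynomial n S (hA.of_isLocalization p.primeCompl S)
      (isUnit_natCast_map (algebraMap A S) hf) _ hu
  have hc0 : (cc ∘ f ∘ v) ᵥ* β.map C' = cc ∘ ((f ∘ v) ᵥ* β.map C') := by
    rw [← hβc]
    funext j
    rw [← RingHom.map_vecMul, hβc]; rfl
  have key := CommEquiv.of_splitting (e := (gramMatrix x ξ).map (C'.comp (algebraMap A S)))
    (α := α.map C') (β := β.map C')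
    (by rw [← Matrix.map_mul, h1]; rfl)
    (by rw [← Matrix.map_mul, h2, Matrix.map_one _ (map_zero _) (map_one _)])
    hw hw0 (hc.commEquiv_one (hc0 ▸ hc.map cc))
  have hcf : cc ∘ f ∘ v = fun i => MvPolynomial.C (algebraMap A S
      (MvPolynomial.constantCoeff (v i))) :=
    funext fun i => congrArg MvPolynomial.C (MvPolynomial.constantCoeff_map (algebraMap A S) (v i))
  rw [hcf] at key
  exact key

theorem Module.Projective.ker_of_surjective {A Q : Type*} [CommRing A] [AddCommGroup Q] [Module A Q]
    [Module.Projective A Q] {φ : Q →ₗ[A] A} (h : Function.Surjective φ) :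
    Module.Projective A (LinearMap.ker φ) := by
  obtain ⟨q, hq⟩ := h 1
  refine Module.Projective.of_split (LinearMap.ker φ).subtype
    ((LinearMap.id - φ.smulRight q).codRestrict _ fun y => by simp [hq]) ?_
  · refine LinearMap.ext fun y => Subtype.ext ?_
    show y.1 - φ y.1 • q = y.1
    rw [LinearMap.mem_ker.mp y.2, zero_smul, sub_zero]

theorem rankAtStalk_of_prod_equiv {A R P Q : Type u} [CommRing A] [CommRing R] [Algebra A R]
    [Nontrivial R] (ε : R →+* A) (hε : ε.comp (algebraMap A R) = RingHom.id A)
    [AddCommGroup P] [Module R P] [Module.Finite R P] [Module.Projective R P]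
    [AddCommGroup Q] [Module A Q] [Module.Finite A Q] [Module.Projective A Q] {d : ℕ}
    (hP : ∀ p, Module.rankAtStalk (R := R) P p = d) (Θ : (P × R) ≃ₗ[R] R ⊗[A] Q)
    (p : PrimeSpectrum A) : Module.rankAtStalk (R := A) Q p = d + 1 := by
  have h1 := Module.rankAtStalk_baseChange (R := A) (M := Q) (S := R) (PrimeSpectrum.comap ε p)
  rw [← Module.rankAtStalk_eq_of_equiv Θ, Module.rankAtStalk_prod, Pi.add_apply, hP,
    Module.rankAtStalk_self, ← PrimeSpectrum.comap_comp_apply, hε] at h1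
  exact h1.symm

theorem exists_ker_equiv_of_prod_equiv {A P Q : Type u} [CommRing A] [IsNoetherianRing A]
    {d n : ℕ} (hA : HeightLE A d) (hf : IsUnit ((d.factorial : ℕ) : A))
    [AddCommGroup P] [Module (MvPolynomial (Fin n) A) P]
    [AddCommGroup Q] [Module A Q] [Module.Finite A Q] [Module.Projective A Q]
    (hQ : ∀ p, Module.rankAtStalk (R := A) Q p = d + 1)
    (Θ : (P × MvPolynomial (Fin n) A) ≃ₗ[MvPolynomial (Fin n) A] MvPolynomial (Fin n) A ⊗[A] Q) :
    ∃ φ : Q →ₗ[A] A, Function.Surjective φ ∧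
      Nonempty (P ≃ₗ[MvPolynomial (Fin n) A] MvPolynomial (Fin n) A ⊗[A] LinearMap.ker φ) := by
  let R := MvPolynomial (Fin n) A
  obtain ⟨m, x, ξ, hx⟩ := Module.exists_dual_system A Q
  let φ : R ⊗[A] Q →ₗ[R] R := LinearMap.snd R P R ∘ₗ Θ.symm.toLinearMap
  let φ₀ : Q →ₗ[A] A :=
    { toFun := fun q => MvPolynomial.constantCoeff (φ (1 ⊗ₜ q))
      map_add' := fun a b => by rw [tmul_add, map_add, map_add]
      map_smul' := fun a q => by
        rw [tmul_smul, ← algebraMap_smul R a, map_smul, smul_eq_mul, map_mul]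
        exact congrArg (· * _) (MvPolynomial.constantCoeff_C _ a) }
  let ψ : R ⊗[A] Q →ₗ[R] R :=
    (AlgebraTensorModule.rid A R R).toLinearMap ∘ₗ AlgebraTensorModule.lTensor R R φ₀
  let X : Fin m → R ⊗[A] Q := fun i => 1 ⊗ₜ x i
  let Ξ : Fin m → R ⊗[A] Q →ₗ[R] R := fun i =>
    (AlgebraTensorModule.rid A R R).toLinearMap ∘ₗ AlgebraTensorModule.lTensor R R (ξ i)
  have hX : ∀ y, ∑ i, Ξ i y • X i = y := fun y => by
    induction y with
    | zero => simp
    | add a b ha hb => simp only [map_add, add_smul, Finset.sum_add_distrib, ha, hb]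
    | tmul s q =>
      conv_rhs => rw [← hx q, tmul_sum]
      refine Finset.sum_congr rfl fun i _ => ?_
      show (ξ i q • s) • (1 : R) ⊗ₜ[A] x i = s ⊗ₜ (ξ i q • x i)
      rw [smul_tmul', smul_eq_mul, mul_one, smul_tmul]
  have hgram : gramMatrix X Ξ = (gramMatrix x ξ).map MvPolynomial.C := by
    ext1 i j
    show ξ i (x j) • (1 : R) = MvPolynomial.C (ξ i (x j))
    rw [Algebra.smul_def, mul_one]; rfl
  have hφ1 : φ (Θ (0, 1)) = 1 := by simp [φ]
  have hφsum : ∑ i, Ξ i (Θ (0, 1)) * φ (X i) = 1 := by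
    conv_rhs => rw [← hφ1, ← hX (Θ (0, 1)), map_sum]
    simp only [map_smul, smul_eq_mul]
  have hv : Unimod fun i => φ (X i) :=
    ⟨fun i => Ξ i (Θ (0, 1)), by simpa only [dotProduct, mul_comm] using hφsum⟩
  have hcomm := commEquiv_constantCoeff_of_rankAtStalk hA hf hQ hx hv
    (hgram ▸ vecMul_gramMatrix hX φ)
  have hψ : (fun i => ψ (X i)) = fun i => MvPolynomial.C (MvPolynomial.constantCoeff (φ (X i))) := by
    funext i
    show φ₀ (x i) • (1 : R) = _
    rw [Algebra.smul_def, mul_one]; rfl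
  rw [← hgram, ← hψ] at hcomm
  obtain ⟨Γ, hΓ⟩ := hcomm.exists_linearEquiv hX
  refine ⟨φ₀, fun a => ?_, ⟨?_⟩⟩
  · refine ⟨∑ i, (a * MvPolynomial.constantCoeff (Ξ i (Θ (0, 1)))) • x i, ?_⟩
    have := congrArg MvPolynomial.constantCoeff hφsum
    rw [map_sum, map_one] at this
    simp only [map_mul] at this
    rw [map_sum]
    simp only [map_smul, smul_eq_mul, mul_assoc]
    rw [← Finset.mul_sum]
    exact (congrArg (a * ·) this).trans (mul_one a)
  · have hker : LinearMap.ker (AlgebraTensorModule.lTensor R R φ₀) =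
        (LinearMap.ker φ).comap (Γ : R ⊗[A] Q →ₗ[R] R ⊗[A] Q) := by
      rw [← LinearMap.ker_comp, hΓ]
      exact (LinearEquiv.ker_comp _ _).symm
    let j : P →ₗ[R] R ⊗[A] Q := Θ.toLinearMap ∘ₗ LinearMap.inl R P R
    have hj : Function.Injective j := Θ.injective.comp LinearMap.inl_injective
    have hrange : LinearMap.range j = LinearMap.ker φ := by
      ext y
      constructor
      · rintro ⟨p, rfl⟩
        simp [φ, j]
      · intro hy
        refine ⟨(Θ.symm y).1, ?_⟩
        have hy' : (Θ.symm y).2 = 0 := hy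
        show Θ ((Θ.symm y).1, 0) = y
        rw [← hy', Prod.mk.eta, LinearEquiv.apply_symm_apply]
    exact (LinearEquiv.ofInjective j hj).trans ((LinearEquiv.ofEq _ _ hrange).trans
      ((Γ.ofSubmodule' (LinearMap.ker φ)).symm.trans ((LinearEquiv.ofEq _ _ hker.symm).trans
        (LinearMap.tensorKerEquiv R R φ₀).symm)))

end FinalStep

end Preliminaries

theorem extended_of_stably_extended_polynomial_rank_dim
    (A : Type u) [CommRing A] [IsNoetherianRing A] (d : ℕ) (hdim : ringKrullDim A = d)
    (hd : IsUnit ((Nat.factorial d : ℕ) : A)) (n : ℕ)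
    (P : Type u) [AddCommGroup P] [Module (MvPolynomial (Fin n) A) P]
    [Module.Finite (MvPolynomial (Fin n) A) P]
    [Module.Projective (MvPolynomial (Fin n) A) P]
    (hrank : HasRank (MvPolynomial (Fin n) A) P d)
    (hst : IsExtendedFrom A (MvPolynomial (Fin n) A) (P × MvPolynomial (Fin n) A)) :
    IsExtendedFrom A (MvPolynomial (Fin n) A) P := by
  classical
  obtain ⟨Q, _, _, _, _, ⟨Θ⟩⟩ := hst
  have : Nontrivial A := by
    by_contra hA
    rw [not_nontrivial_iff_subsingleton] at hA
    rw [ringKrullDim_eq_bot_of_subsingleton] at hdim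
    exact WithBot.bot_ne_coe hdim
  have hA : HeightLE A d := fun p hp => by
    have := Ideal.height_le_ringKrullDim_of_isPrime (I := p)
    rw [hdim] at this
    exact_mod_cast this
  have hQ := rankAtStalk_of_prod_equiv MvPolynomial.constantCoeff
    (RingHom.ext fun a => MvPolynomial.constantCoeff_C _ a) hrank Θ
  obtain ⟨φ, hφ, e⟩ := exists_ker_equiv_of_prod_equiv hA hd hQ Θ
  exact ⟨LinearMap.ker φ, inferInstance, inferInstance, inferInstance,
    Module.Projective.ker_of_surjective hφ, e⟩
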